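/- Assume ZF + I_{0,λ} where λ is even, let j : 𝓛 → 𝓛 be elementary with crit(j) < λ, let j⁻ = j↾V_{λ+2}^𝓛, and let 𝓛[j⁻] = L(V_{λ+1}, j⁻). If η ≤ λ is a limit ordinal and η-DC holds in V, then η-DC holds in 𝓛 and η-DC holds in 𝓛[j⁻]. -/

import Mathlib

set_option autoImplicit false
set_option maxHeartbeats 1000000

/-
Semantic framework for formalizing statements of
"On the consistency of ZF with an elementary embedding from V_{λ+2} into V_{λ+2}".

A model of set theory is a type `M` with a binary relation `E`.  First-order
formulas (in the language of set theory with one additional unary predicate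
symbol, used for theories of the form ZF(j)) are given by the inductive type
`Fml`; `Eval` is Tarskian satisfaction relativized to a class `C`.
`SatZF E P` says that `(M, E)` is a model of ZF in the language with the extra
predicate `P` (separation and replacement are full first-order schemas).

Internal set-theoretic notions (ordinals, the cumulative hierarchy, the
constructible hierarchy over a set via Gödel operations, functions coded by
Kuratowski pairs, trees, posets, ...) are defined by their internal first-order
characterizations.  Classes of a model are predicates `M → Prop`; class
embeddings are functional relations `M → M → Prop`, elementary with respect to
all (external, standard) formulas.
-/

namespace ZFI0

/-- First-order formulas for set theory with one extra unary predicate symbol,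
with de Bruijn-style variables; `Fml n` has free variables among `0, ..., n-1`. -/
inductive Fml : ℕ → Type where
  | mem : {n : ℕ} → Fin n → Fin n → Fml n
  | equ : {n : ℕ} → Fin n → Fin n → Fml n
  | aux : {n : ℕ} → Fin n → Fml n
  | impl : {n : ℕ} → Fml n → Fml n → Fml n
  | neg : {n : ℕ} → Fml n → Fml n
  | all : {n : ℕ} → Fml (n + 1) → Fml n
  | ex : {n : ℕ} → Fml (n + 1) → Fml n
  | allb : {n : ℕ} → Fin n → Fml (n + 1) → Fml n

/-- Δ₀ (bounded) formulas: no unbounded quantifiers. -/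
def IsDelta0 : {n : ℕ} → Fml n → Prop
  | _, Fml.mem _ _ => True
  | _, Fml.equ _ _ => True
  | _, Fml.aux _ => True
  | _, Fml.impl f g => IsDelta0 f ∧ IsDelta0 g
  | _, Fml.neg f => IsDelta0 f
  | _, Fml.all _ => False
  | _, Fml.ex _ => False
  | _, Fml.allb _ f => IsDelta0 f

/-- Σ₁ formulas: existential quantifiers in front of a Δ₀ formula. -/
inductive IsSigma1 : {n : ℕ} → Fml n → Prop where
  | base : ∀ {n : ℕ} (f : Fml n), IsDelta0 f → IsSigma1 f
  | exI : ∀ {n : ℕ} (f : Fml (n + 1)), IsSigma1 f → IsSigma1 (Fml.ex f)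

variable {M : Type}

/-- Satisfaction of a formula, with membership `E`, extra predicate `P`,
relativized to the class `C` (the new variable is put at index `0`). -/
def Eval (E : M → M → Prop) (P : M → Prop) (C : M → Prop) :
    {n : ℕ} → Fml n → (Fin n → M) → Prop
  | _, Fml.mem i j, v => E (v i) (v j)
  | _, Fml.equ i j, v => v i = v j
  | _, Fml.aux i, v => P (v i)
  | _, Fml.impl f g, v => Eval E P C f v → Eval E P C g v
  | _, Fml.neg f, v => ¬ Eval E P C f v
  | _, Fml.all f, v => ∀ x : M, C x → Eval E P C f (Fin.cons x v)
  | _, Fml.ex f, v => ∃ x : M, C x ∧ Eval E P C f (Fin.cons x v)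
  | _, Fml.allb i f, v => ∀ x : M, C x → E x (v i) → Eval E P C f (Fin.cons x v)

/-- The trivial (identically false) extra predicate: plain language of set theory. -/
def NoAux : M → Prop := fun _ => False

/-- The class of all sets. -/
def AllSets : M → Prop := fun _ => True

def SubsetE (E : M → M → Prop) (x y : M) : Prop := ∀ z, E z x → E z y

def TransClass (E : M → M → Prop) (C : M → Prop) : Prop :=
  ∀ x y, C x → E y x → C y

/-- `(M, E)` is a model of ZF in the language with the extra unary predicate `P`
(full separation and replacement schemas for formulas of that language). -/
structure SatZF (E : M → M → Prop) (P : M → Prop) : Prop where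
  ext : ∀ x y : M, (∀ z, E z x ↔ E z y) → x = y
  found : ∀ x : M, (∃ y, E y x) → ∃ y, E y x ∧ ∀ z, E z y → ¬ E z x
  pair : ∀ x y : M, ∃ p, ∀ z, E z p ↔ (z = x ∨ z = y)
  union : ∀ x : M, ∃ u, ∀ z, E z u ↔ ∃ y, E y x ∧ E z y
  power : ∀ x : M, ∃ p, ∀ z, E z p ↔ SubsetE E z x
  infty : ∃ w : M, (∃ z, E z w ∧ ∀ u, ¬ E u z) ∧
    ∀ x, E x w → ∃ s, E s w ∧ ∀ z, E z s ↔ (E z x ∨ z = x)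
  sep : ∀ {n : ℕ} (f : Fml (n + 1)) (v : Fin n → M) (a : M),
    ∃ b, ∀ z, E z b ↔ (E z a ∧ Eval E P AllSets f (Fin.cons z v))
  repl : ∀ {n : ℕ} (f : Fml (n + 2)) (v : Fin n → M) (a : M),
    (∀ x, E x a → ∃! y, Eval E P AllSets f (Fin.cons x (Fin.cons y v))) →
    ∃ b, ∀ y, E y b ↔ ∃ x, E x a ∧ Eval E P AllSets f (Fin.cons x (Fin.cons y v))

/-- The class `C` (with the extra predicate `P`) is a model of ZF. -/
def ClassSatZF (E : M → M → Prop) (P : M → Prop) (C : M → Prop) : Prop :=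
  SatZF (M := {x : M // C x}) (fun a b => E a.1 b.1) (fun a => P a.1)

/- ## Ordinals -/

def TransSet (E : M → M → Prop) (x : M) : Prop := ∀ y, E y x → SubsetE E y x

def IsOrd (E : M → M → Prop) (x : M) : Prop :=
  TransSet E x ∧ ∀ y z, E y x → E z x → (E y z ∨ y = z ∨ E z y)

def IsZero (E : M → M → Prop) (x : M) : Prop := IsOrd E x ∧ ∀ y, ¬ E y x

def IsSuccOf (E : M → M → Prop) (x s : M) : Prop := ∀ z, E z s ↔ (E z x ∨ z = x)

def IsLimitOrd (E : M → M → Prop) (x : M) : Prop :=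
  IsOrd E x ∧ (∃ y, E y x) ∧ ∀ y, E y x → ∃ s, E s x ∧ IsSuccOf E y s

/-- `OrdIter E n x y`: `y` is the `n`-th internal successor of `x`. -/
def OrdIter (E : M → M → Prop) : ℕ → M → M → Prop
  | 0, x, y => x = y
  | n + 1, x, y => ∃ s, IsSuccOf E x s ∧ OrdIter E n s y

/-- An ordinal is even iff it has the form `η + 2n` with `η` a limit ordinal or `0`. -/
def IsEvenOrd (E : M → M → Prop) (l : M) : Prop :=
  ∃ (h : M) (n : ℕ), (IsZero E h ∨ IsLimitOrd E h) ∧ OrdIter E (2 * n) h l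

/-- The least limit ordinal (internal ω). -/
def IsOmegaOrd (E : M → M → Prop) (w : M) : Prop :=
  IsLimitOrd E w ∧ ∀ z, E z w → ¬ IsLimitOrd E z

/-- `w` is the least limit ordinal strictly above `u`. -/
def IsNextLimit (E : M → M → Prop) (u w : M) : Prop :=
  IsLimitOrd E w ∧ E u w ∧ ∀ z, IsLimitOrd E z → E u z → (w = z ∨ E w z)

/- ## Pairs and functions -/

def IsUPair (E : M → M → Prop) (p x y : M) : Prop := ∀ z, E z p ↔ (z = x ∨ z = y)

def IsKPair (E : M → M → Prop) (p x y : M) : Prop :=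
  ∃ a b, IsUPair E a x x ∧ IsUPair E b x y ∧ IsUPair E p a b

def IsKTriple (E : M → M → Prop) (t u v w : M) : Prop :=
  ∃ q, IsKPair E q v w ∧ IsKPair E t u q

def PairIn (E : M → M → Prop) (f x y : M) : Prop := ∃ p, E p f ∧ IsKPair E p x y

def IsFunc (E : M → M → Prop) (f : M) : Prop :=
  (∀ p, E p f → ∃ x y, IsKPair E p x y) ∧
  (∀ x y y', PairIn E f x y → PairIn E f x y' → y = y')

def IsFuncOn (E : M → M → Prop) (f d : M) : Prop :=
  IsFunc E f ∧ ∀ x, (∃ y, PairIn E f x y) ↔ E x d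

def MapsTo (E : M → M → Prop) (f a b : M) : Prop :=
  IsFuncOn E f a ∧ ∀ x y, PairIn E f x y → E y b

def SurjOn (E : M → M → Prop) (f a b : M) : Prop :=
  MapsTo E f a b ∧ ∀ y, E y b → ∃ x, PairIn E f x y

def IsRestrOfFn (E : M → M → Prop) (f d r : M) : Prop :=
  IsFuncOn E r d ∧ ∀ x y, PairIn E r x y ↔ (E x d ∧ PairIn E f x y)

/-- The axiom of choice: every family of nonempty sets has a choice function. -/
def SatAC (E : M → M → Prop) : Prop :=
  ∀ x, (∀ y, E y x → ∃ z, E z y) →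
    ∃ f, IsFuncOn E f x ∧ ∀ y z, PairIn E f y z → E z y

/- ## The cumulative hierarchy -/

def IsVHier (E : M → M → Prop) (H a : M) : Prop :=
  IsOrd E a ∧ IsFunc E H ∧ (∀ b, (∃ y, PairIn E H b y) ↔ (E b a ∨ b = a)) ∧
  ∀ b w, PairIn E H b w →
    ∀ x, E x w ↔ ∃ c u, E c b ∧ PairIn E H c u ∧ SubsetE E x u

/-- `v = V_a`. -/
def IsVStage (E : M → M → Prop) (a v : M) : Prop := ∃ H, IsVHier E H a ∧ PairIn E H a v

/-- `v = V_{l + n}` for an external `n : ℕ`. -/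
def VAt (E : M → M → Prop) (l : M) (n : ℕ) (v : M) : Prop :=
  ∃ s, OrdIter E n l s ∧ IsVStage E s v

/-- `r = rank(x)`: least `r` with `x ⊆ V_r`. -/
def IsRankOf (E : M → M → Prop) (x r : M) : Prop :=
  IsOrd E r ∧ (∃ v, IsVStage E r v ∧ SubsetE E x v) ∧
  ∀ r' v', IsOrd E r' → IsVStage E r' v' → SubsetE E x v' → (r = r' ∨ E r r')

/- ## Gödel operations and the constructible hierarchy over a set -/

def IsGProd (E : M → M → Prop) (z x y : M) : Prop :=
  ∀ w, E w z ↔ ∃ u v, E u x ∧ E v y ∧ IsKPair E w u v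
def IsGMemRel (E : M → M → Prop) (z x y : M) : Prop :=
  ∀ w, E w z ↔ ∃ u v, E u x ∧ E v y ∧ E u v ∧ IsKPair E w u v
def IsGDiff (E : M → M → Prop) (z x y : M) : Prop := ∀ w, E w z ↔ (E w x ∧ ¬ E w y)
def IsGInter (E : M → M → Prop) (z x y : M) : Prop := ∀ w, E w z ↔ (E w x ∧ E w y)
def IsGUnionSet (E : M → M → Prop) (z x : M) : Prop := ∀ w, E w z ↔ ∃ u, E u x ∧ E w u
def IsGDom (E : M → M → Prop) (z x : M) : Prop :=
  ∀ w, E w z ↔ ∃ p u, E p x ∧ IsKPair E p w u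
def IsGConv (E : M → M → Prop) (z x : M) : Prop :=
  ∀ w, E w z ↔ ∃ u v p, E p x ∧ IsKPair E p u v ∧ IsKPair E w v u
def IsGPerm1 (E : M → M → Prop) (z x : M) : Prop :=
  ∀ t, E t z ↔ ∃ u v w t', E t' x ∧ IsKTriple E t' u w v ∧ IsKTriple E t u v w
def IsGPerm2 (E : M → M → Prop) (z x : M) : Prop :=
  ∀ t, E t z ↔ ∃ u v w t', E t' x ∧ IsKTriple E t' v w u ∧ IsKTriple E t u v w

def GClosed (E : M → M → Prop) (c : M) : Prop :=
  (∀ x y z, E x c → E y c →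
    (IsUPair E z x y ∨ IsGProd E z x y ∨ IsGMemRel E z x y ∨
      IsGDiff E z x y ∨ IsGInter E z x y) → E z c) ∧
  (∀ x z, E x c →
    (IsGUnionSet E z x ∨ IsGDom E z x ∨ IsGConv E z x ∨
      IsGPerm1 E z x ∨ IsGPerm2 E z x) → E z c)

/-- `c` is the Gödel-closure of `b`. -/
def IsGClOf (E : M → M → Prop) (b c : M) : Prop :=
  SubsetE E b c ∧ GClosed E c ∧ ∀ c', SubsetE E b c' → GClosed E c' → SubsetE E c c'

/-- `d = Def(l)`: the definable subsets of `l` (via Gödel closure of `l ∪ {l}`). -/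
def IsDefSetOf (E : M → M → Prop) (l d : M) : Prop :=
  ∃ lp c, (∀ z, E z lp ↔ (E z l ∨ z = l)) ∧ IsGClOf E lp c ∧
    ∀ y, E y d ↔ (SubsetE E y l ∧ E y c)

def IsTransClOf (E : M → M → Prop) (x t : M) : Prop :=
  SubsetE E x t ∧ TransSet E t ∧ ∀ t', SubsetE E x t' → TransSet E t' → SubsetE E t t'

/-- `t = trcl({x})`. -/
def IsTCSing (E : M → M → Prop) (x t : M) : Prop :=
  E x t ∧ TransSet E t ∧ ∀ t', E x t' → TransSet E t' → SubsetE E t t'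

/-- `z = L_0(b) = trcl(b) ∪ {b}`. -/
def IsLZero (E : M → M → Prop) (b z : M) : Prop :=
  ∃ t, IsTransClOf E b t ∧ ∀ x, E x z ↔ (E x t ∨ x = b)

/-- `H` is the constructible hierarchy over base `b` up to (and including) stage `a`. -/
def IsLHier (E : M → M → Prop) (b H a : M) : Prop :=
  IsOrd E a ∧ IsFunc E H ∧ (∀ c, (∃ y, PairIn E H c y) ↔ (E c a ∨ c = a)) ∧
  (∀ c z, IsZero E c → PairIn E H c z → IsLZero E b z) ∧
  (∀ c s z w, IsSuccOf E c s → PairIn E H c z → PairIn E H s w → IsDefSetOf E z w) ∧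
  (∀ c z, IsLimitOrd E c → PairIn E H c z →
    ∀ x, E x z ↔ ∃ d u, E d c ∧ PairIn E H d u ∧ E x u)

/-- `l = L_a(b)`. -/
def IsLStage (E : M → M → Prop) (b a l : M) : Prop :=
  ∃ H, IsLHier E b H a ∧ PairIn E H a l

/-- Membership in the constructible closure `L(b)` of the set `b`.
`L(V_{λ+1})` is `InL E v1` where `v1 = V_{λ+1}`; `L(V_{λ+1}, A)` for a set `A`
is `InL E b` where `b = {v1, A}`. -/
def InL (E : M → M → Prop) (b x : M) : Prop := ∃ a l, IsLStage E b a l ∧ E x l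

/-- `w = V_{λ+2}^{L(V_{λ+1})} = 𝒫(V_{λ+1}) ∩ L(V_{λ+1})` (as a set of `M`). -/
def IsV2L (E : M → M → Prop) (v1 w : M) : Prop :=
  ∀ x, E x w ↔ (InL E v1 x ∧ SubsetE E x v1)

/- ## Class embeddings -/

def ClassFun (C : M → Prop) (J : M → M → Prop) : Prop :=
  (∀ x, C x → ∃ y, J x y) ∧ (∀ x y, J x y → C x ∧ C y) ∧
  (∀ x y y', J x y → J x y' → y = y')

/-- `J` is (the graph of) an elementary embedding of the class `C` into itself. -/
def ElemOn (E : M → M → Prop) (C : M → Prop) (J : M → M → Prop) : Prop :=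
  ClassFun C J ∧ ∀ {n : ℕ} (f : Fml n) (v w : Fin n → M),
    (∀ i, J (v i) (w i)) → (Eval E NoAux C f v ↔ Eval E NoAux C f w)

/-- `J` is an elementary embedding from class `C` into class `D`. -/
def ElemBetween (E : M → M → Prop) (C D : M → Prop) (J : M → M → Prop) : Prop :=
  (∀ x, C x → ∃ y, J x y) ∧ (∀ x y, J x y → C x ∧ D y) ∧
  (∀ x y y', J x y → J x y' → y = y') ∧
  ∀ {n : ℕ} (f : Fml n) (v w : Fin n → M),
    (∀ i, J (v i) (w i)) → (Eval E NoAux C f v ↔ Eval E NoAux D f w)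

/-- `J` is a Σ₁-elementary embedding of the class `C` into itself. -/
def Sigma1ElemOn (E : M → M → Prop) (C : M → Prop) (J : M → M → Prop) : Prop :=
  ClassFun C J ∧ ∀ {n : ℕ} (f : Fml n), IsSigma1 f → ∀ (v w : Fin n → M),
    (∀ i, J (v i) (w i)) → (Eval E NoAux C f v ↔ Eval E NoAux C f w)

/-- `k` is an internal function which is an elementary embedding of `(a, E)` into itself. -/
def SetElemEmbOn (E : M → M → Prop) (a k : M) : Prop :=
  MapsTo E k a a ∧ ∀ {n : ℕ} (f : Fml n) (v w : Fin n → M),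
    (∀ i, PairIn E k (v i) (w i)) →
    (Eval E NoAux (fun z => E z a) f v ↔ Eval E NoAux (fun z => E z a) f w)

/-- `k` is an internal function which is a Σ₁-elementary embedding of `(a, E)` into itself. -/
def SetSigma1ElemEmbOn (E : M → M → Prop) (a k : M) : Prop :=
  MapsTo E k a a ∧ ∀ {n : ℕ} (f : Fml n), IsSigma1 f → ∀ (v w : Fin n → M),
    (∀ i, PairIn E k (v i) (w i)) →
    (Eval E NoAux (fun z => E z a) f v ↔ Eval E NoAux (fun z => E z a) f w)

def NontrivialRel (J : M → M → Prop) : Prop := ∃ x y, J x y ∧ x ≠ y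

/-- The critical point of `J` exists and is `< l`. -/
def CritBelow (E : M → M → Prop) (J : M → M → Prop) (l : M) : Prop :=
  ∃ k, IsOrd E k ∧ E k l ∧ ¬ J k k ∧ ∀ b, IsOrd E b → E b k → J b b

/-- `J` is an `I_{0,λ}`-embedding: a nontrivial elementary embedding of
`L(V_{λ+1})` into itself with critical point `< λ` (here `v1 = V_{λ+1}`, `l = λ`). -/
def I0Emb (E : M → M → Prop) (l v1 : M) (J : M → M → Prop) : Prop :=
  ElemOn E (InL E v1) J ∧ CritBelow E J l

/-- The unary predicate coding the graph of the class embedding `J`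
(used for the language of the theory ZF(j)). -/
def JPred (E : M → M → Prop) (J : M → M → Prop) : M → Prop :=
  fun p => ∃ x y, IsKPair E p x y ∧ J x y

/-- `r` is an internal function with domain `a` whose graph is contained in `J`,
i.e. `r = J ↾ a`. -/
def CodesRestr (E : M → M → Prop) (J : M → M → Prop) (a r : M) : Prop :=
  IsFuncOn E r a ∧ ∀ x y, PairIn E r x y → J x y

/-- `m = μ_J = { X ∈ 𝒫(V_{λ+1}) ∩ L(V_{λ+1}) : J↾V_λ ∈ J(X) }`
(here `vl = V_λ`, `v1 = V_{λ+1}`). -/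
def IsMuSet (E : M → M → Prop) (J : M → M → Prop) (vl v1 m : M) : Prop :=
  ∀ X, E X m ↔ (InL E v1 X ∧ SubsetE E X v1 ∧
    ∃ r Y, CodesRestr E J vl r ∧ J X Y ∧ E r Y)

def RelComp (J1 J0 : M → M → Prop) : M → M → Prop := fun x z => ∃ y, J0 x y ∧ J1 y z

/- ## Silver indiscernibles, sharps, properness -/

def IncrTuple (E : M → M → Prop) {n : ℕ} (v : Fin n → M) : Prop :=
  ∀ i j : Fin n, i < j → E (v i) (v j)

/-- `I` is the (club, proper-class) class of Silver indiscernibles for `L(V_{λ+1})`: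
ordinals, unbounded, closed, indiscernible with parameters from `V_{λ+1}`,
and generating all of `L(V_{λ+1})`. -/
def IsSilverClass (E : M → M → Prop) (v1 : M) (I : M → Prop) : Prop :=
  (∀ x, I x → IsOrd E x) ∧
  (∀ a, IsOrd E a → ∃ i, I i ∧ E a i) ∧
  (∀ a, IsLimitOrd E a → (∀ b, E b a → ∃ i, I i ∧ E b i ∧ E i a) → I a) ∧
  (∀ {n m : ℕ} (f : Fml (n + m)) (p : Fin m → M) (s t : Fin n → M),
    (∀ i, E (p i) v1) → (∀ i, I (s i)) → (∀ i, I (t i)) →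
    IncrTuple E s → IncrTuple E t →
    (Eval E NoAux (InL E v1) f (Fin.append s p) ↔
      Eval E NoAux (InL E v1) f (Fin.append t p))) ∧
  (∀ x, InL E v1 x → ∃ (n m : ℕ) (f : Fml (n + m + 1)) (p : Fin m → M) (s : Fin n → M),
    (∀ i, E (p i) v1) ∧ (∀ i, I (s i)) ∧
    ∀ y, InL E v1 y →
      (Eval E NoAux (InL E v1) f (Fin.cons y (Fin.append s p)) ↔ y = x))

/-- A nontrivial elementary embedding of `L(V_{λ+1})` into itself with
critical point `> λ` (the witness for the existence of `V_{λ+1}^#`). -/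
def SharpEmb (E : M → M → Prop) (l v1 : M) (J : M → M → Prop) : Prop :=
  ElemOn E (InL E v1) J ∧ NontrivialRel J ∧
  ∀ b, IsOrd E b → (E b l ∨ b = l) → J b b

/-- `R` is a definable class relation of `(M, E, P)` (with set parameters). -/
def DefClassRel (E : M → M → Prop) (P : M → Prop) (R : M → M → Prop) : Prop :=
  ∃ (n : ℕ) (f : Fml (n + 2)) (p : Fin n → M),
    ∀ x y, R x y ↔ Eval E P AllSets f (Fin.cons x (Fin.cons y p))

/-- `R` is a class of the inner model `W`: definable over `W` from parameters in `W`. -/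
def DefOverClassRel (E : M → M → Prop) (W : M → Prop) (R : M → M → Prop) : Prop :=
  ∃ (n : ℕ) (f : Fml (n + 2)) (p : Fin n → M), (∀ i, W (p i)) ∧
    ∀ x y, W x → W y → (R x y ↔ Eval E NoAux W f (Fin.cons x (Fin.cons y p)))

/-- `V_{λ+1}^#` exists (in the model `(M, E, P)`): there is a definable-class
nontrivial elementary embedding of `L(V_{λ+1})` into itself with critical point `> λ`. -/
def SharpExists (E : M → M → Prop) (P : M → Prop) (l v1 : M) : Prop :=
  ∃ J, DefClassRel E P J ∧ SharpEmb E l v1 J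

/-- `J` is proper: either `V_{λ+1}^#` does not exist, or it exists and `J`
fixes the Silver indiscernibles pointwise. -/
def ProperEmb (E : M → M → Prop) (P : M → Prop) (l v1 : M) (J : M → M → Prop) : Prop :=
  ¬ SharpExists E P l v1 ∨
    (SharpExists E P l v1 ∧ ∀ I, IsSilverClass E v1 I → ∀ x, I x → J x x)

/-- The standard decomposition `J = J1 ∘ J0` of an `I_{0,λ}`-embedding: `J0`, `J1`
elementary, `J0` proper, `crit(J1) ≥ λ`, and `J1 = id` if `V_{λ+1}^#` does not exist. -/
def StdDecomp (E : M → M → Prop) (P : M → Prop) (l v1 : M)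
    (J J0 J1 : M → M → Prop) : Prop :=
  ElemOn E (InL E v1) J0 ∧ ElemOn E (InL E v1) J1 ∧
  (∀ x z, InL E v1 x → (J x z ↔ RelComp J1 J0 x z)) ∧
  ProperEmb E P l v1 J0 ∧
  (∀ b, IsOrd E b → E b l → J1 b b) ∧
  (¬ SharpExists E P l v1 → ∀ x, InL E v1 x → J1 x x)

/-- `sh` is (a set representing) `V_{λ+1}^#`. -/
def IsVSharpSet (E : M → M → Prop) (v1 sh : M) : Prop :=
  SubsetE E sh v1 ∧ ¬ InL E v1 sh ∧ ∃ I, IsSilverClass E v1 I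

/- ## Θ, regularity, cofinality -/

/-- `th = Θ_v^W`: the supremum of the ordinals onto which `v` surjects by a function in `W`. -/
def IsThetaOf (E : M → M → Prop) (W : M → Prop) (v th : M) : Prop :=
  IsOrd E th ∧
  (∀ a, E a th → ∃ b f, (E a b ∨ a = b) ∧ W f ∧ SurjOn E f v b) ∧
  (∀ a f, IsOrd E a → W f → SurjOn E f v a → E a th)

/-- `th` is a regular ordinal in the inner model `W`. -/
def RegularIn (E : M → M → Prop) (W : M → Prop) (th : M) : Prop :=
  ¬ ∃ a f, IsOrd E a ∧ E a th ∧ W f ∧ MapsTo E f a th ∧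
    ∀ b, E b th → ∃ x y, PairIn E f x y ∧ (E b y ∨ b = y)

/-- There is a cofinal ω-sequence in `th` (i.e. `cof(th) = ω` in `V`). -/
def CofinalOmegaSeq (E : M → M → Prop) (th : M) : Prop :=
  ∃ f : ℕ → M, (∀ n, IsOrd E (f n) ∧ E (f n) th) ∧
    ∀ b, E b th → ∃ n, E b (f n) ∨ b = f n

/- ## Dependent choice -/

/-- `T` is a tree of height `≤ h` on `X`: a set of functions `f : b → X` (`b < h`)
closed under initial segments. -/
def IsTreeOn (E : M → M → Prop) (T h X : M) : Prop :=
  (∀ f, E f T → ∃ b, IsOrd E b ∧ E b h ∧ MapsTo E f b X) ∧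
  (∀ f d b r, E f T → IsFuncOn E f d → E b d → IsRestrOfFn E f b r → E r T)

/-- `b` is a maximal branch of the tree `T` of height `≤ h` on `X`. -/
def IsMaxBranch (E : M → M → Prop) (T h X b : M) : Prop :=
  ∃ a, IsOrd E a ∧ (E a h ∨ a = h) ∧ MapsTo E b a X ∧
    ((E b T ∧ ¬ ∃ g dg, E g T ∧ IsFuncOn E g dg ∧ E a dg ∧ IsRestrOfFn E g a b) ∨
     ((IsZero E a ∨ IsLimitOrd E a) ∧ ¬ E b T ∧
       ∀ c, E c a → ∃ r, E r T ∧ IsRestrOfFn E b c r))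

/-- `h`-DC relativized to the class `W`. -/
def DCOn (E : M → M → Prop) (h : M) (W : M → Prop) : Prop :=
  ∀ X T, W X → W T → IsTreeOn E T h X → ∃ b, W b ∧ IsMaxBranch E T h X b

/-- `h`-DC (in the full universe). -/
def DCAt (E : M → M → Prop) (h : M) : Prop := DCOn E h AllSets

/- ## OD and HOD -/

/-- `x` is definable over the class `C` from parameters in `OR ∪ Xc`. -/
def ODIn (E : M → M → Prop) (C : M → Prop) (Xc : M → Prop) (x : M) : Prop :=
  ∃ (n : ℕ) (f : Fml (n + 1)) (p : Fin n → M),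
    (∀ i, C (p i)) ∧ (∀ i, IsOrd E (p i) ∨ Xc (p i)) ∧
    ∀ z, C z → (Eval E NoAux C f (Fin.cons z p) ↔ z = x)

/-- `x ∈ HOD^C(Xc)`: every member of `trcl({x})` is in `OD^C(Xc)`. -/
def HODIn (E : M → M → Prop) (C : M → Prop) (Xc : M → Prop) (x : M) : Prop :=
  ∀ t, IsTCSing E x t → ∀ y, E y t → ODIn E C Xc y

/-- `y ∈ Hull^D(Xp)`: `y` is definable over the structure `(D, E)` from parameters
satisfying `Xp`. -/
def InHull (E : M → M → Prop) (D : M → Prop) (Xp : M → Prop) (y : M) : Prop :=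
  ∃ (n : ℕ) (f : Fml (n + 1)) (p : Fin n → M), (∀ i, Xp (p i)) ∧
    ∀ z, D z → (Eval E NoAux D f (Fin.cons z p) ↔ z = y)

/- ## Ultrapowers -/

/-- `f` is an internal function from `v` into the class `C`, with `f ∈ C`. -/
def FnInto (E : M → M → Prop) (C : M → Prop) (v f : M) : Prop :=
  C f ∧ IsFuncOn E f v ∧ ∀ x y, PairIn E f x y → C y

/-- `{ k ∈ v : Q k }` is a set of measure one for `mu`. -/
def MeasOne (E : M → M → Prop) (mu : M → Prop) (v : M) (Q : M → Prop) : Prop :=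
  ∃ X, (∀ z, E z X ↔ (E z v ∧ Q z)) ∧ mu X

/-- Satisfaction in the ultrapower `Ult₀(C, mu)` (elements represented by
internal functions `f : v → C` with `f ∈ C`). -/
def UltSat (E : M → M → Prop) (C : M → Prop) (v : M) (mu : M → Prop) :
    {n : ℕ} → Fml n → (Fin n → M) → Prop
  | _, Fml.mem i j, fs => MeasOne E mu v (fun k =>
      ∃ y z, PairIn E (fs i) k y ∧ PairIn E (fs j) k z ∧ E y z)
  | _, Fml.equ i j, fs => MeasOne E mu v (fun k =>
      ∃ y z, PairIn E (fs i) k y ∧ PairIn E (fs j) k z ∧ y = z)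
  | _, Fml.aux _, _ => False
  | _, Fml.impl f g, fs => UltSat E C v mu f fs → UltSat E C v mu g fs
  | _, Fml.neg f, fs => ¬ UltSat E C v mu f fs
  | _, Fml.all f, fs => ∀ g, FnInto E C v g → UltSat E C v mu f (Fin.cons g fs)
  | _, Fml.ex f, fs => ∃ g, FnInto E C v g ∧ UltSat E C v mu f (Fin.cons g fs)
  | _, Fml.allb i f, fs => ∀ g, FnInto E C v g →
      MeasOne E mu v (fun k => ∃ y z, PairIn E g k y ∧ PairIn E (fs i) k z ∧ E y z) →
      UltSat E C v mu f (Fin.cons g fs)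

/-- Łoś's theorem holds for `Ult₀(C, mu)`. -/
def LosOK (E : M → M → Prop) (C : M → Prop) (v : M) (mu : M → Prop) : Prop :=
  ∀ {n : ℕ} (f : Fml n) (fs : Fin n → M), (∀ i, FnInto E C v (fs i)) →
    (UltSat E C v mu f fs ↔ MeasOne E mu v (fun k =>
      ∃ ys : Fin n → M, (∀ i, PairIn E (fs i) k (ys i)) ∧ Eval E NoAux C f ys))

/-- `Rep f x` means `x = [f]` under a transitive collapse of `Ult₀(C, mu)` onto the
class `D`; this packages: Łoś's theorem, wellfoundedness, extensionality, `Ult = D`,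
and `Jm` being the ultrapower embedding `C → D`. -/
def UltRepOKB (E : M → M → Prop) (C D : M → Prop) (v : M) (mu : M → Prop)
    (Rep : M → M → Prop) (Jm : M → M → Prop) : Prop :=
  (∀ f, FnInto E C v f → ∃ x, D x ∧ Rep f x) ∧
  (∀ f x, Rep f x → FnInto E C v f ∧ D x) ∧
  (∀ x, D x → ∃ f, Rep f x) ∧
  (∀ {n : ℕ} (f : Fml n) (fs xs : Fin n → M), (∀ i, Rep (fs i) (xs i)) →
    (Eval E NoAux D f xs ↔ MeasOne E mu v (fun k =>
      ∃ ys : Fin n → M, (∀ i, PairIn E (fs i) k (ys i)) ∧ Eval E NoAux C f ys))) ∧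
  (∀ x y, C x → (Jm x y ↔ ∃ f, (∀ p, E p f ↔ ∃ k, E k v ∧ IsKPair E p k x) ∧ Rep f y))

def UltRepOK (E : M → M → Prop) (C : M → Prop) (v : M) (mu : M → Prop)
    (Rep : M → M → Prop) (Jm : M → M → Prop) : Prop :=
  UltRepOKB E C C v mu Rep Jm

/-- `Jm` is the ultrapower map of `Ult₀(C, mu)`, the ultrapower satisfying Łoś's
theorem, being wellfounded and equal to `C` itself. -/
def IsUltPowMap (E : M → M → Prop) (C : M → Prop) (v : M) (mu : M → Prop)
    (Jm : M → M → Prop) : Prop :=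
  ∃ Rep, UltRepOK E C v mu Rep Jm

/-- `Jm` is the ultrapower map of `Ult₀(C, mu)`, with the ultrapower transitive
and equal to `D`. -/
def IsUltPowMapB (E : M → M → Prop) (C D : M → Prop) (v : M) (mu : M → Prop)
    (Jm : M → M → Prop) : Prop :=
  ∃ Rep, UltRepOKB E C D v mu Rep Jm

/- ## Iteration systems -/

/-- Data for a transfinite iteration: `cls a` is the `a`-th iterate (a class),
`meas a` the `a`-th measure (a class of sets), `emb a` the `a`-th ultrapower
embedding, `imap a b` the iteration map from stage `a` to stage `b`. -/
structure IterData (M : Type) where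
  cls : M → M → Prop
  meas : M → M → Prop
  emb : M → M → M → Prop
  imap : M → M → M → M → Prop

/-- The successor-step measure: `Y ∈ μ_{a+1}` iff `Y ∈ j_{a,tgt}(rg(π) ∩ μ_a)`
for some `π : V_{λ_a+1}^{𝓛_a} → V_{λ_a+2}^{𝓛_a}` in `𝓛_a`. -/
def IterMeasStep (E : M → M → Prop) (S : IterData M) (z0 v1 v2L a tgt Y : M) : Prop :=
  ∃ v1a v2a pi Xr jX, S.imap z0 a v1 v1a ∧ S.imap z0 a v2L v2a ∧
    S.cls a pi ∧ MapsTo E pi v1a v2a ∧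
    (∀ z, E z Xr ↔ (S.meas a z ∧ ∃ x, PairIn E pi x z)) ∧
    S.imap a tgt Xr jX ∧ E Y jX

/-- `S` is an iteration of `(C0, mu0)` (as in Definition "iterates" of the paper)
of length `d`: all iterates are defined (and, being realized as classes of `M`
with the true membership `E`, wellfounded). -/
def IsIterSys (E : M → M → Prop) (C0 : M → Prop) (mu0 : M → Prop)
    (z0 v1 v2L d : M) (S : IterData M) : Prop :=
  IsZero E z0 ∧
  (∀ x, S.cls z0 x ↔ C0 x) ∧ (∀ X, S.meas z0 X ↔ mu0 X) ∧
  (∀ a, IsOrd E a → (E a d ∨ a = d) → ∀ x y, S.imap a a x y ↔ (S.cls a x ∧ x = y)) ∧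
  (∀ a b c, IsOrd E a → IsOrd E b → IsOrd E c → (E a b ∨ a = b) → (E b c ∨ b = c) →
    (E c d ∨ c = d) → ∀ x z, S.imap a c x z ↔ ∃ y, S.imap a b x y ∧ S.imap b c y z) ∧
  (∀ a b, IsOrd E a → IsOrd E b → (E a b ∨ a = b) → (E b d ∨ b = d) →
    ElemBetween E (S.cls a) (S.cls b) (S.imap a b)) ∧
  (∀ a s, IsOrd E a → IsSuccOf E a s → (E s d ∨ s = d) →
    (∀ x, S.cls s x ↔ S.cls a x) ∧
    (∀ x y, S.imap a s x y ↔ S.emb a x y) ∧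
    (∀ Y, S.meas s Y ↔ IterMeasStep E S z0 v1 v2L a s Y)) ∧
  (∀ a v1a, IsOrd E a → (E a d ∨ a = d) → S.imap z0 a v1 v1a →
    IsUltPowMap E (S.cls a) v1a (S.meas a) (S.emb a)) ∧
  (∀ h, IsLimitOrd E h → (E h d ∨ h = d) →
    (∀ x, S.cls h x → ∃ a x0, IsOrd E a ∧ E a h ∧ S.imap a h x0 x) ∧
    (∀ Y, S.meas h Y ↔ ∃ a, IsOrd E a ∧ E a h ∧ IterMeasStep E S z0 v1 v2L a h Y))

/-- The `a`-th measure of the internal (linear) iteration of `N` by the measure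
set `m`: the image of `m` under the iteration map. -/
def LinMeasAt (E : M → M → Prop) (S : IterData M) (z0 m a : M) : M → Prop :=
  fun X => ∃ ma, S.imap z0 a m ma ∧ E X ma

/-- `S` is the internal linear iteration of the proper class `C0 ⊨ ZF` by the
measure `m ∈ C0` on `v1`, of length `d` (all iterates wellfounded). -/
def IsLinIterSys (E : M → M → Prop) (C0 : M → Prop) (z0 v1 m d : M)
    (S : IterData M) : Prop :=
  IsZero E z0 ∧ (∀ x, S.cls z0 x ↔ C0 x) ∧
  (∀ a, IsOrd E a → (E a d ∨ a = d) → ∀ x y, S.imap a a x y ↔ (S.cls a x ∧ x = y)) ∧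
  (∀ a b c, IsOrd E a → IsOrd E b → IsOrd E c → (E a b ∨ a = b) → (E b c ∨ b = c) →
    (E c d ∨ c = d) → ∀ x z, S.imap a c x z ↔ ∃ y, S.imap a b x y ∧ S.imap b c y z) ∧
  (∀ a b, IsOrd E a → IsOrd E b → (E a b ∨ a = b) → (E b d ∨ b = d) →
    ElemBetween E (S.cls a) (S.cls b) (S.imap a b)) ∧
  (∀ a s, IsOrd E a → IsSuccOf E a s → (E s d ∨ s = d) →
    (∀ x y, S.imap a s x y ↔ S.emb a x y) ∧
    ∀ v1a, S.imap z0 a v1 v1a →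
      IsUltPowMapB E (S.cls a) (S.cls s) v1a (LinMeasAt E S z0 m a) (S.emb a)) ∧
  (∀ h, IsLimitOrd E h → (E h d ∨ h = d) →
    ∀ x, S.cls h x → ∃ a x0, IsOrd E a ∧ E a h ∧ S.imap a h x0 x)

/-- Data for the length-(ω+1) iteration: measures `meas n`, ultrapower embeddings
`emb n = j_n`, the direct limit class `limC = 𝓛_ω`, the direct limit maps
`limMap n = j_{nω}`, the limit measure `limMeas = μ_ω`, and `limEmb = j_ω`. -/
structure OmegaIterData (M : Type) where
  meas : ℕ → M → Prop
  emb : ℕ → M → M → Prop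
  limC : M → Prop
  limMap : ℕ → M → M → Prop
  limMeas : M → Prop
  limEmb : M → M → Prop

def OmegaMeasStep (E : M → M → Prop) (C0 : M → Prop) (mu : M → Prop)
    (Jn : M → M → Prop) (v1 v2L Y : M) : Prop :=
  ∃ pi Xr jX, C0 pi ∧ MapsTo E pi v1 v2L ∧
    (∀ z, E z Xr ↔ (mu z ∧ ∃ x, PairIn E pi x z)) ∧ Jn Xr jX ∧ E Y jX

/-- `S` is the length-(ω+1) iteration of `(L(V_{λ+1}), mu0)`. -/
def IsOmegaIter (E : M → M → Prop) (v1 v2L : M) (mu0 : M → Prop)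
    (S : OmegaIterData M) : Prop :=
  (∀ X, S.meas 0 X ↔ mu0 X) ∧
  (∀ n Y, S.meas (n + 1) Y ↔
    OmegaMeasStep E (InL E v1) (S.meas n) (S.emb n) v1 v2L Y) ∧
  (∀ n, IsUltPowMap E (InL E v1) v1 (S.meas n) (S.emb n)) ∧
  (∀ n x y, S.limMap n x y ↔ ∃ z, S.emb n x z ∧ S.limMap (n + 1) z y) ∧
  (∀ y, S.limC y ↔ ∃ n x, S.limMap n x y) ∧
  (∀ n, ElemBetween E (InL E v1) S.limC (S.limMap n)) ∧
  (∀ Y, S.limMeas Y ↔ ∃ n pi Xr jX, InL E v1 pi ∧ MapsTo E pi v1 v2L ∧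
    (∀ z, E z Xr ↔ (S.meas n z ∧ ∃ x, PairIn E pi x z)) ∧
    S.limMap n Xr jX ∧ E Y jX) ∧
  (∀ v1w, S.limMap 0 v1 v1w → IsUltPowMap E S.limC v1w S.limMeas S.limEmb)

/- ## Forcing -/

def IsPosetOn (E : M → M → Prop) (P le : M) : Prop :=
  (∀ q, E q le → ∃ x y, IsKPair E q x y ∧ E x P ∧ E y P) ∧
  (∀ p, E p P → PairIn E le p p) ∧
  (∀ p q r, PairIn E le p q → PairIn E le q r → PairIn E le p r) ∧
  (∀ p q, PairIn E le p q → PairIn E le q p → p = q)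

def CompatIn (E : M → M → Prop) (P le p q : M) : Prop :=
  ∃ r, E r P ∧ PairIn E le r p ∧ PairIn E le r q

def IsDenseIn (E : M → M → Prop) (P le D : M) : Prop :=
  SubsetE E D P ∧ ∀ p, E p P → ∃ q, E q D ∧ PairIn E le q p

def IsFilterCl (E : M → M → Prop) (P le : M) (G : M → Prop) : Prop :=
  (∀ p, G p → E p P) ∧ (∃ p, G p) ∧
  (∀ p q, G p → G q → ∃ r, G r ∧ PairIn E le r p ∧ PairIn E le r q) ∧
  (∀ p q, G p → E q P → PairIn E le p q → G q)

def IsGenericOver (E : M → M → Prop) (W : M → Prop) (P le : M) (G : M → Prop) : Prop :=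
  IsFilterCl E P le G ∧ ∀ D, W D → IsDenseIn E P le D → ∃ p, G p ∧ E p D

def IsAntichainIn (E : M → M → Prop) (P le A : M) : Prop :=
  SubsetE E A P ∧ ∀ p q, E p A → E q A → p ≠ q → ¬ CompatIn E P le p q

/-- `Wx = W[G]`: the least transitive ZF-class extending `W` and containing `G`
(as a set). -/
def ExtEquals (E : M → M → Prop) (W : M → Prop) (G : M → Prop) (Wx : M → Prop) : Prop :=
  (∀ x, W x → Wx x) ∧ TransClass E Wx ∧ ClassSatZF E NoAux Wx ∧
  (∃ g, Wx g ∧ ∀ x, E x g ↔ G x) ∧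
  ∀ C : M → Prop, TransClass E C → ClassSatZF E NoAux C → (∀ x, W x → C x) →
    (∀ g, (∀ x, E x g ↔ G x) → C g) → ∀ x, Wx x → C x

/-- `Wx` is a set-generic extension of `W`. -/
def IsSetGenExt (E : M → M → Prop) (W Wx : M → Prop) : Prop :=
  ∃ P le G, W P ∧ W le ∧ IsPosetOn E P le ∧ IsGenericOver E W P le G ∧
    ExtEquals E W G Wx

/- ## The trees T_j and their derivatives -/

/-- `g = l + a·ω` (internal ordinal arithmetic, via the iteration of
"next limit ordinal"). -/
def LamAlphaOmega (E : M → M → Prop) (l a g : M) : Prop :=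
  ∃ F s, IsSuccOf E a s ∧ IsFuncOn E F s ∧
    (∀ z y, IsZero E z → PairIn E F z y → y = l) ∧
    (∀ c sc u w, IsSuccOf E c sc → E sc s → PairIn E F c u → PairIn E F sc w →
      IsNextLimit E u w) ∧
    (∀ c w, IsLimitOrd E c → PairIn E F c w →
      ∀ x, E x w ↔ ∃ dd u, E dd c ∧ PairIn E F dd u ∧ E x u) ∧
    PairIn E F a g

/-- `t` is a node of the tree `T_j`: a map `t : (λ + α·ω) → (λ + β·ω)` (for
limits `α, β < Θ`) such that `j ∪ t` extends to a partial map with domain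
`L_α(V_{λ+1})` which is Σ₁-elementary with respect to truth in `L_Θ(V_{λ+1})`. -/
def IsTjNode (E : M → M → Prop) (l v1 th lth j t : M) : Prop :=
  ∃ a b ga gb la el,
    IsLimitOrd E a ∧ E a th ∧ IsLimitOrd E b ∧ E b th ∧
    LamAlphaOmega E l a ga ∧ LamAlphaOmega E l b gb ∧
    MapsTo E t ga gb ∧
    IsLStage E v1 a la ∧ IsFuncOn E el la ∧
    (∀ x y, PairIn E j x y → PairIn E el x y) ∧
    (∀ x y, PairIn E t x y → PairIn E el x y) ∧
    (∀ x y, PairIn E el x y → E y lth) ∧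
    (∀ {n : ℕ} (f : Fml n), IsSigma1 f → ∀ v w : Fin n → M,
      (∀ i, PairIn E el (v i) (w i)) →
      (Eval E NoAux (fun z => E z lth) f v ↔ Eval E NoAux (fun z => E z lth) f w))

/-- `T = T_j` (as an internal set). -/
def IsTjSet (E : M → M → Prop) (l v1 th lth j T : M) : Prop :=
  ∀ t, E t T ↔ IsTjNode E l v1 th lth j t

/-- `s` extends `t` as a node (i.e. `t = s ↾ dom(t)`). -/
def NodeExtends (E : M → M → Prop) (s t : M) : Prop :=
  ∃ dt, IsFuncOn E t dt ∧ IsRestrOfFn E s dt t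

/-- `T'` is the derivative of `T`: remove the nodes `t` whose extensions in `T`
have domains bounded below `th`. -/
def IsDerivOf (E : M → M → Prop) (th T T' : M) : Prop :=
  ∀ t, E t T' ↔ (E t T ∧ ∀ b, E b th →
    ∃ s ds, E s T ∧ IsFuncOn E s ds ∧ NodeExtends E s t ∧ (E b ds ∨ b = ds))

def IsDerivHier (E : M → M → Prop) (th T0 H a : M) : Prop :=
  IsOrd E a ∧ IsFunc E H ∧ (∀ c, (∃ y, PairIn E H c y) ↔ (E c a ∨ c = a)) ∧
  (∀ c z, IsZero E c → PairIn E H c z → z = T0) ∧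
  (∀ c s z w, IsSuccOf E c s → PairIn E H c z → PairIn E H s w → IsDerivOf E th z w) ∧
  (∀ c z, IsLimitOrd E c → PairIn E H c z →
    ∀ x, E x z ↔ ∀ dd u, E dd c → PairIn E H dd u → E x u)

/-- `T = T_{j,a}`, the `a`-th derivative of `T0 = T_j`. -/
def IsTjDerivAt (E : M → M → Prop) (th T0 a T : M) : Prop :=
  ∃ H, IsDerivHier E th T0 H a ∧ PairIn E H a T

/-- `t ∈ T_{j,∞} = ⋂_{a ∈ OR} T_{j,a}`. -/
def InTjInfty (E : M → M → Prop) (th T0 t : M) : Prop :=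
  E t T0 ∧ ∀ a T, IsOrd E a → IsTjDerivAt E th T0 a T → E t T

/-- `B` is a branch of length `th` through the tree `T` (as a class of nodes:
linearly ordered by extension, with domains cofinal in `th`). -/
def IsThBranchCl (E : M → M → Prop) (th T : M) (B : M → Prop) : Prop :=
  (∀ t, B t → E t T) ∧
  (∀ t s, B t → B s → NodeExtends E s t ∨ NodeExtends E t s) ∧
  (∀ b, E b th → ∃ t ds, B t ∧ IsFuncOn E t ds ∧ (E b ds ∨ b = ds))

/-- `Bs` is an internal set which is a branch of length `th` through `T`. -/
def IsThBranchSet (E : M → M → Prop) (th T Bs : M) : Prop :=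
  (∀ t, E t Bs → E t T) ∧
  (∀ t s, E t Bs → E s Bs → NodeExtends E s t ∨ NodeExtends E t s) ∧
  (∀ b, E b th → ∃ t ds, E t Bs ∧ IsFuncOn E t ds ∧ (E b ds ∨ b = ds))

set_option autoImplicit false
set_option maxHeartbeats 1000000
section
variable {M : Type}

/-- renaming of variables -/
def renm : {n m : ℕ} → Fml n → (Fin n → Fin m) → Fml m
  | _, _, Fml.mem i j, r => Fml.mem (r i) (r j)
  | _, _, Fml.equ i j, r => Fml.equ (r i) (r j)
  | _, _, Fml.aux i, r => Fml.aux (r i)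
  | _, _, Fml.impl f g, r => Fml.impl (renm f r) (renm g r)
  | _, _, Fml.neg f, r => Fml.neg (renm f r)
  | _, _, Fml.all f, r => Fml.all (renm f (Fin.cons 0 (fun i => (r i).succ)))
  | _, _, Fml.ex f, r => Fml.ex (renm f (Fin.cons 0 (fun i => (r i).succ)))
  | _, _, Fml.allb i f, r => Fml.allb (r i) (renm f (Fin.cons 0 (fun i => (r i).succ)))

theorem cons_renm {n m : ℕ} (r : Fin n → Fin m) (x : M) (v : Fin m → M) :
    (fun i => (Fin.cons x v : Fin (m+1) → M) ((Fin.cons 0 (fun i => (r i).succ) : Fin (n+1) → Fin (m+1)) i))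
      = (Fin.cons x (fun i => v (r i)) : Fin (n+1) → M) := by
  funext i
  refine Fin.cases ?_ (fun j => ?_) i <;> simp

theorem eval_renm (E : M → M → Prop) (P C : M → Prop) {n : ℕ} (f : Fml n) :
    ∀ {m : ℕ} (r : Fin n → Fin m) (v : Fin m → M),
      Eval E P C (renm f r) v ↔ Eval E P C f (fun i => v (r i)) := by
  induction f with
  | mem i j => intro m r v; simp [renm, Eval]
  | equ i j => intro m r v; simp [renm, Eval]
  | aux i => intro m r v; simp [renm, Eval]
  | impl f g ihf ihg => intro m r v; simp [renm, Eval, ihf, ihg]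
  | neg f ih => intro m r v; simp [renm, Eval, ih]
  | all f ih => intro m r v; simp only [renm, Eval, ih, cons_renm]
  | ex f ih => intro m r v; simp only [renm, Eval, ih, cons_renm]
  | allb i f ih => intro m r v; simp only [renm, Eval, ih, cons_renm]


/-- definable (with parameters) relation -/
class Dfn (E : M → M → Prop) {n : ℕ} (R : (Fin n → M) → Prop) : Prop where
  out : ∃ (k : ℕ) (f : Fml k) (ρ : Fin k → Fin n ⊕ M),
    ∀ v, R v ↔ Eval E NoAux AllSets f (fun i => Sum.elim v id (ρ i))

variable {E : M → M → Prop}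

theorem Dfn.congr {n : ℕ} {R S : (Fin n → M) → Prop} (h : Dfn E R) (e : ∀ v, S v ↔ R v) :
    Dfn E S := by
  have : S = R := funext fun v => propext (e v)
  rw [this]; exact h

instance Dfn.imp {n : ℕ} {R S : (Fin n → M) → Prop} [hR : Dfn E R] [hS : Dfn E S] :
    Dfn E (fun v => R v → S v) := by
  obtain ⟨k, f, ρ, hf⟩ := hR.out
  obtain ⟨l, g, σ, hg⟩ := hS.out
  refine ⟨k + l, Fml.impl (renm f (Fin.castAdd l)) (renm g (Fin.natAdd k)), Fin.append ρ σ, ?_⟩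
  intro v
  simp [Eval, eval_renm, hf, hg]

instance Dfn.not {n : ℕ} {R : (Fin n → M) → Prop} [hR : Dfn E R] :
    Dfn E (fun v => ¬ R v) := by
  obtain ⟨k, f, ρ, hf⟩ := hR.out
  refine ⟨k, Fml.neg f, ρ, ?_⟩
  intro v
  simp [Eval, hf]

instance Dfn.and {n : ℕ} {R S : (Fin n → M) → Prop} [hR : Dfn E R] [hS : Dfn E S] :
    Dfn E (fun v => R v ∧ S v) :=
  (inferInstance : Dfn E (fun v => ¬ (R v → ¬ S v))).congr (fun v => by tauto)

instance Dfn.or {n : ℕ} {R S : (Fin n → M) → Prop} [hR : Dfn E R] [hS : Dfn E S] :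
    Dfn E (fun v => R v ∨ S v) :=
  (inferInstance : Dfn E (fun v => (¬ R v → S v))).congr (fun v => by tauto)

instance Dfn.iff {n : ℕ} {R S : (Fin n → M) → Prop} [hR : Dfn E R] [hS : Dfn E S] :
    Dfn E (fun v => R v ↔ S v) :=
  (inferInstance : Dfn E (fun v => (R v → S v) ∧ (S v → R v))).congr (fun v => by tauto)

theorem cons_eta {n : ℕ} (w : Fin (n+1) → M) :
    (Fin.cons (w 0) (fun i => w i.succ) : Fin (n+1) → M) = w := by
  funext i
  refine Fin.cases ?_ (fun j => ?_) i <;> simp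

/-- quantifier preparation -/
theorem Dfn.prep {n : ℕ} {R : (Fin (n+1) → M) → Prop} (hR : Dfn E R) (x0 : M) :
    ∃ (k : ℕ) (f : Fml (k + 1)) (ρ : Fin k → Fin n ⊕ M),
      ∀ x v, R (Fin.cons x v) ↔ Eval E NoAux AllSets f
        (Fin.cons x (fun i => Sum.elim v id (ρ i))) := by
  obtain ⟨k, f, ρ, hf⟩ := hR.out
  let s : Fin k → Fin (k+1) := fun i => Sum.elim (fun j : Fin (n+1) => Fin.cases 0 (fun _ => i.succ) j)
    (fun _ => i.succ) (ρ i)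
  let ρ' : Fin k → Fin n ⊕ M := fun i => Sum.elim
    (fun j : Fin (n+1) => Fin.cases (motive := fun _ => Fin n ⊕ M) (Sum.inr x0) (fun j => Sum.inl j) j)
    (fun m => Sum.inr m) (ρ i)
  refine ⟨k, renm f s, ρ', fun x v => ?_⟩
  rw [eval_renm, hf]
  have : (fun i => Sum.elim (Fin.cons x v : Fin (n+1) → M) id (ρ i)) =
      (fun i => (Fin.cons x (fun i => Sum.elim v id (ρ' i)) : Fin (k+1) → M) (s i)) := by
    funext i
    simp only [s, ρ']
    cases hi : ρ i with
    | inl j =>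
      revert hi
      refine Fin.cases ?_ (fun j => ?_) j <;> intro hi <;> simp [hi]
    | inr m => simp [hi]
  rw [this]

theorem Dfn.ofNot {n : ℕ} (h : ¬ Nonempty M) (R : (Fin n → M) → Prop) (hR : ∀ v, ¬ R v) : Dfn E R := by
  refine ⟨0, Fml.ex (Fml.equ 0 0), fun i => i.elim0, fun v => ?_⟩
  simp only [Eval, AllSets]
  constructor
  · intro h; exact (hR v h).elim
  · rintro ⟨x, _⟩; exact (h ⟨x⟩).elim

instance Dfn.ex {n : ℕ} {R : (Fin n → M) → M → Prop}
    [hR : Dfn E (fun w : Fin (n+1) → M => R (fun i => w i.succ) (w 0))] :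
    Dfn E (fun v => ∃ x, R v x) := by
  by_cases hM : Nonempty M
  · obtain ⟨x0⟩ := hM
    obtain ⟨k, f, ρ, hf⟩ := hR.prep x0
    refine ⟨k, Fml.ex f, ρ, fun v => ?_⟩
    simp only [Eval, AllSets, true_and]
    refine exists_congr fun x => ?_
    have := hf x v
    simpa using this
  · exact Dfn.ofNot hM _ (fun v ⟨x, _⟩ => hM ⟨x⟩)

instance Dfn.all {n : ℕ} {R : (Fin n → M) → M → Prop}
    [hR : Dfn E (fun w : Fin (n+1) → M => R (fun i => w i.succ) (w 0))] :
    Dfn E (fun v => ∀ x, R v x) :=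
  (inferInstance : Dfn E (fun v => ¬ ∃ x, ¬ R v x)).congr (fun v => by push Not; rfl)

/-- reindexing -/
theorem Dfn.reidx {n m : ℕ} {R : (Fin n → M) → Prop} (hR : Dfn E R) (g : Fin n → Fin m) :
    Dfn E (fun w : Fin m → M => R (fun i => w (g i))) := by
  obtain ⟨k, f, ρ, hf⟩ := hR.out
  refine ⟨k, f, fun i => Sum.elim (fun j => Sum.inl (g j)) Sum.inr (ρ i), fun v => ?_⟩
  rw [hf]
  have : (fun i => Sum.elim (fun i => v (g i)) id (ρ i)) =
    (fun i => Sum.elim v id (Sum.elim (fun j => Sum.inl (g j)) Sum.inr (ρ i) : Fin m ⊕ M)) := by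
    funext i; cases ρ i <;> simp
  rw [this]

/-- definable term -/
class DFn (E : M → M → Prop) {n : ℕ} (t : (Fin n → M) → M) : Prop where
  out : Dfn E (fun w : Fin (n+1) → M => w 0 = t (fun i => w i.succ))

instance DFn.proj {n : ℕ} (i : Fin n) : DFn E (fun v : Fin n → M => v i) where
  out := ⟨2, Fml.equ 0 1, ![Sum.inl 0, Sum.inl i.succ], fun v => by simp [Eval]⟩

instance DFn.const {n : ℕ} (c : M) : DFn E (fun _ : Fin n → M => c) where
  out := ⟨2, Fml.equ 0 1, ![Sum.inl 0, Sum.inr c], fun v => by simp [Eval]⟩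

theorem Dfn.sub1 {R : M → Prop} (h : Dfn E (fun v : Fin 1 → M => R (v 0))) {n : ℕ}
    (t : (Fin n → M) → M) [ht : DFn E t] : Dfn E (fun v => R (t v)) := by
  have h1 := h.reidx (m := n+1) ![0]
  have h2 := ht.out
  have h3 : Dfn E (fun w : Fin (n+1) → M => w 0 = t (fun i => w i.succ) ∧ R (w 0)) := by
    exact Dfn.and (hR := h2) (hS := h1)
  exact (Dfn.ex (R := fun v x => x = t v ∧ R x)).congr (fun v => by simp)

theorem Dfn.sub2 {R : M → M → Prop} (h : Dfn E (fun v : Fin 2 → M => R (v 0) (v 1))) {n : ℕ}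
    (t s : (Fin n → M) → M) [ht : DFn E t] [hs : DFn E s] : Dfn E (fun v => R (t v) (s v)) := by
  have h1 := h.reidx (m := n+2) ![1, 0]
  have h2 := (ht.out).reidx (m := n+2) (Fin.cons 1 (fun i => i.succ.succ))
  have h3 := (hs.out).reidx (m := n+2) (Fin.cons 0 (fun i => i.succ.succ))
  have h4 := Dfn.and (hR := Dfn.and (hR := h2) (hS := h3)) (hS := h1)
  have := Dfn.ex (E := E) (n := n) (R := fun v x => ∃ y, (x = t v ∧ y = s v) ∧ R x y)
    (hR := Dfn.ex (R := fun v y => (v 0 = t (fun i => v i.succ) ∧ y = s (fun i => v i.succ)) ∧ R (v 0) y)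
     (hR := h4))
  exact this.congr (fun v => by simp)

theorem Dfn.sub3 {R : M → M → M → Prop} (h : Dfn E (fun v : Fin 3 → M => R (v 0) (v 1) (v 2))) {n : ℕ}
    (t s r : (Fin n → M) → M) [ht : DFn E t] [hs : DFn E s] [hr : DFn E r] :
    Dfn E (fun v => R (t v) (s v) (r v)) := by
  have h1 := h.reidx (m := n+3) ![2, 1, 0]
  have h2 := (ht.out).reidx (m := n+3) (Fin.cons 2 (fun i => i.succ.succ.succ))
  have h3 := (hs.out).reidx (m := n+3) (Fin.cons 1 (fun i => i.succ.succ.succ))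
  have h5 := (hr.out).reidx (m := n+3) (Fin.cons 0 (fun i => i.succ.succ.succ))
  have h4 := Dfn.and (hR := Dfn.and (hR := Dfn.and (hR := h2) (hS := h3)) (hS := h5)) (hS := h1)
  have := Dfn.ex (E := E) (n := n) (R := fun v x => ∃ y z, ((x = t v ∧ y = s v) ∧ z = r v) ∧ R x y z)
    (hR := Dfn.ex (R := fun v y => ∃ z, ((v 0 = t (fun i => v i.succ) ∧ y = s (fun i => v i.succ)) ∧ z = r (fun i => v i.succ)) ∧ R (v 0) y z)
     (hR := Dfn.ex (R := fun v z => ((v 1 = t (fun i => v i.succ.succ) ∧ v 0 = s (fun i => v i.succ.succ)) ∧ z = r (fun i => v i.succ.succ)) ∧ R (v 1) (v 0) z) (hR := h4)))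
  exact this.congr (fun v => by simp)

theorem Dfn.sub4 {R : M → M → M → M → Prop} (h : Dfn E (fun v : Fin 4 → M => R (v 0) (v 1) (v 2) (v 3)))
    {n : ℕ} (t s r q : (Fin n → M) → M) [ht : DFn E t] [hs : DFn E s] [hr : DFn E r] [hq : DFn E q] :
    Dfn E (fun v => R (t v) (s v) (r v) (q v)) := by
  have h1 := h.reidx (m := n+4) ![3, 2, 1, 0]
  have h2 := (ht.out).reidx (m := n+4) (Fin.cons 3 (fun i => i.succ.succ.succ.succ))
  have h3 := (hs.out).reidx (m := n+4) (Fin.cons 2 (fun i => i.succ.succ.succ.succ))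
  have h5 := (hr.out).reidx (m := n+4) (Fin.cons 1 (fun i => i.succ.succ.succ.succ))
  have h6 := (hq.out).reidx (m := n+4) (Fin.cons 0 (fun i => i.succ.succ.succ.succ))
  have h4 := Dfn.and (hR := Dfn.and (hR := Dfn.and (hR := h2) (hS := h3)) (hS := Dfn.and (hR := h5) (hS := h6))) (hS := h1)
  have := Dfn.ex (E := E) (n := n) (R := fun v x => ∃ y z u, ((x = t v ∧ y = s v) ∧ z = r v ∧ u = q v) ∧ R x y z u)
    (hR := Dfn.ex (R := fun v y => ∃ z u, ((v 0 = t (fun i => v i.succ) ∧ y = s (fun i => v i.succ)) ∧ z = r (fun i => v i.succ) ∧ u = q (fun i => v i.succ)) ∧ R (v 0) y z u)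
     (hR := Dfn.ex (R := fun v z => ∃ u, ((v 1 = t (fun i => v i.succ.succ) ∧ v 0 = s (fun i => v i.succ.succ)) ∧ z = r (fun i => v i.succ.succ) ∧ u = q (fun i => v i.succ.succ)) ∧ R (v 1) (v 0) z u)
      (hR := Dfn.ex (R := fun v u => ((v 2 = t (fun i => v i.succ.succ.succ) ∧ v 1 = s (fun i => v i.succ.succ.succ)) ∧ v 0 = r (fun i => v i.succ.succ.succ) ∧ u = q (fun i => v i.succ.succ.succ)) ∧ R (v 2) (v 1) (v 0) u) (hR := h4))))
  exact this.congr (fun v => by simp)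

theorem Dfn.mem0 : Dfn E (fun v : Fin 2 → M => E (v 0) (v 1)) :=
  ⟨2, Fml.mem 0 1, ![Sum.inl 0, Sum.inl 1], fun v => by simp [Eval]⟩
theorem Dfn.eq0 : Dfn E (fun v : Fin 2 → M => (v 0) = (v 1)) :=
  ⟨2, Fml.equ 0 1, ![Sum.inl 0, Sum.inl 1], fun v => by simp [Eval]⟩

section
variable {n : ℕ} {t s r q : (Fin n → M) → M} [DFn E t] [DFn E s] [DFn E r] [DFn E q]
instance : Dfn E (fun v => E (t v) (s v)) := Dfn.sub2 Dfn.mem0 t s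
instance : Dfn E (fun v => (t v) = (s v)) := Dfn.sub2 Dfn.eq0 t s
instance : Dfn E (fun v => SubsetE E (t v) (s v)) := Dfn.sub2 (by unfold SubsetE; infer_instance) t s
instance : Dfn E (fun v => IsUPair E (t v) (s v) (r v)) := Dfn.sub3 (by unfold IsUPair; infer_instance) t s r
instance : Dfn E (fun v => IsKPair E (t v) (s v) (r v)) := Dfn.sub3 (by unfold IsKPair; infer_instance) t s r
instance : Dfn E (fun v => IsKTriple E (t v) (s v) (r v) (q v)) := Dfn.sub4 (by unfold IsKTriple; infer_instance) t s r q
instance : Dfn E (fun v => PairIn E (t v) (s v) (r v)) := Dfn.sub3 (by unfold PairIn; infer_instance) t s r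
instance : Dfn E (fun v => IsFunc E (t v)) := Dfn.sub1 (by unfold IsFunc; infer_instance) t
instance : Dfn E (fun v => IsFuncOn E (t v) (s v)) := Dfn.sub2 (by unfold IsFuncOn; infer_instance) t s
instance : Dfn E (fun v => MapsTo E (t v) (s v) (r v)) := Dfn.sub3 (by unfold MapsTo; infer_instance) t s r
instance : Dfn E (fun v => IsRestrOfFn E (t v) (s v) (r v)) := Dfn.sub3 (by unfold IsRestrOfFn; infer_instance) t s r
instance : Dfn E (fun v => TransSet E (t v)) := Dfn.sub1 (by unfold TransSet; infer_instance) t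
instance : Dfn E (fun v => IsOrd E (t v)) := Dfn.sub1 (by unfold IsOrd; infer_instance) t
instance : Dfn E (fun v => IsZero E (t v)) := Dfn.sub1 (by unfold IsZero; infer_instance) t
instance : Dfn E (fun v => IsSuccOf E (t v) (s v)) := Dfn.sub2 (by unfold IsSuccOf; infer_instance) t s
instance : Dfn E (fun v => IsLimitOrd E (t v)) := Dfn.sub1 (by unfold IsLimitOrd; infer_instance) t
instance : Dfn E (fun v => IsOmegaOrd E (t v)) := Dfn.sub1 (by unfold IsOmegaOrd; infer_instance) t
instance : Dfn E (fun v => IsGProd E (t v) (s v) (r v)) := Dfn.sub3 (by unfold IsGProd; infer_instance) t s r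
instance : Dfn E (fun v => IsGMemRel E (t v) (s v) (r v)) := Dfn.sub3 (by unfold IsGMemRel; infer_instance) t s r
instance : Dfn E (fun v => IsGDiff E (t v) (s v) (r v)) := Dfn.sub3 (by unfold IsGDiff; infer_instance) t s r
instance : Dfn E (fun v => IsGInter E (t v) (s v) (r v)) := Dfn.sub3 (by unfold IsGInter; infer_instance) t s r
instance : Dfn E (fun v => IsGUnionSet E (t v) (s v)) := Dfn.sub2 (by unfold IsGUnionSet; infer_instance) t s
instance : Dfn E (fun v => IsGDom E (t v) (s v)) := Dfn.sub2 (by unfold IsGDom; infer_instance) t s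
instance : Dfn E (fun v => IsGConv E (t v) (s v)) := Dfn.sub2 (by unfold IsGConv; infer_instance) t s
instance : Dfn E (fun v => IsGPerm1 E (t v) (s v)) := Dfn.sub2 (by unfold IsGPerm1; infer_instance) t s
instance : Dfn E (fun v => IsGPerm2 E (t v) (s v)) := Dfn.sub2 (by unfold IsGPerm2; infer_instance) t s
instance : Dfn E (fun v => GClosed E (t v)) := Dfn.sub1 (by unfold GClosed; infer_instance) t
instance : Dfn E (fun v => IsGClOf E (t v) (s v)) := Dfn.sub2 (by unfold IsGClOf; infer_instance) t s
instance : Dfn E (fun v => IsDefSetOf E (t v) (s v)) := Dfn.sub2 (by unfold IsDefSetOf; infer_instance) t s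
instance : Dfn E (fun v => IsTransClOf E (t v) (s v)) := Dfn.sub2 (by unfold IsTransClOf; infer_instance) t s
instance : Dfn E (fun v => IsLZero E (t v) (s v)) := Dfn.sub2 (by unfold IsLZero; infer_instance) t s
instance : Dfn E (fun v => IsLHier E (t v) (s v) (r v)) := Dfn.sub3 (by unfold IsLHier; infer_instance) t s r
instance : Dfn E (fun v => IsLStage E (t v) (s v) (r v)) := Dfn.sub3 (by unfold IsLStage; infer_instance) t s r
instance : Dfn E (fun v => InL E (t v) (s v)) := Dfn.sub2 (by unfold InL; infer_instance) t s
end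

theorem Dfn.fin {n : ℕ} : ∀ {k : ℕ} {R : Fin k → (Fin n → M) → Prop}, (∀ i, Dfn E (R i)) →
    Dfn E (fun v => ∃ i, R i v)
  | 0, _, _ => Dfn.congr (R := fun _ => ∃ x : M, ¬ x = x) inferInstance (fun v => by simp)
  | k+1, R, h => by
    have := Dfn.fin (R := fun i => R (Fin.succ i)) (fun i => h _)
    have h0 := h 0
    exact (inferInstance : Dfn E (fun v => R 0 v ∨ ∃ i : Fin k, R i.succ v)).congr
      (fun v => by rw [Fin.exists_fin_succ])

/-- remove the auxiliary predicate -/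
def noaux : {n : ℕ} → Fml n → Fml n
  | _, Fml.mem i j => Fml.mem i j
  | _, Fml.equ i j => Fml.equ i j
  | _, Fml.aux i => Fml.neg (Fml.equ i i)
  | _, Fml.impl f g => Fml.impl (noaux f) (noaux g)
  | _, Fml.neg f => Fml.neg (noaux f)
  | _, Fml.all f => Fml.all (noaux f)
  | _, Fml.ex f => Fml.ex (noaux f)
  | _, Fml.allb i f => Fml.allb i (noaux f)

theorem eval_noaux (P C : M → Prop) {n : ℕ} (f : Fml n) (v : Fin n → M) :
    Eval E P C (noaux f) v ↔ Eval E NoAux C f v := by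
  induction f with
  | mem i j => rfl
  | equ i j => rfl
  | aux i => simp [noaux, Eval, NoAux]
  | impl f g ihf ihg => simp [noaux, Eval, ihf, ihg]
  | neg f ih => simp [noaux, Eval, ih]
  | all f ih => simp [noaux, Eval, ih]
  | ex f ih => simp [noaux, Eval, ih]
  | allb i f ih => simp [noaux, Eval, ih]

/-- model of ZF, pure language -/
class ZFM (E : M → M → Prop) : Prop where
  sat : SatZF E NoAux

theorem SatZF.toZFM {P : M → Prop} (h : SatZF E P) : ZFM E where
  sat := { ext := h.ext, found := h.found, pair := h.pair, union := h.union, power := h.power,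
           infty := h.infty
           sep := fun f v a => by simpa only [eval_noaux] using h.sep (noaux f) v a
           repl := fun f v a => by simpa only [eval_noaux] using h.repl (noaux f) v a }

section
variable [Z : ZFM E]

theorem sepD (a : M) (R : M → Prop) [hR : Dfn E (fun v : Fin 1 → M => R (v 0))] :
    ∃ b, ∀ z, E z b ↔ (E z a ∧ R z) := by
  obtain ⟨k, f, ρ, hf⟩ := hR.prep a
  obtain ⟨b, hb⟩ := Z.sat.sep f (fun i => Sum.elim Fin.elim0 id (ρ i)) a
  exact ⟨b, fun z => by rw [hb, ← hf]; simp⟩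

theorem replP (a : M) (R : M → M → Prop) [hR : Dfn E (fun v : Fin 2 → M => R (v 0) (v 1))]
    (h : ∀ x y y', E x a → R x y → R x y' → y = y') :
    ∃ b, ∀ y, E y b ↔ ∃ x, E x a ∧ R x y := by
  have hR' : Dfn E (fun v : Fin 2 → M => R (v 0) (v 1)) := hR
  obtain ⟨a', ha'⟩ := sepD (E := E) a (fun x => ∃ y, R x y)
    (hR := Dfn.ex (hR := Dfn.sub2 hR (fun w : Fin 2 → M => w 1) (fun w => w 0)))
  obtain ⟨k, f, ρ, hf⟩ := hR.prep a
  have h2 : ∃ (m : ℕ) (g : Fml (m + 2)) (p : Fin m → M), ∀ x y, R x y ↔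
      Eval E NoAux AllSets g (Fin.cons x (Fin.cons y p)) := by
    refine ⟨k, renm f (Fin.cons 0 (fun i => Sum.elim (fun _ => 1) (fun _ => i.succ.succ) (ρ i))),
      fun i => Sum.elim (fun _ => a) id (ρ i), fun x y => ?_⟩
    have := hf x ![y]
    simp only [Fin.cons_zero] at this
    rw [eval_renm]
    have e : (fun i => (Fin.cons x (Fin.cons y (fun i => Sum.elim (fun _ => a) id (ρ i)) : Fin (k+1) → M) : Fin (k+2) → M)
      ((Fin.cons 0 (fun i => Sum.elim (fun _ => 1) (fun _ => i.succ.succ) (ρ i)) : Fin (k+1) → Fin (k+2)) i)) =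
      (Fin.cons x (fun i => Sum.elim ![y] id (ρ i)) : Fin (k+1) → M) := by
      funext i
      refine Fin.cases ?_ (fun j => ?_) i
      · simp
      · simp only [Fin.cons_succ]
        cases hj : ρ j with
        | inl q => simp [Fin.fin_one_eq_zero q]
        | inr m => simp [hj]
    rw [e, ← this]; rfl
  obtain ⟨m, g, p, hg⟩ := h2
  obtain ⟨b, hb⟩ := Z.sat.repl g p a' (fun x hx => by
    obtain ⟨hxa, y, hy⟩ := (ha' x).1 hx
    exact ⟨y, (hg _ _).1 hy, fun y' hy' => h x _ _ hxa ((hg _ _).2 hy') hy⟩)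
  refine ⟨b, fun y => ?_⟩
  rw [hb]
  constructor
  · rintro ⟨x, hx, hxy⟩; exact ⟨x, ((ha' x).1 hx).1, (hg _ _).2 hxy⟩
  · rintro ⟨x, hx, hxy⟩; exact ⟨x, (ha' x).2 ⟨hx, y, hxy⟩, (hg _ _).1 hxy⟩
end
end

set_option autoImplicit false
set_option maxHeartbeats 1000000
set_option linter.unusedSectionVars false
section
variable {M : Type} {E : M → M → Prop} [Z : ZFM E]

theorem ext {x y : M} (h : ∀ z, E z x ↔ E z y) : x = y := Z.sat.ext x y h

noncomputable def upr (E : M → M → Prop) [Z : ZFM E] (x y : M) : M := (Z.sat.pair x y).choose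
theorem mem_upr {x y z : M} : E z (upr E x y) ↔ z = x ∨ z = y := (Z.sat.pair x y).choose_spec z
noncomputable def Un (E : M → M → Prop) [Z : ZFM E] (x : M) : M := (Z.sat.union x).choose
theorem mem_Un {x z : M} : E z (Un E x) ↔ ∃ y, E y x ∧ E z y := (Z.sat.union x).choose_spec z
noncomputable def pw (E : M → M → Prop) [Z : ZFM E] (x : M) : M := (Z.sat.power x).choose
theorem mem_pw {x z : M} : E z (pw E x) ↔ SubsetE E z x := (Z.sat.power x).choose_spec z
noncomputable def bun (E : M → M → Prop) [Z : ZFM E] (x y : M) : M := Un E (upr E x y)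
theorem mem_bun {x y z : M} : E z (bun E x y) ↔ E z x ∨ E z y := by
  simp [bun, mem_Un, mem_upr]
noncomputable def sing (E : M → M → Prop) [Z : ZFM E] (x : M) : M := upr E x x
theorem mem_sing {x z : M} : E z (sing E x) ↔ z = x := by simp [sing, mem_upr]
noncomputable def sc (E : M → M → Prop) [Z : ZFM E] (x : M) : M := bun E x (sing E x)
theorem mem_sc {x z : M} : E z (sc E x) ↔ E z x ∨ z = x := by simp [sc, mem_bun, mem_sing]
noncomputable def kp (E : M → M → Prop) [Z : ZFM E] (x y : M) : M := upr E (sing E x) (upr E x y)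
noncomputable def emp (E : M → M → Prop) [Z : ZFM E] : M :=
  (sepD (E := E) (Z.sat.infty.choose) (fun x => ¬ x = x)).choose
theorem mem_emp {z : M} : ¬ E z (emp E) := fun h =>
  (((sepD (E := E) (Z.sat.infty.choose) (fun x => ¬ x = x)).choose_spec z).1 h).2 rfl
noncomputable def sepS (E : M → M → Prop) [Z : ZFM E] (a : M) (R : M → Prop)
  [hR : Dfn E (fun v : Fin 1 → M => R (v 0))] : M := (sepD (E := E) a R).choose
theorem mem_sepS {a z : M} {R : M → Prop} [hR : Dfn E (fun v : Fin 1 → M => R (v 0))] :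
    E z (sepS E a R) ↔ E z a ∧ R z := (sepD (E := E) a R).choose_spec z

theorem isUPair_iff {p x y : M} : IsUPair E p x y ↔ p = upr E x y := by
  constructor
  · intro h; exact ext (E := E) (fun z => by simp only [h z, mem_upr])
  · rintro rfl z; exact mem_upr
theorem isSuccOf_iff {x s : M} : IsSuccOf E x s ↔ s = sc E x := by
  constructor
  · intro h; exact ext (E := E) (fun z => by simp only [h z, mem_sc])
  · rintro rfl z; exact mem_sc
theorem isKPair_iff {p x y : M} : IsKPair E p x y ↔ p = kp E x y := by
  simp [IsKPair, isUPair_iff, kp, sing]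
theorem isKTriple_iff {t u v w : M} : IsKTriple E t u v w ↔ t = kp E u (kp E v w) := by
  simp [IsKTriple, isKPair_iff]
theorem pairIn_iff {f x y : M} : PairIn E f x y ↔ E (kp E x y) f := by
  simp [PairIn, isKPair_iff]

theorem upr_inj {a b c d : M} (h : upr E a b = upr E c d) : (a = c ∧ b = d) ∨ (a = d ∧ b = c) := by
  have h1 : ∀ z, (z = a ∨ z = b) ↔ (z = c ∨ z = d) := fun z => by
    rw [← mem_upr (E := E), h, mem_upr (E := E)]
  have ha := (h1 a).1 (Or.inl rfl); have hb := (h1 b).1 (Or.inr rfl)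
  have hc := (h1 c).2 (Or.inl rfl); have hd := (h1 d).2 (Or.inr rfl)
  grind
theorem kp_inj {a b c d : M} : kp E a b = kp E c d ↔ a = c ∧ b = d := by
  constructor
  · intro h
    rcases upr_inj h with ⟨h1, h2⟩ | ⟨h1, h2⟩ <;> have := upr_inj h1 <;> have := upr_inj h2 <;> grind
  · rintro ⟨rfl, rfl⟩; rfl

section
variable {n : ℕ} {t s : (Fin n → M) → M} [ht : DFn E t] [hs : DFn E s]
theorem DFn.mk1 {f : M → M} (h : Dfn E (fun v : Fin 2 → M => v 0 = f (v 1))) : DFn E (fun v => f (t v)) where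
  out := by
    have : DFn E (fun w : Fin (n+1) → M => t (fun i => w i.succ)) := ⟨by
      have := ht.out.reidx (m := n+2) (Fin.cons 0 (fun i => i.succ.succ)); exact this⟩
    exact Dfn.sub2 (R := fun a b => a = f b) h (fun w : Fin (n+1) → M => w 0) (fun w => t (fun i => w i.succ))
theorem DFn.mk2 {f : M → M → M} (h : Dfn E (fun v : Fin 3 → M => v 0 = f (v 1) (v 2))) :
    DFn E (fun v => f (t v) (s v)) where
  out := by
    have : DFn E (fun w : Fin (n+1) → M => t (fun i => w i.succ)) := ⟨by
      have := ht.out.reidx (m := n+2) (Fin.cons 0 (fun i => i.succ.succ)); exact this⟩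
    have : DFn E (fun w : Fin (n+1) → M => s (fun i => w i.succ)) := ⟨by
      have := hs.out.reidx (m := n+2) (Fin.cons 0 (fun i => i.succ.succ)); exact this⟩
    exact Dfn.sub3 (R := fun a b c => a = f b c) h (fun w : Fin (n+1) → M => w 0)
      (fun w => t (fun i => w i.succ)) (fun w => s (fun i => w i.succ))
instance : DFn E (fun v => upr E (t v) (s v)) :=
  DFn.mk2 (by simp only [← isUPair_iff]; infer_instance)
instance : DFn E (fun v => kp E (t v) (s v)) :=
  DFn.mk2 (by simp only [← isKPair_iff]; infer_instance)
instance : DFn E (fun v => sc E (t v)) :=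
  DFn.mk1 (by simp only [← isSuccOf_iff]; infer_instance)
instance : DFn E (fun v => sing E (t v)) := DFn.mk1 (f := sing E) (by unfold sing; infer_instance)
theorem eq_iff_mem {x y : M} : x = y ↔ ∀ z, E z x ↔ E z y := ⟨by rintro rfl; simp, ext⟩
instance : DFn E (fun v => Un E (t v)) :=
  DFn.mk1 (f := Un E) (by simp only [eq_iff_mem (E := E), mem_Un]; infer_instance)
instance : DFn E (fun v => bun E (t v) (s v)) := DFn.mk2 (f := bun E) (by unfold bun; infer_instance)
instance : DFn E (fun v => pw E (t v)) :=
  DFn.mk1 (f := pw E) (by simp only [eq_iff_mem (E := E), mem_pw]; infer_instance)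
end

theorem prod_ex (x y : M) : ∃ z, ∀ w, E w z ↔ ∃ u v, E u x ∧ E v y ∧ w = kp E u v := by
  obtain ⟨z, hz⟩ := sepD (E := E) (pw E (pw E (bun E x y))) (fun w => ∃ u v, E u x ∧ E v y ∧ w = kp E u v)
  refine ⟨z, fun w => ?_⟩
  rw [hz, and_iff_right_iff_imp]
  rintro ⟨u, v, hu, hv, rfl⟩
  rw [mem_pw (E := E)]
  intro a ha
  rw [mem_pw (E := E)]
  intro b hb
  rw [mem_bun (E := E)]
  rcases mem_upr.1 ha with rfl | rfl
  · rcases mem_sing.1 hb with rfl; exact Or.inl hu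
  · rcases mem_upr.1 hb with rfl | rfl
    · exact Or.inl hu
    · exact Or.inr hv
noncomputable def prd (E : M → M → Prop) [Z : ZFM E] (x y : M) : M := (prod_ex (E := E) x y).choose
theorem mem_prd {x y w : M} : E w (prd E x y) ↔ ∃ u v, E u x ∧ E v y ∧ w = kp E u v :=
  (prod_ex (E := E) x y).choose_spec w
theorem kp_mem_prd {x y u v : M} : E (kp E u v) (prd E x y) ↔ E u x ∧ E v y := by
  simp [mem_prd, kp_inj]
theorem kp_mem_UnUn {x a b : M} (h : E (kp E a b) x) : E a (Un E (Un E x)) ∧ E b (Un E (Un E x)) := by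
  have hk : E (upr E a b) (Un E x) := mem_Un.2 ⟨_, h, mem_upr.2 (Or.inr rfl)⟩
  exact ⟨mem_Un.2 ⟨_, hk, mem_upr.2 (Or.inl rfl)⟩, mem_Un.2 ⟨_, hk, mem_upr.2 (Or.inr rfl)⟩⟩

theorem irr {x : M} : ¬ E x x := by
  intro h
  obtain ⟨y, hy, h2⟩ := Z.sat.found (sing E x) ⟨x, mem_sing.2 rfl⟩
  rw [mem_sing (E := E)] at hy; subst hy
  exact h2 y h (mem_sing.2 rfl)
theorem asym {x y : M} (h : E x y) : ¬ E y x := by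
  intro h'
  obtain ⟨z, hz, h2⟩ := Z.sat.found (upr E x y) ⟨x, mem_upr.2 (Or.inl rfl)⟩
  rcases mem_upr.1 hz with rfl | rfl
  · exact h2 _ h' (mem_upr.2 (Or.inr rfl))
  · exact h2 _ h (mem_upr.2 (Or.inl rfl))
theorem sc_inj {x y : M} (h : sc E x = sc E y) : x = y := by
  have h1 : E x (sc E y) := h ▸ mem_sc.2 (Or.inr rfl)
  have h2 : E y (sc E x) := h ▸ mem_sc.2 (Or.inr rfl)
  rcases mem_sc.1 h1 with h1 | h1
  · rcases mem_sc.1 h2 with h2 | h2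
    · exact (asym h1 h2).elim
    · exact h2.symm
  · exact h1

/- ordinals -/
theorem ord_mem {a b : M} (h : IsOrd E a) (hb : E b a) : IsOrd E b := by
  refine ⟨fun y hy z hz => ?_, fun y z hy hz => h.2 _ _ (h.1 _ hb _ hy) (h.1 _ hb _ hz)⟩
  have hya := h.1 _ hb _ hy
  have hza := h.1 _ hya _ hz
  rcases h.2 _ _ hza hb with h1 | rfl | h1
  · exact h1
  · exact (asym hy hz).elim
  · exfalso
    obtain ⟨w, hw, h2⟩ := Z.sat.found (bun E (upr E b y) (sing E z)) ⟨b, by simp [mem_bun, mem_upr]⟩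
    simp only [mem_bun, mem_upr, mem_sing] at hw h2
    rcases hw with (rfl | rfl) | rfl
    · exact h2 _ hy (by simp)
    · exact h2 _ hz (by simp)
    · exact h2 _ h1 (by simp)
theorem ord_trans {a b c : M} (h : IsOrd E c) (hab : E a b) (hbc : E b c) : E a c := h.1 _ hbc _ hab
theorem ord_sub {a d : M} (h : IsOrd E a) (hd : TransSet E d) (hs : SubsetE E d a) : d = a ∨ E d a := by
  by_cases hne : ∃ y, E y (sepS E a (fun z => ¬ E z d))
  · right
    obtain ⟨m, hm, h2⟩ := Z.sat.found _ hne
    simp only [mem_sepS] at hm h2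
    have : d = m := ext (E := E) fun z => by
      constructor
      · intro hz
        rcases h.2 _ _ (hs _ hz) hm.1 with h3 | rfl | h3
        · exact h3
        · exact (hm.2 hz).elim
        · exact (hm.2 (hd _ hz _ h3)).elim
      · intro hz
        by_contra hc
        exact h2 z hz ⟨h.1 _ hm.1 _ hz, hc⟩
    rw [this]; exact hm.1
  · left
    refine ext (E := E) fun z => ⟨hs z, fun hz => ?_⟩
    by_contra hc
    exact hne ⟨z, mem_sepS.2 ⟨hz, hc⟩⟩
theorem ord_lin {a b : M} (ha : IsOrd E a) (hb : IsOrd E b) : E a b ∨ a = b ∨ E b a := by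
  have ht : TransSet E (sepS E a (fun z => E z b)) := fun y hy z hz => by
    rw [mem_sepS (E := E)] at hy ⊢
    exact ⟨ha.1 _ hy.1 _ hz, hb.1 _ hy.2 _ hz⟩
  have h1 := ord_sub ha ht (fun z hz => (mem_sepS.1 hz).1)
  have h2 := ord_sub hb ht (fun z hz => (mem_sepS.1 hz).2)
  rcases h1 with h1 | h1 <;> rcases h2 with h2 | h2
  · right; left; rw [← h1]; exact h2
  · left; rw [h1] at h2; exact h2
  · right; right; rw [h2] at h1; exact h1
  · exact (irr (mem_sepS.2 ⟨h1, h2⟩)).elim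
theorem ord_le_sub {a b : M} (ha : IsOrd E a) (hb : IsOrd E b) (h : SubsetE E a b) : a = b ∨ E a b :=
  ord_sub hb ha.1 h
theorem ord_sc {a : M} (h : IsOrd E a) : IsOrd E (sc E a) := by
  constructor
  · intro y hy z hz
    rw [mem_sc (E := E)] at hy ⊢
    rcases hy with hy | rfl
    · exact Or.inl (h.1 _ hy _ hz)
    · exact Or.inl hz
  · intro y z hy hz
    have hy' : IsOrd E y := by
      rcases mem_sc.1 hy with hy | rfl
      · exact ord_mem h hy
      · exact h
    have hz' : IsOrd E z := by
      rcases mem_sc.1 hz with hz | rfl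
      · exact ord_mem h hz
      · exact h
    exact ord_lin hy' hz'
theorem isOrd_of {a : M} (ht : TransSet E a) (h : ∀ y, E y a → IsOrd E y) : IsOrd E a :=
  ⟨ht, fun y z hy hz => ord_lin (h y hy) (h z hz)⟩
theorem ord_Un {x : M} (h : ∀ y, E y x → IsOrd E y) : IsOrd E (Un E x) := by
  refine isOrd_of (fun y hy z hz => ?_) (fun y hy => ?_)
  · obtain ⟨u, hu, hyu⟩ := mem_Un.1 hy
    exact mem_Un.2 ⟨u, hu, (h u hu).1 _ hyu _ hz⟩
  · obtain ⟨u, hu, hyu⟩ := mem_Un.1 hy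
    exact ord_mem (h u hu) hyu
theorem no_ord_set (x : M) (h : ∀ a, IsOrd E a → E a x) : False := by
  have hs : IsOrd E (sepS E x (fun z => IsOrd E z)) :=
    isOrd_of (fun y hy z hz => mem_sepS.2 ⟨h _ (ord_mem (mem_sepS.1 hy).2 hz), ord_mem (mem_sepS.1 hy).2 hz⟩)
     (fun y hy => (mem_sepS.1 hy).2)
  exact irr (mem_sepS.2 ⟨h _ hs, hs⟩)
theorem ord_least (R : M → Prop) [hR : Dfn E (fun v : Fin 1 → M => R (v 0))] (h : ∃ a, IsOrd E a ∧ R a) :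
    ∃ a, IsOrd E a ∧ R a ∧ ∀ b, E b a → ¬ R b := by
  obtain ⟨a, ha, hra⟩ := h
  obtain ⟨m, hm, h2⟩ := Z.sat.found (sepS E (sc E a) R) ⟨a, mem_sepS.2 ⟨mem_sc.2 (Or.inr rfl), hra⟩⟩
  rw [mem_sepS (E := E)] at hm
  refine ⟨m, ord_mem (ord_sc ha) hm.1, hm.2, fun b hb hr => h2 b hb (mem_sepS.2 ⟨ord_trans (ord_sc ha) hb hm.1, hr⟩)⟩
theorem ord_ind (R : M → Prop) [hR : Dfn E (fun v : Fin 1 → M => R (v 0))]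
    (h : ∀ a, IsOrd E a → (∀ b, E b a → R b) → R a) : ∀ a, IsOrd E a → R a := by
  intro a ha
  by_contra hc
  obtain ⟨m, hm, h1, h2⟩ := ord_least (E := E) (fun z => ¬ R z) ⟨a, ha, hc⟩
  exact h1 (h m hm (fun b hb => by_contra (h2 b hb)))
/-- membership induction -/
theorem isZero_iff {x : M} : IsZero E x ↔ x = emp E := by
  constructor
  · rintro ⟨_, h⟩; exact ext (E := E) fun z => iff_of_false (h z) mem_emp
  · rintro rfl
    exact ⟨⟨fun y hy => (mem_emp hy).elim, fun y z hy => (mem_emp hy).elim⟩, fun y => mem_emp⟩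
theorem isLimitOrd_iff {x : M} : IsLimitOrd E x ↔ IsOrd E x ∧ (∃ y, E y x) ∧ ∀ y, E y x → E (sc E y) x := by
  simp [IsLimitOrd, isSuccOf_iff]
theorem ord_emp : IsOrd E (emp E) := (isZero_iff.2 rfl).1
theorem ord_tri {a : M} (h : IsOrd E a) : a = emp E ∨ (∃ b, IsOrd E b ∧ a = sc E b) ∨ IsLimitOrd E a := by
  by_cases h0 : ∃ y, E y a
  · right
    by_cases h1 : ∀ y, E y a → E (sc E y) a
    · right; rw [isLimitOrd_iff]; exact ⟨h, h0, h1⟩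
    · left
      push Not at h1
      obtain ⟨y, hy, h2⟩ := h1
      refine ⟨y, ord_mem h hy, ?_⟩
      rcases ord_lin h (ord_sc (ord_mem h hy)) with h3 | h3 | h3
      · rcases mem_sc.1 h3 with h4 | rfl
        · exact (asym hy h4).elim
        · exact (irr hy).elim
      · exact h3
      · exact (h2 h3).elim
  · left; exact isZero_iff.1 ⟨h, fun y hy => h0 ⟨y, hy⟩⟩
theorem lim_ne_sc {a b : M} (h : IsLimitOrd E a) : a ≠ sc E b := by
  rintro rfl
  exact irr ((isLimitOrd_iff.1 h).2.2 b (mem_sc.2 (Or.inr rfl)))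
theorem lim_ne_emp {a : M} (h : IsLimitOrd E a) : a ≠ emp E := by
  rintro rfl
  obtain ⟨y, hy⟩ := h.2.1
  exact mem_emp hy
theorem sc_ne_emp {b : M} : sc E b ≠ emp E := fun h => mem_emp (h ▸ mem_sc.2 (Or.inr rfl) : E b (emp E))
theorem lim_ex : ∃ w, IsLimitOrd E w := by
  by_contra hc
  push Not at hc
  obtain ⟨w, ⟨z, hz, hz'⟩, hs⟩ := Z.sat.infty
  have hze : z = emp E := ext (E := E) fun u => iff_of_false (hz' u) mem_emp
  refine no_ord_set w (ord_ind (E := E) (fun a => E a w) (fun a ha ih => ?_))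
  rcases ord_tri ha with rfl | ⟨b, hb, rfl⟩ | h
  · rw [← hze]; exact hz
  · obtain ⟨s, hs1, hs2⟩ := hs b (ih b (mem_sc.2 (Or.inr rfl)))
    rw [← isSuccOf_iff.1 hs2]; exact hs1
  · exact (hc _ h).elim
noncomputable def om (E : M → M → Prop) [Z : ZFM E] : M :=
  (ord_least (E := E) (fun a => IsLimitOrd E a) ⟨_, lim_ex.choose_spec.1, lim_ex.choose_spec⟩).choose
theorem om_spec : IsOmegaOrd E (om E) :=
  have h := (ord_least (E := E) (fun a => IsLimitOrd E a) ⟨_, lim_ex.choose_spec.1, lim_ex.choose_spec⟩).choose_spec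
  ⟨h.2.1, h.2.2⟩
theorem om_lim : IsLimitOrd E (om E) := om_spec.1
theorem om_ord : IsOrd E (om E) := om_spec.1.1
theorem lim_emp_mem {a : M} (h : IsLimitOrd E a) : E (emp E) a := by
  rcases ord_lin h.1 ord_emp with h1 | h1 | h1
  · exact (mem_emp h1).elim
  · exact (lim_ne_emp h h1).elim
  · exact h1
theorem om_ind (R : M → Prop) [hR : Dfn E (fun v : Fin 1 → M => R (v 0))]
    (h0 : R (emp E)) (hs : ∀ n, E n (om E) → R n → R (sc E n)) : ∀ n, E n (om E) → R n := by
  intro n hn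
  refine ord_ind (E := E) (fun n => E n (om E) → R n) (fun a ha ih han => ?_) n (ord_mem om_ord hn) hn
  rcases ord_tri ha with rfl | ⟨b, hb, rfl⟩ | h
  · exact h0
  · have hb' : E b (sc E b) := mem_sc.2 (Or.inr rfl)
    exact hs b (ord_trans om_ord hb' han) (ih b hb' (ord_trans om_ord hb' han))
  · exact (om_spec.2 _ han h).elim
end

set_option autoImplicit false
set_option maxHeartbeats 1000000
set_option linter.unusedSectionVars false
section
variable {M : Type} {E : M → M → Prop}
class Df1 (E : M → M → Prop) (G : M → Prop) : Prop where
  out : Dfn E (fun v : Fin 1 → M => G (v 0))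
class Df2 (E : M → M → Prop) (G : M → M → Prop) : Prop where
  out : Dfn E (fun v : Fin 2 → M => G (v 0) (v 1))
class Df3 (E : M → M → Prop) (G : M → M → M → Prop) : Prop where
  out : Dfn E (fun v : Fin 3 → M => G (v 0) (v 1) (v 2))
instance {G : M → Prop} [h : Dfn E (fun v : Fin 1 → M => G (v 0))] : Df1 E G := ⟨h⟩
instance {G : M → M → Prop} [h : Dfn E (fun v : Fin 2 → M => G (v 0) (v 1))] : Df2 E G := ⟨h⟩
instance {G : M → M → M → Prop} [h : Dfn E (fun v : Fin 3 → M => G (v 0) (v 1) (v 2))] : Df3 E G := ⟨h⟩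
section
variable {n : ℕ} {t s r : (Fin n → M) → M} [DFn E t] [DFn E s] [DFn E r]
instance (priority := 10) {G : M → Prop} [h : Df1 E G] : Dfn E (fun v => G (t v)) := Dfn.sub1 h.out t
instance (priority := 10) {G : M → M → Prop} [h : Df2 E G] : Dfn E (fun v => G (t v) (s v)) := Dfn.sub2 h.out t s
instance (priority := 10) {G : M → M → M → Prop} [h : Df3 E G] : Dfn E (fun v => G (t v) (s v) (r v)) :=
  Dfn.sub3 h.out t s r
end

variable [Z : ZFM E]
theorem fn_mk (a : M) (R : M → M → Prop) [hR : Df2 E R] (h : ∀ x, E x a → ∃! y, R x y) :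
    ∃ f, IsFuncOn E f a ∧ ∀ x y, E (kp E x y) f ↔ E x a ∧ R x y := by
  obtain ⟨f, hf⟩ := replP (E := E) a (fun x p => ∃ y, R x y ∧ p = kp E x y) (by
    rintro x y y' hx ⟨u, hu, rfl⟩ ⟨u', hu', rfl⟩
    rw [(h x hx).unique hu hu'])
  have h2 : ∀ x y, E (kp E x y) f ↔ E x a ∧ R x y := by
    intro x y
    rw [hf]
    constructor
    · rintro ⟨x', hx', y', hy', e⟩
      obtain ⟨rfl, rfl⟩ := kp_inj.1 e; exact ⟨hx', hy'⟩
    · rintro ⟨hx, hy⟩; exact ⟨x, hx, y, hy, rfl⟩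
  refine ⟨f, ⟨⟨fun p hp => ?_, fun x y y' => ?_⟩, fun x => ?_⟩, h2⟩
  · obtain ⟨x, _, y, _, rfl⟩ := (hf p).1 hp
    exact ⟨x, y, isKPair_iff.2 rfl⟩
  · rw [pairIn_iff, pairIn_iff, h2, h2]; exact fun h1 h3 => (h x h1.1).unique h1.2 h3.2
  · simp only [pairIn_iff, h2]
    exact ⟨fun ⟨y, hy, _⟩ => hy, fun hx => ⟨_, hx, (h x hx).choose_spec.1⟩⟩

theorem fun_val {f d x : M} (hf : IsFuncOn E f d) (hx : E x d) : ∃ y, E (kp E x y) f := by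
  obtain ⟨y, hy⟩ := (hf.2 x).2 hx; exact ⟨y, pairIn_iff.1 hy⟩
theorem fun_dom {f d x y : M} (hf : IsFuncOn E f d) (h : E (kp E x y) f) : E x d :=
  (hf.2 x).1 ⟨y, pairIn_iff.2 h⟩
theorem fun_uniq {f d x y y' : M} (hf : IsFuncOn E f d) (h : E (kp E x y) f) (h' : E (kp E x y') f) : y = y' :=
  hf.1.2 x y y' (pairIn_iff.2 h) (pairIn_iff.2 h')
theorem fun_ext {f d g c : M} (hf : IsFuncOn E f d) (hg : IsFuncOn E g c)
    (h : ∀ x y, E (kp E x y) f ↔ E (kp E x y) g) : f = g := by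
  refine ext (E := E) fun p => ⟨fun hp => ?_, fun hp => ?_⟩
  · obtain ⟨x, y, e⟩ := hf.1.1 p hp
    rw [isKPair_iff] at e; subst e; exact (h _ _).1 hp
  · obtain ⟨x, y, e⟩ := hg.1.1 p hp
    rw [isKPair_iff] at e; subst e; exact (h _ _).2 hp
theorem dom_uniq {f d c : M} (hf : IsFuncOn E f d) (hg : IsFuncOn E f c) : d = c :=
  ext (E := E) fun x => by rw [← hf.2, ← hg.2]
theorem restr_iff {f d r : M} : IsRestrOfFn E f d r ↔
    IsFuncOn E r d ∧ ∀ x y, E (kp E x y) r ↔ (E x d ∧ E (kp E x y) f) := by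
  simp only [IsRestrOfFn, pairIn_iff]
theorem restr_ex {f d c : M} (hf : IsFuncOn E f d) (hc : SubsetE E c d) : ∃ r, IsRestrOfFn E f c r := by
  obtain ⟨r, h1, h2⟩ := fn_mk (E := E) c (fun x y => E (kp E x y) f) (fun x hx => by
    obtain ⟨y, hy⟩ := fun_val hf (hc x hx)
    exact ⟨y, hy, fun y' hy' => fun_uniq hf hy' hy⟩)
  exact ⟨r, restr_iff.2 ⟨h1, h2⟩⟩
theorem restr_uniq {f d r r' : M} (h : IsRestrOfFn E f d r) (h' : IsRestrOfFn E f d r') : r = r' := by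
  rw [restr_iff] at h h'
  exact fun_ext h.1 h'.1 (fun x y => by rw [h.2, h'.2])

/-- attempts -/
def Att (E : M → M → Prop) (G : M → M → Prop) (H a : M) : Prop :=
  IsFuncOn E H a ∧ ∀ b y, PairIn E H b y → ∃ H', IsRestrOfFn E H b H' ∧ G H' y
def RecR (E : M → M → Prop) (G : M → M → Prop) (a x : M) : Prop :=
  IsOrd E a ∧ ∃ H, Att E G H a ∧ G H x
section
variable {G : M → M → Prop} [hG : Df2 E G]
instance Att.dfn {n : ℕ} {t s : (Fin n → M) → M} [DFn E t] [DFn E s] : Dfn E (fun v => Att E G (t v) (s v)) :=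
  Dfn.sub2 (by unfold Att; infer_instance) t s
instance RecR.dfn {n : ℕ} {t s : (Fin n → M) → M} [DFn E t] [DFn E s] : Dfn E (fun v => RecR E G (t v) (s v)) :=
  Dfn.sub2 (by unfold RecR; infer_instance) t s

theorem att_restr {H a b r : M} (ha : IsOrd E a) (h : Att E G H a) (hb : E b a) (hr : IsRestrOfFn E H b r) :
    Att E G r b := by
  rw [restr_iff] at hr
  refine ⟨hr.1, fun c y hcy => ?_⟩
  rw [pairIn_iff, hr.2] at hcy
  obtain ⟨H', h1, h2⟩ := h.2 c y (pairIn_iff.2 hcy.2)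
  rw [restr_iff] at h1
  refine ⟨H', restr_iff.2 ⟨h1.1, fun x z => ?_⟩, h2⟩
  rw [h1.2, hr.2]
  exact ⟨fun h => ⟨h.1, (ord_mem ha hb).1 _ hcy.1 _ h.1, h.2⟩, fun h => ⟨h.1, h.2.2⟩⟩

theorem att_uniq (hf : ∀ H x y, G H x → G H y → x = y) {H H' a : M} (ha : IsOrd E a)
    (h : Att E G H a) (h' : Att E G H' a) : H = H' := by
  have key : ∀ b, IsOrd E b → E b a → ∀ y, E (kp E b y) H ↔ E (kp E b y) H' := by
    refine ord_ind (E := E) (fun b => E b a → ∀ y, E (kp E b y) H ↔ E (kp E b y) H') ?_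
    intro b hb ih hba y
    obtain ⟨u, hu⟩ := fun_val h.1 hba
    obtain ⟨u', hu'⟩ := fun_val h'.1 hba
    obtain ⟨r, hr, hg⟩ := h.2 b u (pairIn_iff.2 hu)
    obtain ⟨r', hr', hg'⟩ := h'.2 b u' (pairIn_iff.2 hu')
    rw [restr_iff] at hr hr'
    have : r = r' := fun_ext hr.1 hr'.1 (fun x z => by
      rw [hr.2, hr'.2]
      exact and_congr_right fun hx => ih x hx (ha.1 _ hba _ hx) z)
    subst this
    have e := hf _ _ _ hg hg'
    subst e
    exact ⟨fun hy => fun_uniq h.1 hu hy ▸ hu', fun hy => fun_uniq h'.1 hu' hy ▸ hu⟩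
  refine fun_ext h.1 h'.1 (fun x y => ⟨fun hxy => ?_, fun hxy => ?_⟩)
  · have hx := fun_dom h.1 hxy
    exact (key x (ord_mem ha hx) hx y).1 hxy
  · have hx := fun_dom h'.1 hxy
    exact (key x (ord_mem ha hx) hx y).2 hxy

theorem recR_main (hf : ∀ H, ∃! x, G H x) : ∀ a, IsOrd E a →
    ∃ H, Att E G H a ∧ ∀ b y, E (kp E b y) H ↔ E b a ∧ RecR E G b y := by
  have hu : ∀ H x y, G H x → G H y → x = y := fun H x y h h' => (hf H).unique h h'
  have ex : ∀ a, IsOrd E a → ∃ H, Att E G H a := by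
    refine ord_ind (E := E) (fun a => ∃ H, Att E G H a) (fun a ha ih => ?_)
    obtain ⟨H, h1, h2⟩ := fn_mk (E := E) a (RecR E G) (fun b hb => by
      obtain ⟨H, hH⟩ := ih b hb
      obtain ⟨x, hx, _⟩ := hf H
      refine ⟨x, ⟨ord_mem ha hb, H, hH, hx⟩, ?_⟩
      rintro y ⟨_, H', hH', hy⟩
      rw [att_uniq hu (ord_mem ha hb) hH' hH] at hy
      exact hu _ _ _ hy hx)
    refine ⟨H, h1, fun b y hby => ?_⟩
    obtain ⟨hba, hbo, K, hK, hKy⟩ := (h2 b y).1 (pairIn_iff.1 hby)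
    refine ⟨K, restr_iff.2 ⟨hK.1, fun c z => ?_⟩, hKy⟩
    rw [h2]
    constructor
    · intro hc
      have hcb := fun_dom hK.1 hc
      refine ⟨hcb, ha.1 _ hba _ hcb, ord_mem hbo hcb, ?_⟩
      obtain ⟨r, hr, hrz⟩ := hK.2 c z (pairIn_iff.2 hc)
      exact ⟨r, att_restr hbo hK hcb hr, hrz⟩
    · rintro ⟨hcb, hca, hco, r, hr, hrz⟩
      obtain ⟨z', hz'⟩ := fun_val hK.1 hcb
      obtain ⟨r', hr', hrz'⟩ := hK.2 c z' (pairIn_iff.2 hz')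
      have := att_uniq hu hco (att_restr hbo hK hcb hr') hr
      subst this
      rw [hu _ _ _ hrz hrz']; exact hz'
  intro a ha
  obtain ⟨H, hH⟩ := ex a ha
  refine ⟨H, hH, fun b y => ?_⟩
  constructor
  · intro h
    have hb := fun_dom hH.1 h
    obtain ⟨r, hr, hrz⟩ := hH.2 b y (pairIn_iff.2 h)
    exact ⟨hb, ord_mem ha hb, r, att_restr ha hH hb hr, hrz⟩
  · rintro ⟨hb, hbo, r, hr, hry⟩
    obtain ⟨z, hz⟩ := fun_val hH.1 hb
    obtain ⟨r', hr', hrz'⟩ := hH.2 b z (pairIn_iff.2 hz)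
    have := att_uniq hu hbo (att_restr ha hH hb hr') hr
    subst this
    rw [hu _ _ _ hry hrz']; exact hz

theorem recR_total (hf : ∀ H, ∃! x, G H x) {a : M} (ha : IsOrd E a) : ∃ x, RecR E G a x := by
  obtain ⟨H, h, _⟩ := recR_main hf a ha
  exact ⟨_, ha, H, h, (hf H).choose_spec.1⟩
theorem recR_uniq (hf : ∀ H, ∃! x, G H x) {a x y : M} (h : RecR E G a x) (h' : RecR E G a y) : x = y := by
  obtain ⟨ha, H, hH, hx⟩ := h
  obtain ⟨_, H', hH', hy⟩ := h'
  have := att_uniq (fun H x y h h' => (hf H).unique h h') ha hH hH'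
  subst this
  exact (hf H).unique hx hy
/-- unfold the recursion at `a` -/
theorem recR_unf (hf : ∀ H, ∃! x, G H x) {a x : M} (h : RecR E G a x) : ∃ H, IsFuncOn E H a ∧
    (∀ b y, E (kp E b y) H ↔ E b a ∧ RecR E G b y) ∧ G H x := by
  obtain ⟨ha, H', hH', hx⟩ := h
  obtain ⟨H, h1, h2⟩ := recR_main hf a ha
  have := att_uniq (fun H x y h h' => (hf H).unique h h') ha h1 hH'
  subst this
  exact ⟨H, h1.1, h2, hx⟩
end

/- recursion with zero, successor, limit cases -/
def TriG (E : M → M → Prop) (z0 : M) (F : M → M → Prop) (H x : M) : Prop :=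
  (∃ d n y, IsFuncOn E H d ∧ IsSuccOf E n d ∧ PairIn E H n y ∧ F y x) ∨
  (¬ (∃ d n, IsFuncOn E H d ∧ IsSuccOf E n d) ∧
    ((∃ d, IsFuncOn E H d ∧ IsLimitOrd E d) ∧ (∀ u, E u x ↔ ∃ c y, PairIn E H c y ∧ E u y) ∨
     ¬ (∃ d, IsFuncOn E H d ∧ IsLimitOrd E d) ∧ x = z0))
abbrev TriR (E : M → M → Prop) (z0 : M) (F : M → M → Prop) : M → M → Prop := RecR E (TriG E z0 F)

section
variable {z0 : M} {F : M → M → Prop} [hF : Df2 E F]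
instance TriG.dfn {n : ℕ} {t s : (Fin n → M) → M} [DFn E t] [DFn E s] : Dfn E (fun v => TriG E z0 F (t v) (s v)) :=
  Dfn.sub2 (by unfold TriG; infer_instance) t s
theorem ran_ex (H : M) : ∃ x, ∀ u, E u x ↔ ∃ c, E (kp E c u) H := by
  refine ⟨sepS E (Un E (Un E H)) (fun u => ∃ c, E (kp E c u) H), fun u => ?_⟩
  rw [mem_sepS (E := E)]
  exact ⟨fun h => h.2, fun ⟨c, hc⟩ => ⟨(kp_mem_UnUn hc).2, c, hc⟩⟩
theorem triG_tot (hf : ∀ y, ∃! x, F y x) (H : M) : ∃! x, TriG E z0 F H x := by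
  by_cases h1 : ∃ d n, IsFuncOn E H d ∧ IsSuccOf E n d
  · obtain ⟨d, n, hd, hn⟩ := h1
    have hn' := isSuccOf_iff.1 hn; subst hn'
    obtain ⟨y, hy⟩ := fun_val hd (mem_sc.2 (Or.inr rfl))
    obtain ⟨x, hx, hxu⟩ := hf y
    refine ⟨x, Or.inl ⟨_, n, y, hd, hn, pairIn_iff.2 hy, hx⟩, ?_⟩
    rintro x' (⟨d', n', y', h1, h2, h3, h4⟩ | ⟨h, _⟩)
    · have := dom_uniq hd h1; subst this
      have := sc_inj (isSuccOf_iff.1 h2); subst this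
      rw [pairIn_iff] at h3
      have := fun_uniq hd hy h3; subst this
      exact hxu _ h4
    · exact (h ⟨_, n, hd, hn⟩).elim
  · have h1' : ¬ (∃ d n y, IsFuncOn E H d ∧ IsSuccOf E n d ∧ PairIn E H n y ∧ True) := by
      rintro ⟨d, n, y, h, h', _⟩; exact h1 ⟨d, n, h, h'⟩
    by_cases h2 : ∃ d, IsFuncOn E H d ∧ IsLimitOrd E d
    · obtain ⟨x, hx⟩ := ran_ex (E := E) H
      have hU : ∀ u, E u (Un E x) ↔ ∃ c y, PairIn E H c y ∧ E u y := by
        intro u; simp only [mem_Un, hx, pairIn_iff]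
        exact ⟨fun ⟨y, ⟨c, h⟩, h'⟩ => ⟨c, y, h, h'⟩, fun ⟨c, y, h, h'⟩ => ⟨y, ⟨c, h⟩, h'⟩⟩
      refine ⟨Un E x, Or.inr ⟨h1, Or.inl ⟨h2, hU⟩⟩, ?_⟩
      rintro x' (⟨d', n', y', g1, g2, g3, g4⟩ | ⟨_, (⟨_, h⟩ | ⟨h, _⟩)⟩)
      · exact (h1 ⟨_, _, g1, g2⟩).elim
      · exact ext (E := E) fun u => by rw [h, hU]
      · exact (h h2).elim
    · refine ⟨z0, Or.inr ⟨h1, Or.inr ⟨h2, rfl⟩⟩, ?_⟩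
      rintro x' (⟨d', n', y', g1, g2, g3, g4⟩ | ⟨_, (⟨h, _⟩ | ⟨_, h⟩)⟩)
      · exact (h1 ⟨_, _, g1, g2⟩).elim
      · exact (h2 h).elim
      · exact h
variable (hf : ∀ y, ∃! x, F y x)
include hf
theorem tri_total {a : M} (ha : IsOrd E a) : ∃ x, TriR E z0 F a x := recR_total (triG_tot hf) ha
theorem tri_uniq {a x y : M} (h : TriR E z0 F a x) (h' : TriR E z0 F a y) : x = y :=
  recR_uniq (triG_tot hf) h h'
theorem tri_zero {x : M} (h : TriR E z0 F (emp E) x) : x = z0 := by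
  obtain ⟨H, h1, h2, h3⟩ := recR_unf (triG_tot hf) h
  rcases h3 with ⟨d, n, y, g1, g2, g3, g4⟩ | ⟨_, (⟨⟨d, g, g'⟩, _⟩ | ⟨_, h⟩)⟩
  · have := dom_uniq h1 g1; subst this
    exact (sc_ne_emp (isSuccOf_iff.1 g2).symm).elim
  · have := dom_uniq h1 g; subst this
    exact (lim_ne_emp g' rfl).elim
  · exact h
theorem tri_sc {a x y : M} (h : TriR E z0 F a x) (h' : TriR E z0 F (sc E a) y) : F x y := by
  obtain ⟨H, h1, h2, h3⟩ := recR_unf (triG_tot hf) h'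
  rcases h3 with ⟨d, n, y', g1, g2, g3, g4⟩ | ⟨g, _⟩
  · have := dom_uniq h1 g1; subst this
    have := sc_inj (isSuccOf_iff.1 g2); subst this
    rw [pairIn_iff, h2] at g3
    rw [tri_uniq hf h g3.2]; exact g4
  · exact (g ⟨_, a, h1, isSuccOf_iff.2 rfl⟩).elim
theorem tri_lim {a x : M} (ha : IsLimitOrd E a) (h : TriR E z0 F a x) :
    ∀ u, E u x ↔ ∃ c y, E c a ∧ TriR E z0 F c y ∧ E u y := by
  obtain ⟨H, h1, h2, h3⟩ := recR_unf (triG_tot hf) h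
  rcases h3 with ⟨d, n, y', g1, g2, g3, g4⟩ | ⟨g, (⟨_, g⟩ | ⟨g, _⟩)⟩
  · have := dom_uniq h1 g1; subst this
    exact (lim_ne_sc ha (isSuccOf_iff.1 g2)).elim
  · intro u; simp only [g u, pairIn_iff, h2, and_assoc]
  · exact (g ⟨_, h1, ha⟩).elim
theorem tri_fun (a : M) (ha : IsOrd E a) : ∃ H, IsFuncOn E H a ∧
    ∀ b y, E (kp E b y) H ↔ E b a ∧ TriR E z0 F b y :=
  fn_mk (E := E) a (TriR E z0 F) (fun b hb => by
    obtain ⟨x, hx⟩ := tri_total (z0 := z0) hf (ord_mem ha hb)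
    exact ⟨x, hx, fun y hy => tri_uniq hf hy hx⟩)
end
end

set_option autoImplicit false
set_option maxHeartbeats 1000000
set_option linter.unusedSectionVars false
section
variable {M : Type} {E : M → M → Prop}
def GM (E : M → M → Prop) : ℕ → M → M → M → Prop
  | 0, w, x, y => w = x ∨ w = y
  | 1, w, x, y => ∃ u v, E u x ∧ E v y ∧ IsKPair E w u v
  | 2, w, x, y => ∃ u v, E u x ∧ E v y ∧ E u v ∧ IsKPair E w u v
  | 3, w, x, y => E w x ∧ ¬ E w y
  | 4, w, x, y => E w x ∧ E w y
  | 5, w, x, _ => ∃ u, E u x ∧ E w u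
  | 6, w, x, _ => ∃ p u, E p x ∧ IsKPair E p w u
  | 7, w, x, _ => ∃ u v p, E p x ∧ IsKPair E p u v ∧ IsKPair E w v u
  | 8, t, x, _ => ∃ u v w t', E t' x ∧ IsKTriple E t' u w v ∧ IsKTriple E t u v w
  | _ + 9, t, x, _ => ∃ u v w t', E t' x ∧ IsKTriple E t' v w u ∧ IsKTriple E t u v w
def GOp (E : M → M → Prop) (i : ℕ) (z x y : M) : Prop := ∀ w, E w z ↔ GM E i w x y

section
variable {n : ℕ} {t s r q : (Fin n → M) → M} [DFn E t] [DFn E s] [DFn E r] [DFn E q]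
instance GM.dfn (i : ℕ) : Dfn E (fun v => GM E i (t v) (s v) (r v)) := by
  refine Dfn.sub3 (R := GM E i) ?_ t s r
  match i with
  | 0 | 1 | 2 | 3 | 4 | 5 | 6 | 7 | 8 | k + 9 => unfold GM; infer_instance
instance GOp.dfn (i : ℕ) : Dfn E (fun v => GOp E i (t v) (s v) (r v)) :=
  Dfn.sub3 (by unfold GOp; infer_instance) t s r
end

theorem gclosed_iff {c : M} : GClosed E c ↔
    ∀ i, ∀ x y z, E x c → E y c → GOp E i z x y → E z c := by
  constructor
  · rintro ⟨h1, h2⟩ i x y z hx hy h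
    match i with
    | 0 => exact h1 x y z hx hy (Or.inl h)
    | 1 => exact h1 x y z hx hy (Or.inr (Or.inl h))
    | 2 => exact h1 x y z hx hy (Or.inr (Or.inr (Or.inl h)))
    | 3 => exact h1 x y z hx hy (Or.inr (Or.inr (Or.inr (Or.inl h))))
    | 4 => exact h1 x y z hx hy (Or.inr (Or.inr (Or.inr (Or.inr h))))
    | 5 => exact h2 x z hx (Or.inl h)
    | 6 => exact h2 x z hx (Or.inr (Or.inl h))
    | 7 => exact h2 x z hx (Or.inr (Or.inr (Or.inl h)))
    | 8 => exact h2 x z hx (Or.inr (Or.inr (Or.inr (Or.inl h))))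
    | k + 9 => exact h2 x z hx (Or.inr (Or.inr (Or.inr (Or.inr h))))
  · intro h
    refine ⟨fun x y z hx hy h' => ?_, fun x z hx h' => ?_⟩
    · rcases h' with h' | h' | h' | h' | h'
      · exact h 0 x y z hx hy h'
      · exact h 1 x y z hx hy h'
      · exact h 2 x y z hx hy h'
      · exact h 3 x y z hx hy h'
      · exact h 4 x y z hx hy h'
    · rcases h' with h' | h' | h' | h' | h'
      · exact h 5 x x z hx hx h'
      · exact h 6 x x z hx hx h'
      · exact h 7 x x z hx hx h'
      · exact h 8 x x z hx hx h'
      · exact h 9 x x z hx hx h'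
theorem gop_big {i : ℕ} {z x y : M} : GOp E (i + 9) z x y ↔ GOp E 9 z x y := Iff.rfl
theorem gop_fin {i : ℕ} {z x y : M} (h : GOp E i z x y) : ∃ j, j < 10 ∧ GOp E j z x y := by
  by_cases hi : i < 10
  · exact ⟨i, hi, h⟩
  · obtain ⟨k, rfl⟩ : ∃ k, i = k + 9 := ⟨i - 9, by omega⟩
    exact ⟨9, by omega, h⟩

variable [Z : ZFM E]
theorem gop_ex (i : ℕ) (x y : M) : ∃ z, GOp E i z x y := by
  have key : ∀ a : M, (∀ w, GM E i w x y → E w a) → ∃ z, GOp E i z x y := fun a h =>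
    ⟨sepS E a (fun w => GM E i w x y), fun w => by
      rw [mem_sepS (E := E)]; exact ⟨fun h => h.2, fun h' => ⟨h w h', h'⟩⟩⟩
  have U : ∀ {p a b : M}, E p x → p = kp E a b → E a (Un E (Un E x)) ∧ E b (Un E (Un E x)) :=
    fun h e => kp_mem_UnUn (e ▸ h)
  have U3 : ∀ {p a b c : M}, E p x → p = kp E a (kp E b c) →
     E a (bun E (Un E (Un E x)) (Un E (Un E (Un E (Un E x))))) ∧
     E b (bun E (Un E (Un E x)) (Un E (Un E (Un E (Un E x))))) ∧
     E c (bun E (Un E (Un E x)) (Un E (Un E (Un E (Un E x))))) := by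
    intro p a b c h e
    have h1 := U h e
    have h2 := kp_mem_UnUn h1.2
    simp only [mem_bun]
    exact ⟨Or.inl h1.1, Or.inr h2.1, Or.inr h2.2⟩
  match i with
  | 0 => exact key (upr E x y) (fun w h => mem_upr.2 h)
  | 1 => exact key (prd E x y) (fun w ⟨u, v, h1, h2, h3⟩ => by
      rw [isKPair_iff] at h3; subst h3; exact kp_mem_prd.2 ⟨h1, h2⟩)
  | 2 => exact key (prd E x y) (fun w ⟨u, v, h1, h2, _, h3⟩ => by
      rw [isKPair_iff] at h3; subst h3; exact kp_mem_prd.2 ⟨h1, h2⟩)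
  | 3 => exact key x (fun w h => h.1)
  | 4 => exact key x (fun w h => h.1)
  | 5 => exact key (Un E x) (fun w h => mem_Un.2 h)
  | 6 => exact key (Un E (Un E x)) (fun w ⟨p, u, h, h'⟩ => (U h (isKPair_iff.1 h')).1)
  | 7 => exact key (prd E (Un E (Un E x)) (Un E (Un E x))) (fun w ⟨u, v, p, h, h', h''⟩ => by
      rw [isKPair_iff] at h' h''; subst h''
      exact kp_mem_prd.2 ⟨(U h h').2, (U h h').1⟩)
  | 8 => exact key _ (fun t ⟨u, v, w, t', h, h', h''⟩ => by
      rw [isKTriple_iff] at h' h''; subst h''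
      exact kp_mem_prd.2 ⟨(U3 h h').1, kp_mem_prd.2 ⟨(U3 h h').2.2, (U3 h h').2.1⟩⟩)
  | k + 9 => exact key _ (fun t ⟨u, v, w, t', h, h', h''⟩ => by
      rw [isKTriple_iff] at h' h''; subst h''
      exact kp_mem_prd.2 ⟨(U3 h h').2.2, kp_mem_prd.2 ⟨(U3 h h').1, (U3 h h').2.1⟩⟩)
theorem gop_uniq {i : ℕ} {x y z z' : M} (h : GOp E i z x y) (h' : GOp E i z' x y) : z = z' :=
  ext (E := E) fun w => by rw [h, h']

theorem im_ex (a : M) (R : M → M → Prop) [hR : Df2 E R] (hu : ∀ x y y', E x a → R x y → R x y' → y = y') :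
    ∃ b, ∀ y, E y b ↔ ∃ x, E x a ∧ R x y := replP (E := E) a R hu
/-- image under a definable binary partial function -/
theorem im2_ex (a c : M) (R : M → M → M → Prop) [hR : Df3 E R]
    (hu : ∀ x y z z', R x y z → R x y z' → z = z') :
    ∃ b, ∀ z, E z b ↔ ∃ x y, E x a ∧ E y c ∧ R x y z := by
  obtain ⟨b, hb⟩ := im_ex (E := E) (prd E a c) (fun p z => ∃ x y, p = kp E x y ∧ R x y z) (by
    rintro p z z' _ ⟨x, y, rfl, h⟩ ⟨x', y', e, h'⟩
    obtain ⟨rfl, rfl⟩ := kp_inj.1 e; exact hu _ _ _ _ h h')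
  refine ⟨b, fun z => ?_⟩
  rw [hb]
  constructor
  · rintro ⟨p, hp, x, y, rfl, h⟩; have hp := kp_mem_prd.1 hp; exact ⟨x, y, hp.1, hp.2, h⟩
  · rintro ⟨x, y, hx, hy, h⟩; exact ⟨_, kp_mem_prd.2 ⟨hx, hy⟩, x, y, rfl, h⟩
theorem fin_un (R : ℕ → M → Prop) (h : ∀ i, ∃ b, ∀ z, E z b ↔ R i z) (k : ℕ) :
    ∃ b, ∀ z, E z b ↔ ∃ i, i < k ∧ R i z := by
  induction k with
  | zero => exact ⟨emp E, fun z => ⟨fun h => (mem_emp h).elim, by rintro ⟨i, h, _⟩; omega⟩⟩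
  | succ k ih =>
    obtain ⟨b, hb⟩ := ih
    obtain ⟨c, hc⟩ := h k
    refine ⟨bun E b c, fun z => ?_⟩
    rw [mem_bun (E := E), hb, hc]
    constructor
    · rintro (⟨i, hi, h⟩ | h)
      · exact ⟨i, by omega, h⟩
      · exact ⟨k, by omega, h⟩
    · rintro ⟨i, hi, h⟩
      by_cases e : i = k
      · subst e; exact Or.inr h
      · exact Or.inl ⟨i, by omega, h⟩

/-- one closure step -/
def Stp (E : M → M → Prop) (y d : M) : Prop :=
  ∀ z, E z d ↔ E z y ∨ ∃ x w, E x y ∧ E w y ∧ ∃ i : Fin 10, GOp E i z x w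
instance Stp.dfn {n : ℕ} {t s : (Fin n → M) → M} [DFn E t] [DFn E s] : Dfn E (fun v => Stp E (t v) (s v)) := by
  refine Dfn.sub2 (R := Stp E) ?_ t s
  unfold Stp
  have : ∀ {n : ℕ} {t s r : (Fin n → M) → M} [DFn E t] [DFn E s] [DFn E r],
      Dfn E (fun v => ∃ i : Fin 10, GOp E i (t v) (s v) (r v)) := fun {n t s r} _ _ _ =>
    Dfn.fin (R := fun (i : Fin 10) v => GOp E i (t v) (s v) (r v)) (fun i => inferInstance)
  infer_instance
theorem stp_tot (y : M) : ∃! d, Stp E y d := by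
  obtain ⟨b, hb⟩ := fin_un (E := E) (fun i z => ∃ x w, E x y ∧ E w y ∧ GOp E i z x w)
    (fun i => im2_ex (E := E) y y (fun x w z => GOp E i z x w) (fun _ _ _ _ => gop_uniq)) 10
  have h : Stp E y (bun E y b) := by
    intro z
    rw [mem_bun (E := E), hb]
    refine or_congr_right ?_
    constructor
    · rintro ⟨i, hi, x, w, h1, h2, h3⟩; exact ⟨x, w, h1, h2, ⟨i, hi⟩, h3⟩
    · rintro ⟨x, w, h1, h2, ⟨i, hi⟩, h3⟩; exact ⟨i, hi, x, w, h1, h2, h3⟩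
  exact ⟨_, h, fun d hd => ext (E := E) fun z => by rw [hd, h]⟩

/-- witness form of iterating a step `F` through omega, starting at `b` with union `c` -/
def ItW (E : M → M → Prop) (F : M → M → Prop) (b c : M) : Prop :=
  ∃ w H, IsOmegaOrd E w ∧ IsFuncOn E H w ∧ (∀ n y, IsZero E n → PairIn E H n y → y = b) ∧
    (∀ n s y z, IsSuccOf E n s → PairIn E H n y → PairIn E H s z → F y z) ∧
    ∀ u, E u c ↔ ∃ n y, PairIn E H n y ∧ E u y
theorem om_uniq {w : M} (h : IsOmegaOrd E w) : w = om E := by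
  rcases ord_lin h.1.1 (om_ord (E := E)) with h' | h' | h'
  · exact (om_spec.2 _ h' h.1).elim
  · exact h'
  · exact (h.2 _ h' om_lim).elim
section
variable {F : M → M → Prop} [hF : Df2 E F]
theorem itw_ex (hf : ∀ y, ∃! x, F y x) (b : M) : ∃ c, ItW E F b c := by
  obtain ⟨H, h1, h2⟩ := tri_fun (z0 := b) hf (om E) om_ord
  obtain ⟨r, hr⟩ := ran_ex (E := E) H
  refine ⟨Un E r, om E, H, om_spec, h1, fun n y hn hy => ?_, fun n s y z hs hy hz => ?_, fun u => ?_⟩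
  · rw [isZero_iff] at hn; subst hn
    rw [pairIn_iff, h2] at hy
    exact tri_zero hf hy.2
  · rw [isSuccOf_iff] at hs; subst hs
    rw [pairIn_iff, h2] at hy hz
    exact tri_sc hf hy.2 hz.2
  · simp only [mem_Un, hr, pairIn_iff]
    exact ⟨fun ⟨y, ⟨c, h⟩, h'⟩ => ⟨c, y, h, h'⟩, fun ⟨c, y, h, h'⟩ => ⟨y, ⟨c, h⟩, h'⟩⟩
/-- base is included -/
theorem itw_base {b c : M} (h : ItW E F b c) : SubsetE E b c := by
  obtain ⟨w, H, hw, h1, h2, h3, h4⟩ := h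
  have := om_uniq hw; subst this
  obtain ⟨y, hy⟩ := fun_val h1 (lim_emp_mem om_lim)
  intro u hu
  refine (h4 u).2 ⟨emp E, y, pairIn_iff.2 hy, ?_⟩
  rw [h2 _ y (isZero_iff.2 rfl) (pairIn_iff.2 hy)]; exact hu
theorem itw_min {b c c' : M} (h : ItW E F b c) (hb : SubsetE E b c')
    (hc : ∀ y z, SubsetE E y c' → F y z → SubsetE E z c') : SubsetE E c c' := by
  obtain ⟨w, H, hw, h1, h2, h3, h4⟩ := h
  have := om_uniq hw; subst this
  have key : ∀ n, E n (om E) → ∀ y, E (kp E n y) H → SubsetE E y c' := by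
    refine om_ind (E := E) (fun n => ∀ y, E (kp E n y) H → SubsetE E y c') ?_ ?_
    · intro y hy
      rw [h2 _ y (isZero_iff.2 rfl) (pairIn_iff.2 hy)]; exact hb
    · intro n hn ih z hz
      obtain ⟨y, hy⟩ := fun_val h1 hn
      exact hc y z (ih y hy) (h3 n _ y z (isSuccOf_iff.2 rfl) (pairIn_iff.2 hy) (pairIn_iff.2 hz))
  intro u hu
  obtain ⟨n, y, hy, huy⟩ := (h4 u).1 hu
  rw [pairIn_iff] at hy
  exact key n (fun_dom h1 hy) y hy u huy
theorem itw_step {b c : M} (hinc : ∀ y z, F y z → SubsetE E y z) (h : ItW E F b c) {x x' : M} (hx : E x c) (hx' : E x' c) :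
    ∃ y z, F y z ∧ E x y ∧ E x' y ∧ SubsetE E z c := by
  obtain ⟨w, H, hw, h1, h2, h3, h4⟩ := h
  have := om_uniq hw; subst this
  have mono : ∀ n, E n (om E) → ∀ m, (E m n ∨ m = n) → ∀ y z, E (kp E m y) H → E (kp E n z) H → SubsetE E y z := by
    refine om_ind (E := E) (fun n => ∀ m, (E m n ∨ m = n) → ∀ y z, E (kp E m y) H → E (kp E n z) H → SubsetE E y z) ?_ ?_
    · rintro m (h | rfl) y z hy hz
      · exact (mem_emp h).elim
      · rw [fun_uniq h1 hy hz]; exact fun _ h => h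
    · rintro n hn ih m (h | rfl) y z hy hz
      · obtain ⟨y', hy'⟩ := fun_val h1 hn
        intro u hu
        exact hinc _ _ (h3 n _ y' z (isSuccOf_iff.2 rfl) (pairIn_iff.2 hy') (pairIn_iff.2 hz)) u
          (ih m (mem_sc.1 h) y y' hy hy' u hu)
      · rw [fun_uniq h1 hy hz]; exact fun _ h => h
  obtain ⟨n, y, hy, hxy⟩ := (h4 x).1 hx
  obtain ⟨n', y', hy', hxy'⟩ := (h4 x').1 hx'
  rw [pairIn_iff] at hy hy'
  have hn := fun_dom h1 hy
  have hn' := fun_dom h1 hy'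
  have fin : ∀ n y, E n (om E) → E (kp E n y) H → E x y → E x' y → ∃ y z, F y z ∧ E x y ∧ E x' y ∧ SubsetE E z c := by
    intro n y hn hy a a'
    obtain ⟨z, hz⟩ := fun_val h1 ((isLimitOrd_iff.1 (om_lim (E := E))).2.2 n hn)
    exact ⟨y, z, h3 n _ y z (isSuccOf_iff.2 rfl) (pairIn_iff.2 hy) (pairIn_iff.2 hz), a, a',
      fun u hu => (h4 u).2 ⟨_, z, pairIn_iff.2 hz, hu⟩⟩
  rcases ord_lin (ord_mem om_ord hn) (ord_mem om_ord hn') with h | h | h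
  · exact fin n' y' hn' hy' (mono n' hn' n (Or.inl h) y y' hy hy' x hxy) hxy'
  · exact fin n' y' hn' hy' (mono n' hn' n (Or.inr h) y y' hy hy' x hxy) hxy'
  · exact fin n y hn hy hxy (mono n hn n' (Or.inl h) y' y hy' hy x' hxy')
end
theorem itw_gcl {b c : M} (h : ItW E (Stp E) b c) : IsGClOf E b c := by
  refine ⟨itw_base h, gclosed_iff.2 fun i x y z hx hy hz => ?_, fun c' hb hc => itw_min h hb ?_⟩
  · obtain ⟨s, d, h1, h2, h3, h4⟩ := itw_step (fun y z h u hu => (h u).2 (Or.inl hu)) h hx hy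
    obtain ⟨j, hj, hz'⟩ := gop_fin hz
    exact h4 z ((h1 z).2 (Or.inr ⟨x, y, h2, h3, ⟨j, hj⟩, hz'⟩))
  · intro y d hy hd z hz
    rcases (hd z).1 hz with h | ⟨x, w, hx, hw, i, hi⟩
    · exact hy z h
    · exact gclosed_iff.1 hc i x w z (hy _ hx) (hy _ hw) hi
theorem gcl_uniq {b c c' : M} (h : IsGClOf E b c) (h' : IsGClOf E b c') : c = c' :=
  ext (E := E) fun z => ⟨h.2.2 _ h'.1 h'.2.1 z, h'.2.2 _ h.1 h.2.1 z⟩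
theorem gcl_ex (b : M) : ∃ c, IsGClOf E b c := by
  obtain ⟨c, hc⟩ := itw_ex (E := E) (F := Stp E) (stp_tot (E := E)) b; exact ⟨c, itw_gcl hc⟩
theorem trcl_ex (b : M) : ∃ t, IsTransClOf E b t := by
  have hf : ∀ y, ∃! x, x = bun E y (Un E y) := fun y => ⟨_, rfl, fun _ h => h⟩
  obtain ⟨c, hc⟩ := itw_ex (E := E) (F := fun y x => x = bun E y (Un E y)) hf b
  refine ⟨c, itw_base hc, fun y hy z hz => ?_, fun t' hb ht => itw_min hc hb ?_⟩
  · obtain ⟨s, d, h1, h2, h3, h4⟩ := itw_step (fun y z h u hu => by subst h; exact mem_bun.2 (Or.inl hu)) hc hy hy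
    subst h1
    exact h4 z (mem_bun.2 (Or.inr (mem_Un.2 ⟨y, h2, hz⟩)))
  · rintro y d hy rfl z hz
    rcases mem_bun.1 hz with h | h
    · exact hy z h
    · obtain ⟨u, hu, hz⟩ := mem_Un.1 h
      exact ht u (hy u hu) z hz
theorem trcl_uniq {b c c' : M} (h : IsTransClOf E b c) (h' : IsTransClOf E b c') : c = c' :=
  ext (E := E) fun z => ⟨h.2.2 _ h'.1 h'.2.1 z, h'.2.2 _ h.1 h.2.1 z⟩
theorem lzero_ex (b : M) : ∃! z, IsLZero E b z := by
  obtain ⟨t, ht⟩ := trcl_ex (E := E) b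
  refine ⟨bun E t (sing E b), ⟨t, ht, fun x => by rw [mem_bun (E := E), mem_sing (E := E)]⟩, ?_⟩
  rintro z ⟨t', ht', h⟩
  have := trcl_uniq ht ht'; subst this
  exact ext (E := E) fun x => by rw [h, mem_bun (E := E), mem_sing (E := E)]
theorem defset_iff {l d : M} : IsDefSetOf E l d ↔ ∃ c, IsGClOf E (sc E l) c ∧ ∀ y, E y d ↔ (SubsetE E y l ∧ E y c) := by
  constructor
  · rintro ⟨lp, c, h, h'⟩
    have : lp = sc E l := isSuccOf_iff.1 h
    subst this; exact ⟨c, h'⟩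
  · rintro ⟨c, h⟩
    exact ⟨sc E l, c, fun z => mem_sc (E := E), h⟩
theorem def_tot (l : M) : ∃! d, IsDefSetOf E l d := by
  obtain ⟨c, hc⟩ := gcl_ex (E := E) (sc E l)
  refine ⟨sepS E c (fun y => SubsetE E y l), defset_iff.2 ⟨c, hc, fun y => ?_⟩, fun d hd => ?_⟩
  · rw [mem_sepS (E := E)]; exact and_comm
  · obtain ⟨c', h, h'⟩ := defset_iff.1 hd
    have := gcl_uniq hc h; subst this
    exact ext (E := E) fun y => by rw [h', mem_sepS (E := E), and_comm]
abbrev LR (E : M → M → Prop) (z0 : M) : M → M → Prop := TriR E z0 (IsDefSetOf E)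
theorem lstage_iff {b z0 a l : M} (hz : IsLZero E b z0) : IsLStage E b a l ↔ LR E z0 a l := by
  constructor
  · rintro ⟨H, ⟨ha, hH, hd, h0, h1, h2⟩, hl⟩
    have hfo : IsFuncOn E H (sc E a) := ⟨hH, fun x => by rw [hd, mem_sc (E := E)]⟩
    have hsa := ord_sc ha
    have key : ∀ c, IsOrd E c → E c (sc E a) → ∀ y, E (kp E c y) H → LR E z0 c y := by
      refine ord_ind (E := E) (fun c => E c (sc E a) → ∀ y, E (kp E c y) H → LR E z0 c y) ?_
      intro c hc ih hca y hy
      obtain ⟨y', hy'⟩ := tri_total (z0 := z0) (def_tot (E := E)) hc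
      suffices y = y' by rw [this]; exact hy'
      rcases ord_tri hc with rfl | ⟨d, hdo, rfl⟩ | hlim
      · rw [tri_zero def_tot hy']
        exact (lzero_ex b).unique (h0 _ y (isZero_iff.2 rfl) (pairIn_iff.2 hy)) hz
      · have hdc : E d (sc E d) := mem_sc.2 (Or.inr rfl)
        have hda := ord_trans hsa hdc hca
        obtain ⟨u, hu⟩ := fun_val hfo hda
        have e1 := h1 d _ u y (isSuccOf_iff.2 rfl) (pairIn_iff.2 hu) (pairIn_iff.2 hy)
        have e2 := tri_sc def_tot (ih d hdc hda u hu) hy'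
        exact (def_tot u).unique e1 e2
      · refine ext (E := E) fun x => ?_
        rw [h2 c y hlim (pairIn_iff.2 hy), tri_lim def_tot hlim hy']
        constructor
        · rintro ⟨d, u, hd, hu, hx⟩
          exact ⟨d, u, hd, ih d hd (ord_trans hsa hd hca) u (pairIn_iff.1 hu), hx⟩
        · rintro ⟨d, u, hd, hu, hx⟩
          obtain ⟨u', hu'⟩ := fun_val hfo (ord_trans hsa hd hca)
          have := tri_uniq def_tot hu (ih d hd (ord_trans hsa hd hca) u' hu')
          subst this
          exact ⟨d, u, hd, pairIn_iff.2 hu', hx⟩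
    exact key a ha (mem_sc.2 (Or.inr rfl)) l (pairIn_iff.1 hl)
  · intro h
    have ha := h.1
    obtain ⟨H, h1, h2⟩ := tri_fun (z0 := z0) (def_tot (E := E)) (sc E a) (ord_sc ha)
    refine ⟨H, ⟨ha, h1.1, fun c => by rw [h1.2, mem_sc (E := E)], ?_, ?_, ?_⟩, pairIn_iff.2 ((h2 _ _).2 ⟨mem_sc.2 (Or.inr rfl), h⟩)⟩
    · intro c z hc hcz
      rw [isZero_iff] at hc; subst hc
      rw [pairIn_iff, h2] at hcz
      rw [tri_zero def_tot hcz.2]; exact hz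
    · intro c s z w hs hz hw
      rw [isSuccOf_iff] at hs; subst hs
      rw [pairIn_iff, h2] at hz hw
      exact tri_sc def_tot hz.2 hw.2
    · intro c z hc hz x
      simp only [pairIn_iff, h2] at hz ⊢
      rw [tri_lim def_tot hc hz.2]
      constructor
      · rintro ⟨d, u, hd, hu, hx⟩
        exact ⟨d, u, hd, ⟨ord_trans (ord_sc ha) hd hz.1, hu⟩, hx⟩
      · rintro ⟨d, u, hd, ⟨_, hu⟩, hx⟩
        exact ⟨d, u, hd, hu, hx⟩
theorem inL_iff {b z0 x : M} (hz : IsLZero E b z0) : InL E b x ↔ ∃ a l, LR E z0 a l ∧ E x l := by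
  simp only [InL, lstage_iff hz]

theorem def_trans {l d : M} (hl : TransSet E l) (h : IsDefSetOf E l d) : TransSet E d ∧ SubsetE E l d ∧ E l d := by
  obtain ⟨c, hc, hd⟩ := defset_iff.1 h
  have h1 : SubsetE E l d := fun x hx => (hd x).2 ⟨hl x hx, hc.1 x (mem_sc.2 (Or.inl hx))⟩
  exact ⟨fun y hy z hz => h1 z (((hd y).1 hy).1 z hz), h1, (hd l).2 ⟨fun _ h => h, hc.1 l (mem_sc.2 (Or.inr rfl))⟩⟩
theorem lzero_trans {b z0 : M} (hz : IsLZero E b z0) : TransSet E z0 ∧ E b z0 := by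
  obtain ⟨t, ht, h⟩ := hz
  refine ⟨fun y hy z hzy => (h z).2 (Or.inl ?_), (h b).2 (Or.inr rfl)⟩
  rcases (h y).1 hy with h' | rfl
  · exact ht.2.1 y h' z hzy
  · exact ht.1 z hzy
theorem LR_main {z0 : M} (hz : TransSet E z0) : ∀ a, IsOrd E a → ∀ l, LR E z0 a l →
    TransSet E l ∧ SubsetE E z0 l ∧ ∀ c k, E c a → LR E z0 c k → SubsetE E k l ∧ E k l := by
  refine ord_ind (E := E) (fun a => ∀ l, LR E z0 a l →
    TransSet E l ∧ SubsetE E z0 l ∧ ∀ c k, E c a → LR E z0 c k → SubsetE E k l ∧ E k l) ?_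
  intro a ha ih l hl
  rcases ord_tri ha with rfl | ⟨d, hdo, rfl⟩ | hlim
  · rw [tri_zero def_tot hl]
    exact ⟨hz, fun _ h => h, fun c k h => (mem_emp h).elim⟩
  · obtain ⟨u, hu⟩ := tri_total (z0 := z0) (def_tot (E := E)) hdo
    obtain ⟨g1, g2, g3⟩ := ih d (mem_sc.2 (Or.inr rfl)) u hu
    obtain ⟨f1, f2, f3⟩ := def_trans g1 (tri_sc def_tot hu hl)
    refine ⟨f1, fun x hx => f2 x (g2 x hx), fun c k hc hk => ?_⟩
    rcases mem_sc.1 hc with h | rfl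
    · have := g3 c k h hk
      exact ⟨fun x hx => f2 x (this.1 x hx), f2 k this.2⟩
    · rw [tri_uniq def_tot hk hu]; exact ⟨f2, f3⟩
  · have hm := tri_lim def_tot hlim hl
    refine ⟨fun y hy x hx => ?_, fun x hx => ?_, fun c k hc hk => ⟨fun x hx => (hm x).2 ⟨c, k, hc, hk, hx⟩, ?_⟩⟩
    · obtain ⟨c, k, hc, hk, hyk⟩ := (hm y).1 hy
      exact (hm x).2 ⟨c, k, hc, hk, (ih c hc k hk).1 y hyk x hx⟩
    · obtain ⟨k, hk⟩ := tri_total (z0 := z0) (def_tot (E := E)) (ord_emp (E := E))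
      refine (hm x).2 ⟨emp E, k, lim_emp_mem hlim, hk, ?_⟩
      rw [tri_zero def_tot hk]; exact hx
    · have hs := (isLimitOrd_iff.1 hlim).2.2 c hc
      obtain ⟨k', hk'⟩ := tri_total (z0 := z0) (def_tot (E := E)) (ord_mem ha hs)
      exact (hm k).2 ⟨_, k', hs, hk', ((ih _ hs k' hk').2.2 c k (mem_sc.2 (Or.inr rfl)) hk).2⟩
end

set_option autoImplicit false
set_option maxHeartbeats 1000000
set_option linter.unusedSectionVars false
section
variable {M : Type} {E : M → M → Prop}
inductive Fm : ℕ → Type where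
  | mem : {n : ℕ} → Fin n → Fin n → Fm n
  | nand : {n : ℕ} → Fm n → Fm n → Fm n
  | ex : {n : ℕ} → Fm (n + 1) → Fm n
def ev (E : M → M → Prop) (C : M → Prop) : {n : ℕ} → Fm n → (Fin n → M) → Prop
  | _, Fm.mem i j, v => E (v i) (v j)
  | _, Fm.nand f g, v => ¬ (ev E C f v ∧ ev E C g v)
  | _, Fm.ex f, v => ∃ x, C x ∧ ev E C f (Fin.cons x v)
abbrev Fm.ng {n : ℕ} (f : Fm n) : Fm n := Fm.nand f f
abbrev Fm.im {n : ℕ} (f g : Fm n) : Fm n := Fm.nand f g.ng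
abbrev Fm.al {n : ℕ} (f : Fm (n + 1)) : Fm n := (Fm.ex f.ng).ng
def tr : {n : ℕ} → Fml n → Fm n
  | _, Fml.mem i j => Fm.mem i j
  | _, Fml.equ i j => Fm.al (Fm.nand (Fm.nand (Fm.mem 0 i.succ) (Fm.mem 0 j.succ))
      (Fm.nand (Fm.mem 0 i.succ).ng (Fm.mem 0 j.succ).ng))
  | _, Fml.aux i => (Fm.im (Fm.mem i i) (Fm.mem i i)).ng
  | _, Fml.impl f g => Fm.im (tr f) (tr g)
  | _, Fml.neg f => (tr f).ng
  | _, Fml.all f => Fm.al (tr f)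
  | _, Fml.ex f => Fm.ex (tr f)
  | _, Fml.allb i f => Fm.al (Fm.im (Fm.mem 0 i.succ) (tr f))
theorem ev_ng {C : M → Prop} {n : ℕ} (f : Fm n) (v : Fin n → M) : ev E C f.ng v ↔ ¬ ev E C f v := by
  simp [ev]
theorem ev_im {C : M → Prop} {n : ℕ} (f g : Fm n) (v : Fin n → M) : ev E C (f.im g) v ↔ (ev E C f v → ev E C g v) := by
  simp [ev]
theorem ev_al {C : M → Prop} {n : ℕ} (f : Fm (n + 1)) (v : Fin n → M) :
    ev E C f.al v ↔ ∀ x, C x → ev E C f (Fin.cons x v) := by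
  simp [ev]
theorem ev_tr (hE : ∀ x y : M, (∀ z, E z x ↔ E z y) → x = y) {C : M → Prop}
    (hC : ∀ x y, C x → E y x → C y) {n : ℕ} (f : Fml n) :
    ∀ v : Fin n → M, (∀ i, C (v i)) → (ev E C (tr f) v ↔ Eval E NoAux C f v) := by
  have hc : ∀ {n : ℕ} {v : Fin n → M} {x : M}, (∀ i, C (v i)) → C x → ∀ i, C ((Fin.cons x v : Fin (n+1) → M) i) := by
    intro n v x hv hx i
    refine Fin.cases ?_ (fun i => ?_) i
    · exact hx
    · exact hv i
  induction f with
  | mem i j => intro v _; rfl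
  | equ i j =>
    intro v hv
    simp only [tr, Eval, ev, and_self, not_not, Fin.cons_zero, Fin.cons_succ]
    constructor
    · intro h
      refine hE _ _ fun z => ⟨fun hz => ?_, fun hz => ?_⟩
      · by_contra h'
        exact h ⟨z, hC _ _ (hv i) hz, by tauto⟩
      · by_contra h'
        exact h ⟨z, hC _ _ (hv j) hz, by tauto⟩
    · intro h
      rw [h]
      rintro ⟨x, _, h⟩; tauto
  | aux i => intro v _; simp [tr, Eval, ev, NoAux]
  | impl f g ihf ihg => intro v hv; rw [tr, ev_im, ihf v hv, ihg v hv]; rfl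
  | neg f ih => intro v hv; rw [tr, ev_ng, ih v hv]; rfl
  | all f ih =>
    intro v hv; rw [tr, ev_al]
    exact forall_congr' fun x => forall_congr' fun hx => ih _ (hc hv hx)
  | ex f ih =>
    intro v hv
    exact exists_congr fun x => and_congr_right fun hx => ih _ (hc hv hx)
  | allb i f ih =>
    intro v hv; rw [tr, ev_al]
    refine forall_congr' fun x => forall_congr' fun hx => ?_
    rw [ev_im, ih _ (hc hv hx)]; simp [ev]

variable [Z : ZFM E]
section
variable {c : M} (hc : GClosed E c)
include hc
theorem gc (i : ℕ) {x y : M} (hx : E x c) (hy : E y c) : ∃ z, E z c ∧ ∀ w, E w z ↔ GM E i w x y := by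
  obtain ⟨z, hz⟩ := gop_ex (E := E) i x y
  exact ⟨z, gclosed_iff.1 hc i x y z hx hy hz, hz⟩
theorem gc_upr {x y : M} (hx : E x c) (hy : E y c) : E (upr E x y) c := by
  obtain ⟨z, h, h'⟩ := gc hc 0 hx hy
  have : z = upr E x y := ext (E := E) fun w => by rw [h', mem_upr (E := E)]; rfl
  rw [← this]; exact h
theorem gc_kp {x y : M} (hx : E x c) (hy : E y c) : E (kp E x y) c :=
  gc_upr hc (gc_upr hc hx hx) (gc_upr hc hx hy)
theorem gc_prd {x y : M} (hx : E x c) (hy : E y c) : E (prd E x y) c := by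
  obtain ⟨z, h, h'⟩ := gc hc 1 hx hy
  have : z = prd E x y := ext (E := E) fun w => by
    rw [h', mem_prd (E := E)]; simp only [GM, isKPair_iff]
  rw [← this]; exact h
theorem gc_diff {x y : M} (hx : E x c) (hy : E y c) : ∃ z, E z c ∧ ∀ w, E w z ↔ E w x ∧ ¬ E w y :=
  gc hc 3 hx hy
theorem gc_int {x y : M} (hx : E x c) (hy : E y c) : ∃ z, E z c ∧ ∀ w, E w z ↔ E w x ∧ E w y :=
  gc hc 4 hx hy
theorem gc_dom {x : M} (hx : E x c) : ∃ z, E z c ∧ ∀ w, E w z ↔ ∃ u, E (kp E w u) x := by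
  obtain ⟨z, h, h'⟩ := gc hc 6 hx hx
  refine ⟨z, h, fun w => ?_⟩
  rw [h']; simp only [GM, isKPair_iff]
  exact ⟨fun ⟨p, u, h, e⟩ => ⟨u, e ▸ h⟩, fun ⟨u, h⟩ => ⟨_, u, h, rfl⟩⟩
/-- image of a set of pairs under a permutation operation -/
theorem gc_conv {x : M} (hx : E x c) : ∃ z, E z c ∧ ∀ w, E w z ↔ ∃ u v, E (kp E u v) x ∧ w = kp E v u := by
  obtain ⟨z, h, h'⟩ := gc hc 7 hx hx
  refine ⟨z, h, fun w => ?_⟩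
  rw [h']; simp only [GM, isKPair_iff]
  exact ⟨fun ⟨u, v, p, h, e, e'⟩ => ⟨u, v, e ▸ h, e'⟩, fun ⟨u, v, h, e⟩ => ⟨u, v, _, h, rfl, e⟩⟩
theorem gc_p1 {x : M} (hx : E x c) : ∃ z, E z c ∧ ∀ t, E t z ↔ ∃ u v w, E (kp E u (kp E w v)) x ∧ t = kp E u (kp E v w) := by
  obtain ⟨z, h, h'⟩ := gc hc 8 hx hx
  refine ⟨z, h, fun w => ?_⟩
  rw [h']; simp only [GM, isKTriple_iff]
  exact ⟨fun ⟨u, v, w, p, h, e, e'⟩ => ⟨u, v, w, e ▸ h, e'⟩, fun ⟨u, v, w, h, e⟩ => ⟨u, v, w, _, h, rfl, e⟩⟩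
theorem gc_p2 {x : M} (hx : E x c) : ∃ z, E z c ∧ ∀ t, E t z ↔ ∃ u v w, E (kp E v (kp E w u)) x ∧ t = kp E u (kp E v w) := by
  obtain ⟨z, h, h'⟩ := gc hc 9 hx hx
  refine ⟨z, h, fun w => ?_⟩
  rw [h']; simp only [GM, isKTriple_iff]
  exact ⟨fun ⟨u, v, w, p, h, e, e'⟩ => ⟨u, v, w, e ▸ h, e'⟩, fun ⟨u, v, w, h, e⟩ => ⟨u, v, w, _, h, rfl, e⟩⟩
end
noncomputable def tup (E : M → M → Prop) [Z : ZFM E] (e : M) : {n : ℕ} → (Fin n → M) → M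
  | 0, _ => e
  | _ + 1, v => kp E (v 0) (tup E e (fun i => v i.succ))
theorem tup_cons {e x : M} {n : ℕ} (v : Fin n → M) : tup E e (Fin.cons x v : Fin (n+1) → M) = kp E x (tup E e v) := by
  simp [tup]
theorem tup_inj {e : M} {n : ℕ} : ∀ {v v' : Fin n → M}, tup E e v = tup E e v' → v = v' := by
  induction n with
  | zero => intro v v' _; exact Subsingleton.elim _ _
  | succ n ih =>
    intro v v' h
    simp only [tup, kp_inj] at h
    funext i
    refine Fin.cases h.1 (fun j => ?_) i
    exact congrFun (ih h.2) j
/-- `d` is the set of coded tuples from `L` satisfying `R` -/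
def Cod (E : M → M → Prop) [Z : ZFM E] (e L : M) {n : ℕ} (R : (Fin n → M) → Prop) (d : M) : Prop :=
  ∀ w, E w d ↔ ∃ v : Fin n → M, (∀ i, E (v i) L) ∧ R v ∧ w = tup E e v
theorem cod_succ {e L : M} {n : ℕ} {R : (Fin (n+1) → M) → Prop} {d : M} : Cod E e L R d ↔
    ∀ w, E w d ↔ ∃ (x : M) (v : Fin n → M), E x L ∧ (∀ i, E (v i) L) ∧ R (Fin.cons x v) ∧ w = kp E x (tup E e v) := by
  unfold Cod
  refine forall_congr' fun w => iff_congr Iff.rfl ?_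
  constructor
  · rintro ⟨v, h1, h2, rfl⟩
    refine ⟨v 0, fun i => v i.succ, h1 0, fun i => h1 _, ?_, rfl⟩
    have := cons_eta v; rw [this]; exact h2
  · rintro ⟨x, v, h1, h2, h3, rfl⟩
    refine ⟨Fin.cons x v, fun i => ?_, h3, (tup_cons v).symm⟩
    exact Fin.cases h1 h2 i
section
variable {c L e : M} (hc : GClosed E c) (hLc : SubsetE E L c) (hL : E L c) (he : E e L)
include hc hLc hL he
theorem cod_all (n : ℕ) : ∃ d, E d c ∧ Cod E e L (n := n) (fun _ => True) d := by
  induction n with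
  | zero =>
    refine ⟨upr E e e, gc_upr hc (hLc e he) (hLc e he), fun w => ?_⟩
    rw [mem_upr (E := E), or_self]
    exact ⟨fun h => ⟨Fin.elim0, fun i => i.elim0, trivial, h⟩, fun ⟨_, _, _, h⟩ => h⟩
  | succ n ih =>
    obtain ⟨d, hd, h⟩ := ih
    refine ⟨prd E L d, gc_prd hc hL hd, cod_succ.2 fun w => ?_⟩
    rw [mem_prd (E := E)]
    constructor
    · rintro ⟨u, v, hu, hv, rfl⟩
      obtain ⟨v', h1, _, rfl⟩ := (h v).1 hv
      exact ⟨u, v', hu, h1, trivial, rfl⟩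
    · rintro ⟨u, v, hu, hv, _, rfl⟩
      exact ⟨u, _, hu, (h _).2 ⟨v, hv, trivial, rfl⟩, rfl⟩
theorem cod_Q {S : M} (hS : E S c) (hSL : ∀ p, E p S → ∃ x y, E x L ∧ E y L ∧ p = kp E x y) {n : ℕ} (k : Fin n) :
    ∃ d, E d c ∧ Cod E e L (n := n+1) (fun v => E (kp E (v 0) (v k.succ)) S) d := by
  induction n with
  | zero => exact k.elim0
  | succ n ih =>
    refine Fin.cases ?_ (fun k => ?_) k
    · obtain ⟨A, hA, hA'⟩ := cod_all hc hLc hL he n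
      obtain ⟨z1, hz1, h1⟩ := gc_conv hc (gc_prd hc hS hA)
      obtain ⟨z2, hz2, h2⟩ := gc_p2 hc hz1
      obtain ⟨z3, hz3, h3⟩ := gc_p2 hc hz2
      refine ⟨z3, hz3, cod_succ.2 fun w => ?_⟩
      have e3 : ∀ x y w, E (kp E x (kp E y w)) z3 ↔ E (kp E x y) S ∧ E w A := by
        intro x y w
        have : E (kp E x (kp E y w)) z3 ↔ E (kp E y (kp E w x)) z2 := by
          rw [h3]; constructor
          · rintro ⟨u, v, w', h, e⟩; simp only [kp_inj] at e; obtain ⟨rfl, rfl, rfl⟩ := e; exact h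
          · intro h; exact ⟨_, _, _, h, rfl⟩
        rw [this]
        have : E (kp E y (kp E w x)) z2 ↔ E (kp E w (kp E x y)) z1 := by
          rw [h2]; constructor
          · rintro ⟨u, v, w', h, e⟩; simp only [kp_inj] at e; obtain ⟨rfl, rfl, rfl⟩ := e; exact h
          · intro h; exact ⟨_, _, _, h, rfl⟩
        rw [this, h1]
        constructor
        · rintro ⟨u, v, h, e⟩; simp only [kp_inj] at e; obtain ⟨rfl, rfl⟩ := e; exact kp_mem_prd.1 h
        · rintro h; exact ⟨_, _, kp_mem_prd.2 h, rfl⟩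
      constructor
      · intro h
        obtain ⟨u, v, w', _, rfl⟩ := (h3 w).1 h
        rw [e3] at h
        obtain ⟨v', h1, _, rfl⟩ := (hA' w').1 h.2
        obtain ⟨x, y, hx, hy, e⟩ := hSL _ h.1
        obtain ⟨rfl, rfl⟩ := kp_inj.1 e
        refine ⟨u, Fin.cons v v', hx, fun i => Fin.cases hy h1 i, ?_, by rw [tup_cons]⟩
        simpa using h.1
      · rintro ⟨x, v, hx, hv, h, rfl⟩
        rw [tup, e3, hA']
        exact ⟨by simpa using h, _, fun i => hv _, trivial, rfl⟩
    · obtain ⟨Q, hQ, hQ'⟩ := ih k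
      obtain ⟨z1, hz1, h1⟩ := gc_p2 hc (gc_prd hc hL hQ)
      obtain ⟨z2, hz2, h2⟩ := gc_p1 hc hz1
      obtain ⟨z3, hz3, h3⟩ := gc_p2 hc hz2
      obtain ⟨z4, hz4, h4⟩ := gc_p2 hc hz3
      refine ⟨z4, hz4, cod_succ.2 fun w => ?_⟩
      have e4 : ∀ x y w, E (kp E x (kp E y w)) z4 ↔ E y L ∧ E (kp E x w) Q := by
        intro x y w
        have : E (kp E x (kp E y w)) z4 ↔ E (kp E y (kp E w x)) z3 := by
          rw [h4]; constructor
          · rintro ⟨u, v, w', h, e⟩; simp only [kp_inj] at e; obtain ⟨rfl, rfl, rfl⟩ := e; exact h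
          · intro h; exact ⟨_, _, _, h, rfl⟩
        rw [this]
        have : E (kp E y (kp E w x)) z3 ↔ E (kp E w (kp E x y)) z2 := by
          rw [h3]; constructor
          · rintro ⟨u, v, w', h, e⟩; simp only [kp_inj] at e; obtain ⟨rfl, rfl, rfl⟩ := e; exact h
          · intro h; exact ⟨_, _, _, h, rfl⟩
        rw [this]
        have : E (kp E w (kp E x y)) z2 ↔ E (kp E w (kp E y x)) z1 := by
          rw [h2]; constructor
          · rintro ⟨u, v, w', h, e⟩; simp only [kp_inj] at e; obtain ⟨rfl, rfl, rfl⟩ := e; exact h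
          · intro h; exact ⟨_, _, _, h, rfl⟩
        rw [this]
        have : E (kp E w (kp E y x)) z1 ↔ E (kp E y (kp E x w)) (prd E L Q) := by
          rw [h1]; constructor
          · rintro ⟨u, v, w', h, e⟩; simp only [kp_inj] at e; obtain ⟨rfl, rfl, rfl⟩ := e; exact h
          · intro h; exact ⟨_, _, _, h, rfl⟩
        rw [this, kp_mem_prd (E := E)]
      rw [cod_succ] at hQ'
      constructor
      · intro h
        obtain ⟨u, v, w', _, rfl⟩ := (h4 w).1 h
        rw [e4] at h
        obtain ⟨x, v', hx, h1, h2, e⟩ := (hQ' _).1 h.2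
        obtain ⟨rfl, rfl⟩ := kp_inj.1 e
        refine ⟨u, Fin.cons v v', hx, fun i => Fin.cases h.1 h1 i, ?_, by rw [tup_cons]⟩
        simpa using h2
      · rintro ⟨x, v, hx, hv, h, rfl⟩
        rw [tup, e4, hQ']
        exact ⟨hv 0, x, fun i => v i.succ, hx, fun i => hv _, by simpa using h, rfl⟩
theorem cod_mem {n : ℕ} (i j : Fin n) : ∃ d, E d c ∧ Cod E e L (fun v => E (v i) (v j)) d := by
  obtain ⟨S, hS, hS'⟩ := gc hc 2 hL hL
  have sS : ∀ x y, E (kp E x y) S ↔ E x L ∧ E y L ∧ E x y := by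
    intro x y; rw [hS']; simp only [GM, isKPair_iff]
    constructor
    · rintro ⟨u, v, h1, h2, h3, e⟩; obtain ⟨rfl, rfl⟩ := kp_inj.1 e; exact ⟨h1, h2, h3⟩
    · rintro ⟨h1, h2, h3⟩; exact ⟨x, y, h1, h2, h3, rfl⟩
  have sL : ∀ p, E p S → ∃ x y, E x L ∧ E y L ∧ p = kp E x y := by
    intro p hp
    obtain ⟨u, v, h1, h2, _, h3⟩ := (hS' p).1 hp
    exact ⟨u, v, h1, h2, isKPair_iff.1 h3⟩
  obtain ⟨T, hT, hT'⟩ := gc_conv hc hS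
  have sT : ∀ x y, E (kp E x y) T ↔ E x L ∧ E y L ∧ E y x := by
    intro x y; rw [hT']
    constructor
    · rintro ⟨u, v, h1, e⟩; obtain ⟨rfl, rfl⟩ := kp_inj.1 e; rw [sS] at h1; tauto
    · rintro ⟨h1, h2, h3⟩; exact ⟨y, x, (sS _ _).2 ⟨h2, h1, h3⟩, rfl⟩
  have sTL : ∀ p, E p T → ∃ x y, E x L ∧ E y L ∧ p = kp E x y := by
    intro p hp
    obtain ⟨u, v, h1, rfl⟩ := (hT' p).1 hp
    rw [sS] at h1
    exact ⟨v, u, h1.2.1, h1.1, rfl⟩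
  induction n with
  | zero => exact i.elim0
  | succ n ih =>
    refine Fin.cases (Fin.cases ?_ (fun j => ?_) j) (fun i => Fin.cases ?_ (fun j => ?_) j) i
    · obtain ⟨z, hz, h⟩ := gc_diff hc hL hL
      refine ⟨z, hz, fun w => ?_⟩
      rw [h]
      exact ⟨fun h => (h.2 h.1).elim, fun ⟨v, _, h, _⟩ => (irr h).elim⟩
    · obtain ⟨d, hd, h⟩ := cod_Q hc hLc hL he hS sL j
      refine ⟨d, hd, fun w => (h w).trans (exists_congr fun v => and_congr_right fun hv => ?_)⟩
      simp only [sS, hv, true_and]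
    · obtain ⟨d, hd, h⟩ := cod_Q hc hLc hL he hT sTL i
      refine ⟨d, hd, fun w => (h w).trans (exists_congr fun v => and_congr_right fun hv => ?_)⟩
      simp only [sT, hv, true_and]
    · obtain ⟨d, hd, h⟩ := ih i j
      refine ⟨prd E L d, gc_prd hc hL hd, cod_succ.2 fun w => ?_⟩
      rw [mem_prd (E := E)]
      constructor
      · rintro ⟨u, v, hu, hv, rfl⟩
        obtain ⟨v', h1, h2, rfl⟩ := (h v).1 hv
        exact ⟨u, v', hu, h1, h2, rfl⟩
      · rintro ⟨u, v, hu, hv, h2, rfl⟩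
        exact ⟨u, _, hu, (h _).2 ⟨v, hv, h2, rfl⟩, rfl⟩
theorem cod_ev {n : ℕ} (f : Fm n) : ∃ d, E d c ∧ Cod E e L (fun v => ev E (fun x => E x L) f v) d := by
  induction f with
  | mem i j => exact cod_mem hc hLc hL he i j
  | @nand n f g ihf ihg =>
    obtain ⟨A, hA, hA'⟩ := ihf
    obtain ⟨B, hB, hB'⟩ := ihg
    obtain ⟨U, hU, hU'⟩ := cod_all hc hLc hL he n
    obtain ⟨I, hI, hI'⟩ := gc_int hc hA hB
    obtain ⟨D, hD, hD'⟩ := gc_diff hc hU hI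
    refine ⟨D, hD, fun w => ?_⟩
    rw [hD', hI', hU', hA', hB']
    constructor
    · rintro ⟨⟨v, hv, _, rfl⟩, h⟩
      exact ⟨v, hv, fun h' => h ⟨⟨v, hv, h'.1, rfl⟩, v, hv, h'.2, rfl⟩, rfl⟩
    · rintro ⟨v, hv, h, rfl⟩
      refine ⟨⟨v, hv, trivial, rfl⟩, ?_⟩
      rintro ⟨⟨u, _, h1, e1⟩, u', _, h2, e2⟩
      rw [← tup_inj e1] at h1; rw [← tup_inj e2] at h2
      exact h ⟨h1, h2⟩
  | ex f ih =>
    obtain ⟨A, hA, hA'⟩ := ih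
    obtain ⟨B, hB, hB'⟩ := gc_conv hc hA
    obtain ⟨D, hD, hD'⟩ := gc_dom hc hB
    refine ⟨D, hD, fun w => ?_⟩
    rw [cod_succ] at hA'
    rw [hD']
    constructor
    · rintro ⟨u, h⟩
      obtain ⟨a, b, h, e⟩ := (hB' _).1 h
      obtain ⟨rfl, rfl⟩ := kp_inj.1 e
      obtain ⟨x, v, hx, hv, h', e'⟩ := (hA' _).1 h
      obtain ⟨rfl, rfl⟩ := kp_inj.1 e'
      exact ⟨v, hv, ⟨u, hx, h'⟩, rfl⟩
    · rintro ⟨v, hv, ⟨x, hx, h⟩, rfl⟩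
      exact ⟨x, (hB' _).2 ⟨x, _, (hA' _).2 ⟨x, v, hx, hv, h, rfl⟩, rfl⟩⟩
theorem tup_mem {n : ℕ} (v : Fin n → M) (hv : ∀ i, E (v i) L) : E (tup E e v) c := by
  induction n with
  | zero => exact hLc e he
  | succ n ih => exact gc_kp hc (hLc _ (hv 0)) (ih _ fun i => hv _)
end
theorem def_sep {L d : M} (hT : TransSet E L) (hd : IsDefSetOf E L d) {n : ℕ} (f : Fm (n + 1)) (p : Fin n → M)
    (hp : ∀ i, E (p i) L) : ∃ s, E s d ∧ ∀ z, E z s ↔ E z L ∧ ev E (fun x => E x L) f (Fin.cons z p) := by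
  by_cases hne : ∃ e, E e L
  · obtain ⟨e, he⟩ := hne
    obtain ⟨c, hc, hd⟩ := defset_iff.1 hd
    have hL : E L c := hc.1 L (mem_sc.2 (Or.inr rfl))
    have hLc : SubsetE E L c := fun x hx => hc.1 x (mem_sc.2 (Or.inl hx))
    obtain ⟨A, hA, hA'⟩ := cod_ev hc.2.1 hLc hL he f
    have ht := tup_mem hc.2.1 hLc hL he p hp
    obtain ⟨I, hI, hI'⟩ := gc_int hc.2.1 hA (gc_prd hc.2.1 hL (gc_upr hc.2.1 ht ht))
    obtain ⟨s, hs, hs'⟩ := gc_dom hc.2.1 hI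
    have key : ∀ z, E z s ↔ E z L ∧ ev E (fun x => E x L) f (Fin.cons z p) := by
      intro z
      rw [hs']
      rw [cod_succ] at hA'
      constructor
      · rintro ⟨u, hu⟩
        obtain ⟨h1, h2⟩ := (hI' _).1 hu
        obtain ⟨h3, h4⟩ := kp_mem_prd.1 h2
        rw [mem_upr (E := E), or_self] at h4; subst h4
        obtain ⟨x, v, hx, hv, h, e'⟩ := (hA' _).1 h1
        obtain ⟨e1, e2⟩ := kp_inj.1 e'
        subst e1
        rw [← tup_inj e2] at h
        exact ⟨h3, h⟩
      · rintro ⟨hz, h⟩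
        exact ⟨tup E e p, (hI' _).2 ⟨(hA' _).2 ⟨z, p, hz, hp, h, rfl⟩, kp_mem_prd.2 ⟨hz, mem_upr.2 (Or.inl rfl)⟩⟩⟩
    exact ⟨s, (hd s).2 ⟨fun z hz => ((key z).1 hz).1, hs⟩, key⟩
  · refine ⟨L, (def_trans hT hd).2.2, fun z => ⟨fun h => (hne ⟨z, h⟩).elim, fun h => h.1⟩⟩
end

set_option autoImplicit false
set_option maxHeartbeats 1000000
set_option linter.unusedSectionVars false
section
variable {M : Type} {E : M → M → Prop} [Z : ZFM E]
def Prj (E : M → M → Prop) : ℕ → M → M → Prop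
  | 0, w, x => ∃ y, IsKPair E w x y
  | k + 1, w, x => ∃ u y, IsKPair E w u y ∧ Prj E k y x
instance Prj.dfn {n : ℕ} {t s : (Fin n → M) → M} [DFn E t] [DFn E s] (k : ℕ) : Dfn E (fun v => Prj E k (t v) (s v)) := by
  refine Dfn.sub2 ?_ t s
  induction k with
  | zero => unfold Prj; infer_instance
  | succ k ih =>
    have : Df2 E (Prj E k) := ⟨ih⟩
    unfold Prj; infer_instance
def Tp (E : M → M → Prop) : ℕ → M → M → Prop
  | 0, _, w => ∀ z, ¬ E z w
  | k + 1, l, w => ∃ x y, IsKPair E w x y ∧ E x l ∧ Tp E k l y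
instance Tp.dfn {n : ℕ} {t s : (Fin n → M) → M} [DFn E t] [DFn E s] (k : ℕ) : Dfn E (fun v => Tp E k (t v) (s v)) := by
  refine Dfn.sub2 ?_ t s
  induction k with
  | zero => unfold Tp; infer_instance
  | succ k ih =>
    have : Df2 E (Tp E k) := ⟨ih⟩
    unfold Tp; infer_instance
def evc (E : M → M → Prop) (C : M → Prop) : {n : ℕ} → Fm n → M → Prop
  | _, Fm.mem i j, w => ∃ x y, Prj E i w x ∧ Prj E j w y ∧ E x y
  | _, Fm.nand f g, w => ¬ (evc E C f w ∧ evc E C g w)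
  | _, Fm.ex f, w => ∃ x u, C x ∧ IsKPair E u x w ∧ evc E C f u
instance evc.dfn {n m : ℕ} {t : (Fin n → M) → M} [DFn E t] {C : M → Prop} [hC : Df1 E C] (f : Fm m) :
    Dfn E (fun v => evc E C f (t v)) := by
  refine Dfn.sub1 ?_ t
  induction f with
  | mem i j => unfold evc; infer_instance
  | nand f g ih1 ih2 =>
    have : Df1 E (evc E C f) := ⟨ih1⟩
    have : Df1 E (evc E C g) := ⟨ih2⟩
    unfold evc; infer_instance
  | ex f ih =>
    have : Df1 E (evc E C f) := ⟨ih⟩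
    unfold evc; infer_instance
theorem prj_tup {e : M} {n : ℕ} (i : Fin n) : ∀ (v : Fin n → M) {x : M}, Prj E i (tup E e v) x ↔ x = v i := by
  induction n with
  | zero => exact i.elim0
  | succ n ih =>
    intro v x
    refine Fin.cases ?_ (fun j => ?_) i
    · simp only [Fin.val_zero, Prj, tup, isKPair_iff, kp_inj]
      constructor
      · rintro ⟨y, h, _⟩; exact h.symm
      · rintro rfl; exact ⟨_, rfl, rfl⟩
    · simp only [Fin.val_succ, Prj, tup, isKPair_iff, kp_inj]
      constructor
      · rintro ⟨u, y, ⟨_, h⟩, h'⟩; rw [← h] at h'; exact (ih j _).1 h'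
      · intro h; exact ⟨_, _, ⟨rfl, rfl⟩, (ih j _).2 h⟩
theorem evc_tup {C : M → Prop} {e : M} {n : ℕ} (f : Fm n) : ∀ v : Fin n → M, evc E C f (tup E e v) ↔ ev E C f v := by
  induction f with
  | mem i j =>
    intro v; simp only [evc, ev, prj_tup]
    exact ⟨by rintro ⟨x, y, rfl, rfl, h⟩; exact h, fun h => ⟨_, _, rfl, rfl, h⟩⟩
  | nand f g ih1 ih2 => intro v; simp only [evc, ev, ih1, ih2]
  | ex f ih =>
    intro v; simp only [evc, ev, isKPair_iff]
    constructor
    · rintro ⟨x, u, hx, rfl, h⟩; rw [← tup_cons, ih] at h; exact ⟨x, hx, h⟩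
    · rintro ⟨x, hx, h⟩; rw [← ih, tup_cons] at h; exact ⟨x, _, hx, rfl, h⟩
theorem tp_iff {l : M} {n : ℕ} : ∀ {w : M}, Tp E n l w ↔ ∃ v : Fin n → M, (∀ i, E (v i) l) ∧ w = tup E (emp E) v := by
  induction n with
  | zero =>
    intro w; simp only [Tp, tup]
    constructor
    · exact fun h => ⟨Fin.elim0, fun i => i.elim0, ext fun z => ⟨fun h' => (h z h').elim, fun h' => (mem_emp h').elim⟩⟩
    · rintro ⟨_, _, rfl⟩ z; exact mem_emp
  | succ n ih =>
    intro w; simp only [Tp, isKPair_iff, ih]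
    constructor
    · rintro ⟨x, _, rfl, hx, v, hv, rfl⟩
      exact ⟨Fin.cons x v, fun i => Fin.cases hx hv i, (tup_cons v).symm⟩
    · rintro ⟨v, hv, rfl⟩
      exact ⟨v 0, _, rfl, hv 0, _, fun i => hv i.succ, rfl⟩
theorem tp_set (n : ℕ) (l : M) : ∃ d, ∀ w, Tp E n l w → E w d := by
  induction n with
  | zero => exact ⟨sing E (emp E), fun w h => mem_sing.2 (ext fun z => ⟨fun h' => (h z h').elim, fun h' => (mem_emp h').elim⟩)⟩
  | succ n ih =>
    obtain ⟨d, hd⟩ := ih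
    refine ⟨prd E l d, ?_⟩
    rintro w ⟨x, y, h, hx, hy⟩
    exact mem_prd.2 ⟨x, y, hx, hd y hy, isKPair_iff.1 h⟩
/-- collection of ordinals -/
theorem coll (a : M) (R : M → M → Prop) [hR : Df2 E R] (h : ∀ x, E x a → ∃ β, IsOrd E β ∧ R x β) :
    ∃ B, IsOrd E B ∧ ∀ x, E x a → ∃ β, E β B ∧ R x β := by
  obtain ⟨s, hs⟩ := replP (E := E) a (fun x β => IsOrd E β ∧ R x β ∧ ∀ γ, E γ β → ¬ R x γ) (by
    rintro x y y' _ ⟨h1, h2, h3⟩ ⟨h1', h2', h3'⟩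
    rcases ord_lin h1 h1' with h | h | h
    · exact (h3' _ h h2).elim
    · exact h
    · exact (h3 _ h h2').elim)
  have ho : ∀ y, E y s → IsOrd E y := fun y hy => by obtain ⟨x, _, h, _⟩ := (hs y).1 hy; exact h
  refine ⟨sc E (Un E s), ord_sc (ord_Un ho), fun x hx => ?_⟩
  obtain ⟨β, h1, h2, h3⟩ := ord_least (E := E) (fun β => R x β) (h x hx)
  have hβ : E β s := (hs β).2 ⟨x, hx, h1, h2, h3⟩
  refine ⟨β, ?_, h2⟩
  rw [mem_sc (E := E)]
  exact ((ord_le_sub h1 (ord_Un ho) (fun z hz => mem_Un.2 ⟨β, hβ, hz⟩))).symm.imp id id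

def WL (E : M → M → Prop) (z0 : M) (x : M) : Prop := ∃ a l, LR E z0 a l ∧ E x l
instance WL.dfn {n : ℕ} {t : (Fin n → M) → M} [DFn E t] {z0 : M} : Dfn E (fun v => WL E z0 (t v)) :=
  Dfn.sub1 (by unfold WL; infer_instance) t
def Clo (E : M → M → Prop) (z0 : M) : {n : ℕ} → Fm n → M → M → Prop
  | _, Fm.mem _ _, _, b => b = b
  | _, Fm.nand f g, a, b => Clo E z0 f a b ∧ Clo E z0 g a b
  | n, Fm.ex f, a, b => Clo E z0 f a b ∧ ∀ l k, LR E z0 a l → LR E z0 b k → ∀ w, Tp E n l w →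
      (∃ x u, WL E z0 x ∧ IsKPair E u x w ∧ evc E (WL E z0) f u) →
        ∃ x u, E x k ∧ IsKPair E u x w ∧ evc E (WL E z0) f u
instance Clo.dfn {n m : ℕ} {t s : (Fin n → M) → M} [DFn E t] [DFn E s] {z0 : M} (f : Fm m) :
    Dfn E (fun v => Clo E z0 f (t v) (s v)) := by
  refine Dfn.sub2 ?_ t s
  induction f with
  | mem i j => unfold Clo; infer_instance
  | nand f g ih1 ih2 =>
    have : Df2 E (Clo E z0 f) := ⟨ih1⟩
    have : Df2 E (Clo E z0 g) := ⟨ih2⟩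
    unfold Clo; infer_instance
  | ex f ih =>
    have : Df2 E (Clo E z0 f) := ⟨ih⟩
    unfold Clo; infer_instance
section
variable {z0 : M} (hz : TransSet E z0)
theorem LR_ex {a : M} (ha : IsOrd E a) : ∃ l, LR E z0 a l := tri_total def_tot ha
theorem LR_uq {a l k : M} (h : LR E z0 a l) (h' : LR E z0 a k) : l = k := tri_uniq def_tot h h'
include hz
theorem LR_mono {a b l k : M} (hab : E a b ∨ a = b) (hl : LR E z0 a l) (hk : LR E z0 b k) : SubsetE E l k := by
  rcases hab with h | rfl
  · exact ((LR_main hz b hk.1 k hk).2.2 a l h hl).1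
  · rw [LR_uq hl hk]; exact fun _ h => h
theorem clo_mono {n : ℕ} (f : Fm n) : ∀ {a a' b b' : M}, IsOrd E a → IsOrd E a' → IsOrd E b → IsOrd E b' →
    (E a' a ∨ a' = a) → (E b b' ∨ b = b') → Clo E z0 f a b → Clo E z0 f a' b' := by
  induction f with
  | mem i j => intros; rfl
  | nand f g ih1 ih2 =>
    intro a a' b b' ha ha' hb hb' h1 h2 h
    exact ⟨ih1 ha ha' hb hb' h1 h2 h.1, ih2 ha ha' hb hb' h1 h2 h.2⟩
  | ex f ih =>
    intro a a' b b' ha ha' hb hb' h1 h2 h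
    refine ⟨ih ha ha' hb hb' h1 h2 h.1, fun l' k' hl' hk' w hw hx => ?_⟩
    obtain ⟨l, hl⟩ := LR_ex (z0 := z0) ha
    obtain ⟨k, hk⟩ := LR_ex (z0 := z0) hb
    obtain ⟨v, hv, rfl⟩ := tp_iff.1 hw
    obtain ⟨x, u, h3, h4⟩ := h.2 l k hl hk _ (tp_iff.2 ⟨v, fun i => LR_mono hz h1 hl' hl _ (hv i), rfl⟩) hx
    exact ⟨x, u, LR_mono hz h2 hk hk' _ h3, h4⟩
theorem ord_max {a b : M} (ha : IsOrd E a) (hb : IsOrd E b) : ∃ c, IsOrd E c ∧ (E a c ∨ a = c) ∧ (E b c ∨ b = c) ∧ (c = a ∨ c = b) := by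
  rcases ord_lin ha hb with h | rfl | h
  · exact ⟨b, hb, Or.inl h, Or.inr rfl, Or.inr rfl⟩
  · exact ⟨a, hb, Or.inr rfl, Or.inr rfl, Or.inl rfl⟩
  · exact ⟨a, ha, Or.inr rfl, Or.inl h, Or.inl rfl⟩
theorem clo_ex {n : ℕ} (f : Fm n) : ∀ a, IsOrd E a → ∃ b, IsOrd E b ∧ Clo E z0 f a b := by
  induction f with
  | mem i j => intro a ha; exact ⟨a, ha, rfl⟩
  | nand f g ih1 ih2 =>
    intro a ha
    obtain ⟨b, hb, h1⟩ := ih1 a ha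
    obtain ⟨b', hb', h2⟩ := ih2 a ha
    obtain ⟨c, hc, h3, h4, _⟩ := ord_max hz hb hb'
    exact ⟨c, hc, clo_mono hz f ha ha hb hc (Or.inr rfl) h3 h1, clo_mono hz g ha ha hb' hc (Or.inr rfl) h4 h2⟩
  | @ex n f ih =>
    intro a ha
    obtain ⟨b, hb, h1⟩ := ih a ha
    obtain ⟨l, hl⟩ := LR_ex (z0 := z0) ha
    obtain ⟨d, hd⟩ := tp_set (E := E) n l
    obtain ⟨B, hB, h2⟩ := coll (E := E) (sepS E d (fun w => ∃ x u, WL E z0 x ∧ IsKPair E u x w ∧ evc E (WL E z0) f u))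
      (fun w β => ∃ k x u, LR E z0 β k ∧ E x k ∧ IsKPair E u x w ∧ evc E (WL E z0) f u) (by
        intro w hw
        obtain ⟨_, x, u, ⟨β, k, hk, hx⟩, h⟩ := mem_sepS.1 hw
        exact ⟨β, hk.1, k, x, u, hk, hx, h⟩)
    obtain ⟨c, hc, h3, h4, _⟩ := ord_max hz hb hB
    refine ⟨c, hc, clo_mono hz f ha ha hb hc (Or.inr rfl) h3 h1, fun l' k' hl' hk' w hw hx => ?_⟩
    rw [LR_uq hl' hl] at hw
    obtain ⟨β, hβ, k, x, u, hk, hxk, h⟩ := h2 w (mem_sepS.2 ⟨hd w hw, hx⟩)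
    refine ⟨x, u, LR_mono hz (Or.inl ?_) hk hk' _ hxk, h⟩
    rcases h4 with h4 | rfl
    · exact hc.1 _ h4 _ hβ
    · exact hβ
def Fst (E : M → M → Prop) (z0 : M) {n : ℕ} (f : Fm n) (y ρ : M) : Prop := IsOrd E ρ ∧ ∀ γ, E γ y → IsOrd E γ → E γ ρ ∧ Clo E z0 f γ ρ
omit hz in
instance Fst.dfn {n m : ℕ} {t s : (Fin n → M) → M} [DFn E t] [DFn E s] {z0 : M} (f : Fm m) :
    Dfn E (fun v => Fst E z0 f (t v) (s v)) := Dfn.sub2 (by unfold Fst; infer_instance) t s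
def Fs (E : M → M → Prop) [Z : ZFM E] (z0 : M) {n : ℕ} (f : Fm n) (y z : M) : Prop :=
  ∃ ρ, Fst E z0 f y ρ ∧ (∀ ρ', E ρ' ρ → ¬ Fst E z0 f y ρ') ∧ z = bun E y (sing E ρ)
omit hz in
instance Fs.dfn {n m : ℕ} {t s : (Fin n → M) → M} [DFn E t] [DFn E s] {z0 : M} (f : Fm m) :
    Dfn E (fun v => Fs E z0 f (t v) (s v)) := Dfn.sub2 (by unfold Fs; infer_instance) t s
theorem fs_tot {n : ℕ} (f : Fm n) (y : M) : ∃! z, Fs E z0 f y z := by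
  have h1 : ∃ ρ, IsOrd E ρ ∧ Fst E z0 f y ρ := by
    obtain ⟨B, hB, h⟩ := coll (E := E) (sepS E y (IsOrd E)) (fun γ β => IsOrd E β ∧ E γ β ∧ Clo E z0 f γ β) (by
      intro γ hγ
      have hγ := (mem_sepS.1 hγ).2
      obtain ⟨b, hb, h⟩ := clo_ex hz f γ hγ
      obtain ⟨c, hc, h3, h4, _⟩ := ord_max hz hb (ord_sc hγ)
      refine ⟨c, hc, hc, ?_, clo_mono hz f hγ hγ hb hc (Or.inr rfl) h3 h⟩
      rcases h4 with h4 | rfl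
      · exact hc.1 _ h4 _ (mem_sc.2 (Or.inr rfl))
      · exact mem_sc.2 (Or.inr rfl))
    refine ⟨B, hB, hB, fun γ h1 h2 => ?_⟩
    obtain ⟨β, h3, h4, h5, h6⟩ := h γ (mem_sepS.2 ⟨h1, h2⟩)
    exact ⟨hB.1 _ h3 _ h5, clo_mono hz f h2 h2 h4 hB (Or.inr rfl) (Or.inl h3) h6⟩
  obtain ⟨ρ, h2, h3, h4⟩ := ord_least (E := E) (fun ρ => Fst E z0 f y ρ) h1
  refine ⟨_, ⟨ρ, h3, h4, rfl⟩, ?_⟩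
  rintro z ⟨ρ', h3', h4', rfl⟩
  rcases ord_lin h3'.1 h2 with h | rfl | h
  · exact (h4 _ h h3').elim
  · rfl
  · exact (h4' _ h h3).elim
/-- closure ordinals -/
theorem clo_lim {n : ℕ} (f : Fm n) {a : M} (ha : IsOrd E a) : ∃ b, IsLimitOrd E b ∧ E a b ∧
    ∀ γ, E γ b → ∃ ρ, E ρ b ∧ Clo E z0 f γ ρ := by
  obtain ⟨c, hc⟩ := itw_ex (E := E) (fs_tot hz f) (sing E a)
  have hac : E a c := itw_base hc _ (mem_sing.2 rfl)
  have step : ∀ γ, E γ c → IsOrd E γ → ∃ ρ, E ρ c ∧ IsOrd E ρ ∧ E γ ρ ∧ Clo E z0 f γ ρ := by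
    intro γ h1 h2
    obtain ⟨y, z, ⟨ρ, h3, _, rfl⟩, h5, _, h6⟩ := itw_step (fun y z ⟨ρ, _, _, h⟩ => by rw [h]; exact fun x hx => mem_bun.2 (Or.inl hx)) hc h1 h1
    exact ⟨ρ, h6 _ (mem_bun.2 (Or.inr (mem_sing.2 rfl))), h3.1, h3.2 γ h5 h2⟩
  have hm : ∀ γ, E γ (Un E (sepS E c (IsOrd E))) ↔ ∃ u, E u c ∧ IsOrd E u ∧ E γ u := fun γ => by
    simp only [mem_Un, mem_sepS, and_assoc]
  have ho : IsOrd E (Un E (sepS E c (IsOrd E))) := ord_Un (fun y hy => (mem_sepS.1 hy).2)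
  have hin : ∀ u, E u c → IsOrd E u → E u (Un E (sepS E c (IsOrd E))) := fun u h1 h2 => by
    obtain ⟨ρ, h3, h4, h5, _⟩ := step u h1 h2
    exact (hm u).2 ⟨ρ, h3, h4, h5⟩
  refine ⟨_, isLimitOrd_iff.2 ⟨ho, ⟨a, hin a hac ha⟩, fun y hy => ?_⟩, hin a hac ha, fun γ hγ => ?_⟩
  · obtain ⟨u, h1, h2, h3⟩ := (hm y).1 hy
    rcases ord_le_sub (ord_sc (ord_mem h2 h3)) h2 (fun z hz => by
      rcases mem_sc.1 hz with h | rfl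
      · exact h2.1 _ h3 _ h
      · exact h3) with h | h
    · rw [h]; exact hin u h1 h2
    · exact (hm _).2 ⟨u, h1, h2, h⟩
  · obtain ⟨u, h1, h2, h3⟩ := (hm γ).1 hγ
    obtain ⟨ρ, h4, h5, h6, h7⟩ := step u h1 h2
    exact ⟨ρ, hin ρ h4 h5, clo_mono hz f h2 (ord_mem h2 h3) h5 h5 (Or.inl h3) (Or.inr rfl) h7⟩
theorem lim_mem {b l : M} (hb : IsLimitOrd E b) (hl : LR E z0 b l) {x : M} : E x l ↔ ∃ a k, E a b ∧ LR E z0 a k ∧ E x k := by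
  have h := tri_lim def_tot hb hl x
  rw [h]
theorem bnd {b l : M} (hb : IsLimitOrd E b) (hl : LR E z0 b l) : ∀ {n : ℕ} (v : Fin n → M), (∀ i, E (v i) l) →
    ∃ a k, E a b ∧ LR E z0 a k ∧ ∀ i, E (v i) k := by
  intro n
  induction n with
  | zero =>
    intro v _
    obtain ⟨k, hk⟩ := LR_ex (z0 := z0) (ord_emp (E := E))
    exact ⟨_, k, lim_emp_mem hb, hk, fun i => i.elim0⟩
  | succ n ih =>
    intro v hv
    obtain ⟨a, k, h1, h2, h3⟩ := ih (fun i => v i.succ) (fun i => hv _)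
    obtain ⟨a', k', h1', h2', h3'⟩ := (lim_mem hz hb hl).1 (hv 0)
    obtain ⟨c, hc, h4, h5, h6⟩ := ord_max hz h2.1 h2'.1
    obtain ⟨m, hm⟩ := LR_ex (z0 := z0) hc
    refine ⟨c, m, ?_, hm, fun i => Fin.cases (LR_mono hz h5 h2' hm _ h3') (fun i => LR_mono hz h4 h2 hm _ (h3 i)) i⟩
    rcases h6 with rfl | rfl <;> assumption
theorem reflect {b l : M} (hb : IsLimitOrd E b) (hl : LR E z0 b l) {n : ℕ} (f : Fm n)
    (hc : ∀ γ, E γ b → ∃ ρ, E ρ b ∧ Clo E z0 f γ ρ) : ∀ v : Fin n → M, (∀ i, E (v i) l) →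
    (ev E (WL E z0) f v ↔ ev E (fun x => E x l) f v) := by
  induction f with
  | mem i j => intro v _; exact Iff.rfl
  | nand f g ih1 ih2 =>
    intro v hv
    simp only [ev]
    rw [ih1 (fun γ h => by obtain ⟨ρ, h1, h2⟩ := hc γ h; exact ⟨ρ, h1, h2.1⟩) v hv,
      ih2 (fun γ h => by obtain ⟨ρ, h1, h2⟩ := hc γ h; exact ⟨ρ, h1, h2.2⟩) v hv]
  | ex f ih =>
    intro v hv
    have ih := ih (fun γ h => by obtain ⟨ρ, h1, h2⟩ := hc γ h; exact ⟨ρ, h1, h2.1⟩)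
    have ih' : ∀ x, E x l → _ := fun x hx => ih (Fin.cons x v) (fun i => Fin.cases hx hv i)
    simp only [ev]
    constructor
    · rintro ⟨x, hx, h⟩
      obtain ⟨a, k, h1, h2, h3⟩ := bnd hz hb hl v hv
      obtain ⟨ρ, h4, h5⟩ := hc a h1
      obtain ⟨m, hm⟩ := LR_ex (z0 := z0) (ord_mem hb.1 h4)
      obtain ⟨x', u, h6, h7, h8⟩ := h5.2 k m h2 hm _ (tp_iff.2 ⟨v, h3, rfl⟩) ⟨x, _, hx, isKPair_iff.2 rfl, by rw [← tup_cons, evc_tup]; exact h⟩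
      rw [isKPair_iff.1 h7, ← tup_cons, evc_tup] at h8
      have := LR_mono hz (Or.inl h4) hm hl _ h6
      exact ⟨x', this, (ih' x' this).1 h8⟩
    · rintro ⟨x, hx, h⟩
      exact ⟨x, ⟨b, l, hl, hx⟩, (ih' x hx).2 h⟩
theorem WL_bnd {n : ℕ} (v : Fin n → M) (h : ∀ i, WL E z0 (v i)) : ∃ a k, LR E z0 a k ∧ ∀ i, E (v i) k := by
  induction n with
  | zero =>
    obtain ⟨k, hk⟩ := LR_ex (z0 := z0) (ord_emp (E := E))
    exact ⟨_, k, hk, fun i => i.elim0⟩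
  | succ n ih =>
    obtain ⟨a, k, h2, h3⟩ := ih (fun i => v i.succ) (fun i => h _)
    obtain ⟨a', k', h2', h3'⟩ := h 0
    obtain ⟨c, hc, h4, h5, h6⟩ := ord_max hz h2.1 h2'.1
    obtain ⟨m, hm⟩ := LR_ex (z0 := z0) hc
    exact ⟨c, m, hm, fun i => Fin.cases (LR_mono hz h5 h2' hm _ h3') (fun i => LR_mono hz h4 h2 hm _ (h3 i)) i⟩
theorem WL_trans {x y : M} (h : WL E z0 x) (hy : E y x) : WL E z0 y := by
  obtain ⟨a, l, hl, hx⟩ := h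
  exact ⟨a, l, hl, (LR_main hz a hl.1 l hl).1 _ hx _ hy⟩
theorem WL_sep {n : ℕ} (f : Fm (n + 1)) (a : M) (p : Fin n → M) (ha : WL E z0 a) (hp : ∀ i, WL E z0 (p i)) :
    ∃ s, WL E z0 s ∧ ∀ z, E z s ↔ E z a ∧ ev E (WL E z0) f (Fin.cons z p) := by
  obtain ⟨c, k, hk, hv⟩ := WL_bnd hz (Fin.cons a p : Fin (n+1) → M) (fun i => Fin.cases ha hp i)
  obtain ⟨b, hb, hcb, hcl⟩ := clo_lim hz f hk.1
  obtain ⟨l, hl⟩ := LR_ex (z0 := z0) hb.1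
  have hs := LR_mono hz (Or.inl hcb) hk hl
  have hal : E a l := hs _ (hv 0)
  have hpl : ∀ i, E (p i) l := fun i => hs _ (hv i.succ)
  have hT := (LR_main hz b hl.1 l hl).1
  obtain ⟨d, hd⟩ := LR_ex (z0 := z0) (ord_sc hl.1)
  have hD := tri_sc def_tot hl hd
  obtain ⟨s, h1, h2⟩ := def_sep hT hD f p hpl
  obtain ⟨g, hg, hg'⟩ := defset_iff.1 hD
  obtain ⟨s', h3, h4⟩ := gc_int hg.2.1 (hg.1 a (mem_sc.2 (Or.inl hal))) ((hg' s).1 h1).2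
  refine ⟨s', ⟨_, d, hd, (hg' s').2 ⟨fun z hz => hT _ hal _ ((h4 z).1 hz).1, h3⟩⟩, fun z => ?_⟩
  rw [h4, h2]
  constructor
  · rintro ⟨h5, h6, h7⟩
    exact ⟨h5, (reflect hz hb hl f hcl _ (fun i => Fin.cases h6 hpl i)).2 h7⟩
  · rintro ⟨h5, h7⟩
    have h6 := hT _ hal _ h5
    exact ⟨h5, h6, (reflect hz hb hl f hcl _ (fun i => Fin.cases h6 hpl i)).1 h7⟩
end
end

set_option autoImplicit false
set_option maxHeartbeats 1000000
set_option linter.unusedSectionVars false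
section
variable {M : Type} {E : M → M → Prop} [Z : ZFM E]
abbrev Nn (E : M → M → Prop) (z0 : M) : Type := {x : M // WL E z0 x}
def EN (E : M → M → Prop) (z0 : M) (x y : Nn E z0) : Prop := E x.1 y.1
theorem exD {M : Type} {E : M → M → Prop} (a : M) (G : M → M → Prop) [Df2 E G] :
    Dfn E (fun w : Fin 1 → M => ∃ x, E x a ∧ G x (w 0)) := inferInstance
section
variable {z0 : M} (hz : TransSet E z0)
theorem val_cons {n : ℕ} {C : M → Prop} (x : {x : M // C x}) (v : Fin n → {x : M // C x}) :
    (fun i => ((Fin.cons x v : Fin (n+1) → {x : M // C x}) i).1) = Fin.cons x.1 (fun i => (v i).1) := by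
  funext i; exact Fin.cases rfl (fun _ => rfl) i
include hz
theorem evalN {n : ℕ} (f : Fml n) (v : Fin n → Nn E z0) :
    Eval (EN E z0) NoAux AllSets f v ↔ ev E (WL E z0) (tr f) (fun i => (v i).1) := by
  rw [ev_tr Z.sat.ext (fun x y => WL_trans hz) f _ (fun i => (v i).2)]
  induction f with
  | mem i j => rfl
  | equ i j => exact Subtype.ext_iff
  | aux i => rfl
  | impl f g ih1 ih2 => simp only [Eval, ih1, ih2]
  | neg f ih => simp only [Eval, ih]
  | all f ih => simp only [Eval, ih, val_cons, AllSets, true_implies, Subtype.forall]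
  | ex f ih => simp only [Eval, ih, val_cons, AllSets, true_and, Subtype.exists, exists_prop]
  | allb i f ih => simp only [Eval, ih, val_cons, AllSets, true_implies, Subtype.forall]; rfl
theorem sepFN {n : ℕ} (f : Fml (n + 1)) (v : Fin n → Nn E z0) (a : Nn E z0) :
    ∃ b, ∀ z, EN E z0 z b ↔ (EN E z0 z a ∧ Eval (EN E z0) NoAux AllSets f (Fin.cons z v)) := by
  obtain ⟨s, h1, h2⟩ := WL_sep hz (tr f) a.1 (fun i => (v i).1) a.2 (fun i => (v i).2)
  refine ⟨⟨s, h1⟩, fun z => ?_⟩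
  rw [evalN hz, val_cons]; exact h2 z.1
theorem sepN (a : Nn E z0) (R : Nn E z0 → Prop) [hR : Dfn (EN E z0) (fun v : Fin 1 → Nn E z0 => R (v 0))] :
    ∃ b, ∀ z, EN E z0 z b ↔ (EN E z0 z a ∧ R z) := by
  obtain ⟨k, f, ρ, hf⟩ := hR.prep a
  obtain ⟨b, hb⟩ := sepFN hz f (fun i => Sum.elim Fin.elim0 id (ρ i)) a
  exact ⟨b, fun z => by rw [hb, ← hf]; simp⟩
theorem au (s : M) (h : ∀ z, E z s → WL E z0 z) : ∃ n : Nn E z0, ∀ z, E z s → E z n.1 := by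
  obtain ⟨B, hB, h1⟩ := coll (E := E) s (fun z β => ∃ l, LR E z0 β l ∧ E z l) (by
    intro z hz
    obtain ⟨a, l, hl, hx⟩ := h z hz
    exact ⟨a, hl.1, l, hl, hx⟩)
  obtain ⟨l, hl⟩ := LR_ex (z0 := z0) hB
  obtain ⟨k, hk⟩ := LR_ex (z0 := z0) (ord_sc hB)
  refine ⟨⟨l, _, k, hk, ((LR_main hz _ hk.1 k hk).2.2 B l (mem_sc.2 (Or.inr rfl)) hl).2⟩, fun z hzs => ?_⟩
  obtain ⟨β, hβ, m, hm, hzm⟩ := h1 z hzs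
  exact LR_mono hz (Or.inl hβ) hm hl _ hzm
theorem allN {P : M → Prop} {x : Nn E z0} : (∀ z : Nn E z0, E z.1 x.1 → P z.1) ↔ ∀ z, E z x.1 → P z :=
  ⟨fun h z hzx => h ⟨z, WL_trans hz x.2 hzx⟩ hzx, fun h z hzx => h z.1 hzx⟩
theorem exN {P : M → Prop} {x : Nn E z0} : (∃ z : Nn E z0, E z.1 x.1 ∧ P z.1) ↔ ∃ z, E z x.1 ∧ P z :=
  ⟨fun ⟨z, h⟩ => ⟨z.1, h⟩, fun ⟨z, h, h'⟩ => ⟨⟨z, WL_trans hz x.2 h⟩, h, h'⟩⟩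
theorem subN {x y : Nn E z0} : SubsetE (EN E z0) x y ↔ SubsetE E x.1 y.1 := allN hz (P := fun z => E z y.1)
theorem transN {x : Nn E z0} : TransSet (EN E z0) x ↔ TransSet E x.1 := by
  unfold TransSet; simp only [subN hz]; exact allN hz (P := fun y => SubsetE E y x.1)
theorem ordN {x : Nn E z0} : IsOrd (EN E z0) x ↔ IsOrd E x.1 := by
  unfold IsOrd; rw [transN hz]
  refine and_congr Iff.rfl ⟨fun h y z hy hzx => ?_, fun h y z hy hzx => ?_⟩
  · have := h ⟨y, WL_trans hz x.2 hy⟩ ⟨z, WL_trans hz x.2 hzx⟩ hy hzx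
    simpa only [Subtype.mk.injEq, EN] using this
  · have := h y.1 z.1 hy hzx
    simpa only [EN, Subtype.ext_iff] using this
theorem ord_WL : ∀ a, IsOrd E a → WL E z0 a := by
  refine ord_ind (E := E) (WL E z0) ?_
  intro a ha ih
  obtain ⟨n, hn⟩ := au hz a ih
  obtain ⟨s, hs⟩ := sepN hz n (IsOrd (EN E z0))
  have hs' : ∀ z, E z s.1 ↔ E z n.1 ∧ IsOrd E z := fun z => by
    constructor
    · intro h
      have := (hs ⟨z, WL_trans hz s.2 h⟩).1 h
      exact ⟨this.1, (ordN hz).1 this.2⟩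
    · rintro ⟨h1, h2⟩
      exact (hs ⟨z, WL_trans hz n.2 h1⟩).2 ⟨h1, (ordN hz).2 h2⟩
  by_contra hc
  have hns : ∀ y, E y s.1 → E y a := fun y hy => by
    rcases ord_lin ((hs' y).1 hy).2 ha with h | rfl | h
    · exact h
    · exact (hc (WL_trans hz s.2 hy)).elim
    · exact (hc (WL_trans hz (WL_trans hz s.2 hy) h)).elim
  have : s.1 = a := ext fun z => ⟨hns z, fun h => (hs' z).2 ⟨hn z h, ord_mem ha h⟩⟩
  exact hc (this ▸ s.2)
theorem zfN : ZFM (EN E z0) := by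
  refine ⟨⟨?_, ?_, ?_, ?_, ?_, ?_, sepFN hz, ?_⟩⟩
  · intro x y h
    refine Subtype.ext (ext (E := E) fun z => ⟨fun h' => ?_, fun h' => ?_⟩)
    · exact (h ⟨z, WL_trans hz x.2 h'⟩).1 h'
    · exact (h ⟨z, WL_trans hz y.2 h'⟩).2 h'
  · rintro x ⟨y, hy⟩
    obtain ⟨m, h1, h2⟩ := Z.sat.found x.1 ⟨y.1, hy⟩
    exact ⟨⟨m, WL_trans hz x.2 h1⟩, h1, fun z hz => h2 z.1 hz⟩
  · intro x y
    obtain ⟨n, hn⟩ := au hz (upr E x.1 y.1) (fun z hz => by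
      rcases mem_upr.1 hz with rfl | rfl
      · exact x.2
      · exact y.2)
    obtain ⟨b, hb⟩ := sepN hz n (fun z => z = x ∨ z = y)
    refine ⟨b, fun z => (hb z).trans ⟨fun h => h.2, fun h => ⟨hn _ ?_, h⟩⟩⟩
    rcases h with rfl | rfl
    · exact mem_upr.2 (Or.inl rfl)
    · exact mem_upr.2 (Or.inr rfl)
  · intro x
    obtain ⟨n, hn⟩ := au hz (Un E x.1) (fun z h => by
      obtain ⟨y, h1, h2⟩ := mem_Un.1 h
      exact WL_trans hz (WL_trans hz x.2 h1) h2)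
    obtain ⟨b, hb⟩ := sepN hz n (fun z => ∃ y, EN E z0 y x ∧ EN E z0 z y)
    exact ⟨b, fun z => (hb z).trans ⟨fun h => h.2, fun h => ⟨hn _ (mem_Un.2 ⟨h.choose.1, h.choose_spec⟩), h⟩⟩⟩
  · intro x
    obtain ⟨n, hn⟩ := au hz (sepS E (pw E x.1) (WL E z0)) (fun z h => (mem_sepS.1 h).2)
    obtain ⟨b, hb⟩ := sepN hz n (fun z => SubsetE (EN E z0) z x)
    exact ⟨b, fun z => (hb z).trans ⟨fun h => h.2, fun h => ⟨hn _ (mem_sepS.2 ⟨mem_pw.2 ((subN hz).1 h), z.2⟩), h⟩⟩⟩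
  · have ho : WL E z0 (om E) := ord_WL hz _ om_ord
    refine ⟨⟨om E, ho⟩, ⟨⟨emp E, WL_trans hz ho (lim_emp_mem om_lim)⟩, lim_emp_mem om_lim, fun u hu => mem_emp hu⟩, fun x hx => ?_⟩
    have h1 := (isLimitOrd_iff.1 (om_lim (E := E))).2.2 x.1 hx
    exact ⟨⟨sc E x.1, WL_trans hz ho h1⟩, h1, fun z => mem_sc.trans (or_congr Iff.rfl Subtype.ext_iff.symm)⟩
  · intro n f v a h
    have hev : ∀ x y : Nn E z0, Eval (EN E z0) NoAux AllSets f (Fin.cons x (Fin.cons y v)) ↔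
        evc E (WL E z0) (tr f) (kp E x.1 (kp E y.1 (tup E (emp E) (fun i => (v i).1)))) := fun x y => by
      rw [evalN hz, val_cons, val_cons, ← tup_cons, ← tup_cons, evc_tup]
    obtain ⟨s, hs⟩ := replP (E := E) a.1 (fun x y => WL E z0 y ∧
      evc E (WL E z0) (tr f) (kp E x (kp E y (tup E (emp E) (fun i => (v i).1))))) (by
        rintro x y y' hx ⟨h1, h2⟩ ⟨h1', h2'⟩
        have hxw := WL_trans hz a.2 hx
        exact congrArg Subtype.val ((h ⟨x, hxw⟩ hx).unique ((hev ⟨x, hxw⟩ ⟨y, h1⟩).2 h2) ((hev ⟨x, hxw⟩ ⟨y', h1'⟩).2 h2')))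
    obtain ⟨m, hm⟩ := au hz s (fun z h => by obtain ⟨_, _, h, _⟩ := (hs z).1 h; exact h)
    have hD : Dfn (EN E z0) (fun w : Fin 2 → Nn E z0 => Eval (EN E z0) NoAux AllSets f (Fin.cons (w 0) (Fin.cons (w 1) v))) :=
      ⟨_, f, Fin.cons (Sum.inl 0) (Fin.cons (Sum.inl 1) (fun i => Sum.inr (v i))), fun w => by
        refine iff_of_eq (congrArg _ ?_)
        funext i
        refine Fin.cases rfl (fun i => ?_) i
        exact Fin.cases rfl (fun i => rfl) i⟩
    have : Df2 (EN E z0) (fun x y : Nn E z0 => Eval (EN E z0) NoAux AllSets f (Fin.cons x (Fin.cons y v))) := ⟨hD⟩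
    have hD2 : Dfn (EN E z0) (fun w : Fin 1 → Nn E z0 => ∃ x, EN E z0 x a ∧ Eval (EN E z0) NoAux AllSets f (Fin.cons x (Fin.cons (w 0) v))) :=
      exD a (fun x y : Nn E z0 => Eval (EN E z0) NoAux AllSets f (Fin.cons x (Fin.cons y v)))
    obtain ⟨b, hb⟩ := sepN hz m (fun y => ∃ x, EN E z0 x a ∧ Eval (EN E z0) NoAux AllSets f (Fin.cons x (Fin.cons y v))) (hR := hD2)
    exact ⟨b, fun y => (hb y).trans ⟨fun h => h.2, fun ⟨x, hx, h'⟩ => ⟨hm _ ((hs _).2 ⟨x.1, hx, y.2, (hev x y).1 h'⟩), x, hx, h'⟩⟩⟩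
end
end

set_option autoImplicit false
set_option maxHeartbeats 1000000
set_option linter.unusedSectionVars false
section
variable {M : Type} {E : M → M → Prop} [Z : ZFM E]
section
variable {z0 : M} (hz : TransSet E z0) [ZN : ZFM (EN E z0)]
include hz
theorem eqN {x : Nn E z0} {y : M} (hy : ∀ z, E z y → WL E z0 z) (h : ∀ z : Nn E z0, EN E z0 z x ↔ E z.1 y) : x.1 = y :=
  ext (E := E) fun z => ⟨fun h' => (h ⟨z, WL_trans hz x.2 h'⟩).1 h', fun h' => (h ⟨z, hy z h'⟩).2 h'⟩
theorem uprN (x y : Nn E z0) : (upr (EN E z0) x y).1 = upr E x.1 y.1 :=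
  eqN hz (fun z h => by
    rcases mem_upr.1 h with rfl | rfl
    exacts [x.2, y.2]) (fun z => by simp only [mem_upr, Subtype.ext_iff])
theorem kpN (x y : Nn E z0) : (kp (EN E z0) x y).1 = kp E x.1 y.1 := by
  simp only [kp, sing, uprN hz]
theorem scN (x : Nn E z0) : (sc (EN E z0) x).1 = sc E x.1 :=
  eqN hz (fun z h => by
    rcases mem_sc.1 h with h | rfl
    exacts [WL_trans hz x.2 h, x.2]) (fun z => mem_sc.trans (by rw [mem_sc (E := E), Subtype.ext_iff]; rfl))
theorem empN : (emp (EN E z0)).1 = emp E :=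
  eqN hz (fun _ h => (mem_emp h).elim) (fun _ => ⟨fun h => (mem_emp h).elim, fun h => (mem_emp h).elim⟩)
theorem WL_kp {x y : M} (hx : WL E z0 x) (hy : WL E z0 y) : WL E z0 (kp E x y) := by
  have := kpN hz ⟨x, hx⟩ ⟨y, hy⟩; rw [← this]; exact Subtype.property _
theorem WL_of_kp {x y : M} (h : WL E z0 (kp E x y)) : WL E z0 x ∧ WL E z0 y := by
  have : WL E z0 (upr E x y) := WL_trans hz h (mem_upr.2 (Or.inr rfl))
  exact ⟨WL_trans hz this (mem_upr.2 (Or.inl rfl)), WL_trans hz this (mem_upr.2 (Or.inr rfl))⟩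
theorem ikpN {p x y : Nn E z0} : IsKPair (EN E z0) p x y ↔ p.1 = kp E x.1 y.1 := by
  rw [isKPair_iff, ← kpN hz]; exact Subtype.ext_iff
theorem prN {f x y : Nn E z0} : EN E z0 (kp (EN E z0) x y) f ↔ E (kp E x.1 y.1) f.1 := by
  rw [← kpN hz]; rfl
theorem funN {f d : Nn E z0} : IsFuncOn (EN E z0) f d ↔ IsFuncOn E f.1 d.1 := by
  unfold IsFuncOn IsFunc
  simp only [pairIn_iff, isKPair_iff, prN hz]
  constructor
  · rintro ⟨⟨h1, h2⟩, h3⟩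
    refine ⟨⟨fun p hp => ?_, fun x y y' hy hy' => ?_⟩, fun x => ⟨?_, fun hx => ?_⟩⟩
    · obtain ⟨x, y, h⟩ := h1 ⟨p, WL_trans hz f.2 hp⟩ hp
      exact ⟨x.1, y.1, by rw [← kpN hz, ← h]⟩
    · have a := WL_of_kp hz (WL_trans hz f.2 hy)
      have b := WL_of_kp hz (WL_trans hz f.2 hy')
      exact congrArg Subtype.val (h2 ⟨x, a.1⟩ ⟨y, a.2⟩ ⟨y', b.2⟩ hy hy')
    · rintro ⟨y, hy⟩
      have a := WL_of_kp hz (WL_trans hz f.2 hy)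
      exact (h3 ⟨x, a.1⟩).1 ⟨⟨y, a.2⟩, hy⟩
    · obtain ⟨y, hy⟩ := (h3 ⟨x, WL_trans hz d.2 hx⟩).2 hx; exact ⟨y.1, hy⟩
  · rintro ⟨⟨h1, h2⟩, h3⟩
    refine ⟨⟨fun p hp => ?_, fun x y y' hy hy' => Subtype.ext (h2 _ _ _ hy hy')⟩, fun x => ⟨?_, fun hx => ?_⟩⟩
    · obtain ⟨x, y, h⟩ := h1 p.1 hp
      have a := WL_of_kp hz (h ▸ p.2)
      exact ⟨⟨x, a.1⟩, ⟨y, a.2⟩, Subtype.ext (by rw [kpN hz, h])⟩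
    · rintro ⟨y, hy⟩; exact (h3 x.1).1 ⟨y.1, hy⟩
    · obtain ⟨y, hy⟩ := (h3 x.1).2 hx
      exact ⟨⟨y, (WL_of_kp hz (WL_trans hz f.2 hy)).2⟩, hy⟩
theorem limN {x : Nn E z0} : IsLimitOrd (EN E z0) x ↔ IsLimitOrd E x.1 := by
  rw [isLimitOrd_iff, isLimitOrd_iff, ordN hz]
  refine and_congr Iff.rfl (and_congr ?_ ?_)
  · exact ⟨fun ⟨y, h⟩ => ⟨y.1, h⟩, fun ⟨y, h⟩ => ⟨⟨y, WL_trans hz x.2 h⟩, h⟩⟩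
  · have : ∀ y : Nn E z0, EN E z0 (sc (EN E z0) y) x ↔ E (sc E y.1) x.1 := fun y => by rw [← scN hz]; rfl
    simp only [this]; exact allN hz (P := fun z => E (sc E z) x.1)
theorem omN : (om (EN E z0)).1 = om E := by
  have h := om_spec (E := EN E z0)
  refine om_uniq ⟨(limN hz).1 h.1, fun z hzx hl => ?_⟩
  exact h.2 ⟨z, WL_trans hz (om (EN E z0)).2 hzx⟩ hzx ((limN hz).2 hl)
theorem gmW {i : ℕ} {w x y : M} (hx : WL E z0 x) (hy : WL E z0 y) (h : GM E i w x y) : WL E z0 w := by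
  have k2 : ∀ {u v}, WL E z0 u → WL E z0 v → WL E z0 (kp E u v) := WL_kp hz
  match i with
  | 0 => rcases h with rfl | rfl; exacts [hx, hy]
  | 1 => obtain ⟨u, v, hu, hv, h⟩ := h; rw [isKPair_iff.1 h]; exact k2 (WL_trans hz hx hu) (WL_trans hz hy hv)
  | 2 => obtain ⟨u, v, hu, hv, _, h⟩ := h; rw [isKPair_iff.1 h]; exact k2 (WL_trans hz hx hu) (WL_trans hz hy hv)
  | 3 => exact WL_trans hz hx h.1
  | 4 => exact WL_trans hz hx h.1
  | 5 => obtain ⟨u, hu, h⟩ := h; exact WL_trans hz (WL_trans hz hx hu) h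
  | 6 => obtain ⟨p, u, hu, h⟩ := h; rw [isKPair_iff.1 h] at hu; exact (WL_of_kp hz (WL_trans hz hx hu)).1
  | 7 =>
    obtain ⟨u, v, p, hu, h, h'⟩ := h; rw [isKPair_iff.1 h] at hu; rw [isKPair_iff.1 h']
    have a := WL_of_kp hz (WL_trans hz hx hu); exact k2 a.2 a.1
  | 8 =>
    obtain ⟨u, v, w, t, hu, h, h'⟩ := h; rw [isKTriple_iff.1 h] at hu; rw [isKTriple_iff.1 h']
    have a := WL_of_kp hz (WL_trans hz hx hu); have b := WL_of_kp hz a.2; exact k2 a.1 (k2 b.2 b.1)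
  | k + 9 =>
    obtain ⟨u, v, w, t, hu, h, h'⟩ := h; rw [isKTriple_iff.1 h] at hu; rw [isKTriple_iff.1 h']
    have a := WL_of_kp hz (WL_trans hz hx hu); have b := WL_of_kp hz a.2; exact k2 b.2 (k2 a.1 b.1)
theorem gmN {i : ℕ} {w x y : Nn E z0} : GM (EN E z0) i w x y ↔ GM E i w.1 x.1 y.1 := by
  have e1 : ∀ {p u v : Nn E z0}, p = kp (EN E z0) u v ↔ p.1 = kp E u.1 v.1 := fun {p u v} => by
    rw [← kpN hz]; exact Subtype.ext_iff
  match i with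
  | 0 => exact or_congr Subtype.ext_iff Subtype.ext_iff
  | 1 =>
    simp only [GM, isKPair_iff, e1]
    constructor
    · rintro ⟨u, v, h⟩; exact ⟨u.1, v.1, h⟩
    · rintro ⟨u, v, hu, hv, h⟩; exact ⟨⟨u, WL_trans hz x.2 hu⟩, ⟨v, WL_trans hz y.2 hv⟩, hu, hv, h⟩
  | 2 =>
    simp only [GM, isKPair_iff, e1]
    constructor
    · rintro ⟨u, v, h⟩; exact ⟨u.1, v.1, h⟩
    · rintro ⟨u, v, hu, hv, h⟩; exact ⟨⟨u, WL_trans hz x.2 hu⟩, ⟨v, WL_trans hz y.2 hv⟩, hu, hv, h⟩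
  | 3 => exact Iff.rfl
  | 4 => exact Iff.rfl
  | 5 => exact exN hz (P := fun z => E w.1 z)
  | 6 =>
    simp only [GM, isKPair_iff, e1]
    constructor
    · rintro ⟨p, u, h⟩; exact ⟨p.1, u.1, h⟩
    · rintro ⟨p, u, hp, rfl⟩; exact ⟨⟨_, WL_trans hz x.2 hp⟩, ⟨u, (WL_of_kp hz (WL_trans hz x.2 hp)).2⟩, hp, rfl⟩
  | 7 =>
    simp only [GM, isKPair_iff, e1]
    constructor
    · rintro ⟨u, v, p, h⟩; exact ⟨u.1, v.1, p.1, h⟩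
    · rintro ⟨u, v, p, hp, rfl, h⟩
      have a := WL_of_kp hz (WL_trans hz x.2 hp)
      exact ⟨⟨u, a.1⟩, ⟨v, a.2⟩, ⟨_, WL_trans hz x.2 hp⟩, hp, rfl, h⟩
  | 8 =>
    simp only [GM, isKTriple_iff, e1, kpN hz]
    constructor
    · rintro ⟨u, v, w, t, h⟩; exact ⟨u.1, v.1, w.1, t.1, h⟩
    · rintro ⟨u, v, w, t, hp, rfl, h⟩
      have a := WL_of_kp hz (WL_trans hz x.2 hp); have b := WL_of_kp hz a.2
      exact ⟨⟨u, a.1⟩, ⟨v, b.2⟩, ⟨w, b.1⟩, ⟨_, WL_trans hz x.2 hp⟩, hp, rfl, h⟩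
  | k + 9 =>
    simp only [GM, isKTriple_iff, e1, kpN hz]
    constructor
    · rintro ⟨u, v, w, t, h⟩; exact ⟨u.1, v.1, w.1, t.1, h⟩
    · rintro ⟨u, v, w, t, hp, rfl, h⟩
      have a := WL_of_kp hz (WL_trans hz x.2 hp); have b := WL_of_kp hz a.2
      exact ⟨⟨u, b.2⟩, ⟨v, a.1⟩, ⟨w, b.1⟩, ⟨_, WL_trans hz x.2 hp⟩, hp, rfl, h⟩
theorem gopN {i : ℕ} {z x y : Nn E z0} : GOp (EN E z0) i z x y ↔ GOp E i z.1 x.1 y.1 := by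
  unfold GOp; simp only [gmN hz]
  constructor
  · intro h w
    constructor
    · intro hw; exact (h ⟨w, WL_trans hz z.2 hw⟩).1 hw
    · intro hw; exact (h ⟨w, gmW hz x.2 y.2 hw⟩).2 hw
  · exact fun h w => h w.1
theorem gop_up {i : ℕ} {x y : Nn E z0} {z : M} (h : GOp E i z x.1 y.1) : ∃ z' : Nn E z0, z'.1 = z ∧ GOp (EN E z0) i z' x y := by
  obtain ⟨z', h'⟩ := gop_ex (E := EN E z0) i x y
  exact ⟨z', gop_uniq ((gopN hz).1 h') h, h'⟩
theorem gclN {b c : Nn E z0} (h : IsGClOf (EN E z0) b c) : IsGClOf E b.1 c.1 := by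
  obtain ⟨c', hc'⟩ := itw_ex (E := EN E z0) (F := Stp (EN E z0)) (stp_tot (E := EN E z0)) b
  have := gcl_uniq h (itw_gcl hc'); subst this
  refine ⟨(subN hz).1 h.1, gclosed_iff.2 fun i x y z hx hy hg => ?_, fun d hbd hd => ?_⟩
  · obtain ⟨z', rfl, h'⟩ := gop_up hz (x := ⟨x, WL_trans hz c.2 hx⟩) (y := ⟨y, WL_trans hz c.2 hy⟩) hg
    exact gclosed_iff.1 h.2.1 i ⟨x, WL_trans hz c.2 hx⟩ ⟨y, WL_trans hz c.2 hy⟩ _ hx hy h'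
  · obtain ⟨w, H, hw, h1, h2, h3, h4⟩ := hc'
    have := om_uniq hw; subst this
    have h1' := (funN hz).1 h1; rw [omN hz] at h1'
    have key : ∀ n, E n (om E) → ∀ y, E (kp E n y) H.1 → SubsetE E y d := by
      refine om_ind (E := E) (fun n => ∀ y, E (kp E n y) H.1 → SubsetE E y d) ?_ ?_
      · intro y hy
        have a := WL_of_kp hz (WL_trans hz H.2 hy)
        have := h2 (emp (EN E z0)) ⟨y, a.2⟩ (isZero_iff.2 rfl) (pairIn_iff.2 ((prN hz).2 (by rw [empN hz]; exact hy)))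
        have := congrArg Subtype.val this; simp only at this
        rw [this]; exact hbd
      · intro n hn ih y hy u hu
        obtain ⟨x, hx⟩ := fun_val h1' hn
        have a := WL_of_kp hz (WL_trans hz H.2 hx)
        have b := WL_of_kp hz (WL_trans hz H.2 hy)
        have hs := h3 ⟨n, a.1⟩ (sc (EN E z0) ⟨n, a.1⟩) ⟨x, a.2⟩ ⟨y, b.2⟩ (isSuccOf_iff.2 rfl) (pairIn_iff.2 ((prN hz).2 hx))
          (pairIn_iff.2 ((prN hz).2 (by rw [scN hz]; exact hy)))
        rcases (hs ⟨u, WL_trans hz b.2 hu⟩).1 hu with h | ⟨p, q, hp, hq, i, hg⟩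
        · exact ih x hx u h
        · exact gclosed_iff.1 hd i _ _ _ (ih x hx _ hp) (ih x hx _ hq) ((gopN hz).1 hg)
    intro u hu
    obtain ⟨n, y, hy, huy⟩ := (h4 ⟨u, WL_trans hz c.2 hu⟩).1 hu
    have hy := (prN hz).1 (pairIn_iff.1 hy)
    exact key n.1 (fun_dom h1' hy) y.1 hy u huy
theorem defN {l d : Nn E z0} (h : IsDefSetOf (EN E z0) l d) : IsDefSetOf E l.1 d.1 := by
  obtain ⟨c, hc, hd⟩ := defset_iff.1 h
  have := gclN hz hc; rw [scN hz] at this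
  refine defset_iff.2 ⟨c.1, this, fun y => ⟨fun hy => ?_, fun hy => ?_⟩⟩
  · have := (hd ⟨y, WL_trans hz d.2 hy⟩).1 hy; rw [subN hz] at this; exact this
  · exact (hd ⟨y, WL_trans hz c.2 hy.2⟩).2 ⟨(subN hz).2 hy.1, hy.2⟩
theorem LRN {z1 a l : Nn E z0} (h : LR (EN E z0) z1 a l) : LR E z1.1 a.1 l.1 := by
  have ha := h.1
  obtain ⟨H, h1, h2⟩ := tri_fun (z0 := z1) (def_tot (E := EN E z0)) (sc (EN E z0) a) (ord_sc ha)
  have h1' := (funN hz).1 h1; rw [scN hz] at h1'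
  have up : ∀ {c y}, E (kp E c y) H.1 → ∃ (hc : WL E z0 c) (hy : WL E z0 y), LR (EN E z0) z1 ⟨c, hc⟩ ⟨y, hy⟩ := fun {c y} h => by
    have a := WL_of_kp hz (WL_trans hz H.2 h)
    exact ⟨a.1, a.2, ((h2 ⟨c, a.1⟩ ⟨y, a.2⟩).1 ((prN hz).2 h)).2⟩
  have hosc := ord_sc ((ordN hz).1 ha)
  have key : ∀ c, IsOrd E c → ∀ y, E (kp E c y) H.1 → LR E z1.1 c y := by
    refine ord_ind (E := E) (fun c => ∀ y, E (kp E c y) H.1 → LR E z1.1 c y) ?_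
    intro c hc ih y hy
    obtain ⟨hcw, hyw, hL⟩ := up hy
    obtain ⟨k, hk⟩ := LR_ex (z0 := z1.1) hc
    suffices y = k by rw [this]; exact hk
    have hcd := fun_dom h1' hy
    rcases ord_tri hc with rfl | ⟨b, hb, rfl⟩ | hlim
    · rw [tri_zero def_tot hk]
      have e : (⟨emp E, hcw⟩ : Nn E z0) = emp (EN E z0) := Subtype.ext (empN hz).symm
      rw [e] at hL
      exact congrArg Subtype.val (tri_zero def_tot hL)
    · have hbs : E b (sc E b) := mem_sc.2 (Or.inr rfl)
      obtain ⟨x, hx⟩ := fun_val h1' (hosc.1 _ hcd _ hbs)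
      obtain ⟨hbw, hxw, hLx⟩ := up hx
      have e : (⟨sc E b, hcw⟩ : Nn E z0) = sc (EN E z0) ⟨b, hbw⟩ := Subtype.ext (scN hz ⟨b, hbw⟩).symm
      rw [e] at hL
      exact (def_tot x).unique (defN hz (tri_sc def_tot hLx hL)) (tri_sc def_tot (ih b hbs x hx) hk)
    · have t1 := tri_lim def_tot hlim hk
      have t2 := tri_lim def_tot ((limN hz (x := ⟨c, hcw⟩)).2 hlim) hL
      refine ext (E := E) fun u => ?_
      rw [t1]
      constructor
      · intro hu
        obtain ⟨d, m, hd, hm, hum⟩ := (t2 ⟨u, WL_trans hz hyw hu⟩).1 hu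
        have hmH := (h2 d m).2 ⟨(h1.2 _).1 (by
          have := hosc.1 _ hcd _ hd
          obtain ⟨q, hq⟩ := fun_val h1' this
          exact ⟨⟨q, (WL_of_kp hz (WL_trans hz H.2 hq)).2⟩, pairIn_iff.2 ((prN hz).2 hq)⟩), hm⟩
        exact ⟨d.1, m.1, hd, ih _ hd _ ((prN hz).1 hmH), hum⟩
      · rintro ⟨d, m, hd, hm, hum⟩
        obtain ⟨q, hq⟩ := fun_val h1' (hosc.1 _ hcd _ hd)
        obtain ⟨hdw, hqw, hLq⟩ := up hq
        have := LR_uq hm (ih d hd q hq); subst this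
        exact (t2 ⟨u, WL_trans hz hqw hum⟩).2 ⟨⟨d, hdw⟩, ⟨m, hqw⟩, hd, hLq, hum⟩
  exact key a.1 ((ordN hz).1 ha) l.1 ((prN hz).1 ((h2 a l).2 ⟨mem_sc.2 (Or.inr rfl), h⟩))
/-- elements of the M-hierarchy over a base in N appear in the N-hierarchy -/
theorem WLN {z1 : Nn E z0} {x : M} (h : WL E z1.1 x) : ∃ hx : WL E z0 x, WL (EN E z0) z1 ⟨x, hx⟩ := by
  obtain ⟨a, l, hl, hx⟩ := h
  have ha : IsOrd (EN E z0) ⟨a, ord_WL hz a hl.1⟩ := (ordN hz).2 hl.1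
  obtain ⟨k, hk⟩ := LR_ex (z0 := z1) ha
  have := LR_uq hl (LRN hz hk); subst this
  exact ⟨WL_trans hz k.2 hx, _, k, hk, hx⟩
end
end

set_option autoImplicit false
set_option maxHeartbeats 1000000
set_option linter.unusedSectionVars false
set_option synthInstance.maxSize 2000
set_option synthInstance.maxHeartbeats 400000
section
variable {M : Type} {E : M → M → Prop} [Z : ZFM E]
section
variable (E) (V1 : M) (P OP : M → M → M → Prop)
def Ug (H u : M) : Prop := ∀ z, E z u ↔ E z V1 ∨ ∃ β k i x w, E (kp E β k) H ∧ E i V1 ∧ E x k ∧ E w k ∧ OP β (kp E i (kp E x w)) z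
abbrev UR : M → M → Prop := RecR E (Ug E V1 OP)
def Hit (β k A : M) : Prop := ∃ i x w z, E i V1 ∧ E x k ∧ E w k ∧ E z A ∧ OP β (kp E i (kp E x w)) z
def SB (H A y z : M) : Prop := (E y A ∧ E y V1 ∧ z = y) ∨ ((¬ ∃ a, E a A ∧ E a V1) ∧ ∃ β σ k, E (kp E β σ) H ∧ UR E V1 OP β k ∧
  Hit E V1 OP β k A ∧ (∀ β', E β' β → ∀ k', UR E V1 OP β' k' → ¬ Hit E V1 OP β' k' A) ∧
  ∃ i y' y0 y1, P y i y' ∧ P y' y0 y1 ∧ E i V1 ∧ ∃ x w A1 A2,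
    (∀ p, E p A1 ↔ E p k ∧ ∃ q z', E q k ∧ E z' A ∧ OP β (kp E i (kp E p q)) z') ∧
    (∀ q, E q A2 ↔ E q k ∧ ∃ z', E z' A ∧ OP β (kp E i (kp E x q)) z') ∧
    E (kp E A1 (kp E y0 x)) σ ∧ E (kp E A2 (kp E y1 w)) σ ∧ OP β (kp E i (kp E x w)) z)
def Sg (H s : M) : Prop := ∀ t, E t s ↔ ∃ d u A y z, IsFuncOn E H d ∧ UR E V1 OP d u ∧ SubsetE E A u ∧ E y V1 ∧ E z A ∧
  t = kp E A (kp E y z) ∧ SB E V1 P OP H A y z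
abbrev SR : M → M → Prop := RecR E (Sg E V1 P OP)
end
section
variable {V1 : M} {P OP : M → M → M → Prop} [hP : Df3 E P] [hO : Df3 E OP]
section
variable {n : ℕ} {t s r q : (Fin n → M) → M} [DFn E t] [DFn E s] [DFn E r] [DFn E q]
instance Ug.dfn : Dfn E (fun v => Ug E V1 OP (t v) (s v)) := Dfn.sub2 (by unfold Ug; infer_instance) t s
instance Hit.dfn : Dfn E (fun v => Hit E V1 OP (t v) (s v) (r v)) := Dfn.sub3 (by unfold Hit; infer_instance) t s r
instance SB.dfn : Dfn E (fun v => SB E V1 P OP (t v) (s v) (r v) (q v)) := Dfn.sub4 (by unfold SB; infer_instance) t s r q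
instance Sg.dfn : Dfn E (fun v => Sg E V1 P OP (t v) (s v)) := Dfn.sub2 (by unfold Sg; infer_instance) t s
end
variable (hOf : ∀ β p z z', OP β p z → OP β p z' → z = z')
include hOf
theorem ug_tot (H : M) : ∃! u, Ug E V1 OP H u := by
  obtain ⟨b, hb⟩ := replP (E := E) (prd E (Un E (Un E H)) (prd E V1 (prd E (Un E (Un E (Un E H))) (Un E (Un E (Un E H))))))
    (fun q z => ∃ β k i x w, q = kp E β (kp E i (kp E x w)) ∧ E (kp E β k) H ∧ E i V1 ∧ E x k ∧ E w k ∧ OP β (kp E i (kp E x w)) z) (by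
      rintro q z z' _ ⟨β, k, i, x, w, rfl, h⟩ ⟨β', k', i', x', w', e, h'⟩
      simp only [kp_inj] at e
      obtain ⟨rfl, rfl, rfl, rfl⟩ := e
      exact hOf _ _ _ _ h.2.2.2.2 h'.2.2.2.2)
  have h1 : Ug E V1 OP H (bun E V1 b) := by
    intro z; rw [mem_bun (E := E), hb]
    refine or_congr Iff.rfl ⟨?_, ?_⟩
    · rintro ⟨q, _, β, k, i, x, w, _, h⟩; exact ⟨β, k, i, x, w, h⟩
    · rintro ⟨β, k, i, x, w, h1, h2, h3, h4, h5⟩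
      have := kp_mem_UnUn h1
      exact ⟨_, mem_prd.2 ⟨_, _, this.1, mem_prd.2 ⟨_, _, h2, mem_prd.2 ⟨_, _, mem_Un.2 ⟨k, this.2, h3⟩, mem_Un.2 ⟨k, this.2, h4⟩, rfl⟩, rfl⟩, rfl⟩,
        β, k, i, x, w, rfl, h1, h2, h3, h4, h5⟩
  exact ⟨_, h1, fun u h => ext (E := E) fun z => by rw [h, h1]⟩
theorem U_mem {a u : M} (h : UR E V1 OP a u) (z : M) : E z u ↔ E z V1 ∨ ∃ β k, E β a ∧ UR E V1 OP β k ∧ ∃ i x w, E i V1 ∧ E x k ∧ E w k ∧ OP β (kp E i (kp E x w)) z := by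
  obtain ⟨H, h1, h2, h3⟩ := recR_unf (ug_tot (E := E) (V1 := V1) hOf) h
  rw [h3 z]
  simp only [h2]
  refine or_congr Iff.rfl ⟨?_, ?_⟩
  · rintro ⟨β, k, i, x, w, ⟨ha, hb⟩, h⟩; exact ⟨β, k, ha, hb, i, x, w, h⟩
  · rintro ⟨β, k, ha, hb, i, x, w, h⟩; exact ⟨β, k, i, x, w, ⟨ha, hb⟩, h⟩
theorem U_uq {a u u' : M} (h : UR E V1 OP a u) (h' : UR E V1 OP a u') : u = u' := recR_uniq (ug_tot (E := E) (V1 := V1) hOf) h h'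
theorem U_ex {a : M} (h : IsOrd E a) : ∃ u, UR E V1 OP a u := recR_total (ug_tot (E := E) (V1 := V1) hOf) h
theorem U_mono {a b u v : M} (hab : E a b ∨ a = b) (h : UR E V1 OP a u) (h' : UR E V1 OP b v) : SubsetE E u v := by
  rcases hab with hab | rfl
  · intro z hz
    rw [U_mem hOf h'] 
    refine ((U_mem hOf h z).1 hz).imp id ?_
    rintro ⟨β, k, h1, h2⟩; exact ⟨β, k, h'.1.1 _ hab _ h1, h2⟩
  · rw [U_uq hOf h h']; exact fun _ h => h
theorem sg_tot (H : M) : ∃! s, Sg E V1 P OP H s := by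
  have : ∃ s, Sg E V1 P OP H s := by
    by_cases h : ∃ d u, IsFuncOn E H d ∧ UR E V1 OP d u
    · obtain ⟨d, u, h1, h2⟩ := h
      refine ⟨sepS E (prd E (pw E u) (prd E V1 u)) (fun t => ∃ d u A y z, IsFuncOn E H d ∧ UR E V1 OP d u ∧ SubsetE E A u ∧ E y V1 ∧ E z A ∧
        t = kp E A (kp E y z) ∧ SB E V1 P OP H A y z), fun t => ?_⟩
      rw [mem_sepS (E := E)]
      refine ⟨fun h => h.2, fun h => ⟨?_, h⟩⟩
      obtain ⟨d', u', A, y, z, g1, g2, g3, g4, g5, rfl, _⟩ := h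
      have := dom_uniq h1 g1; subst this
      have := U_uq hOf h2 g2; subst this
      exact mem_prd.2 ⟨_, _, mem_pw.2 g3, mem_prd.2 ⟨_, _, g4, g3 _ g5, rfl⟩, rfl⟩
    · refine ⟨emp E, fun t => ⟨fun h => (mem_emp h).elim, ?_⟩⟩
      rintro ⟨d, u, A, y, z, g1, g2, _⟩; exact (h ⟨d, u, g1, g2⟩).elim
  obtain ⟨s, hs⟩ := this
  exact ⟨s, hs, fun s' h' => ext (E := E) fun z => by rw [hs, h']⟩
theorem S_mem {a s u : M} (h : SR E V1 P OP a s) (hu : UR E V1 OP a u) : ∃ H, IsFuncOn E H a ∧ (∀ b y, E (kp E b y) H ↔ E b a ∧ SR E V1 P OP b y) ∧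
    ∀ A y z, E (kp E A (kp E y z)) s ↔ SubsetE E A u ∧ E y V1 ∧ E z A ∧ SB E V1 P OP H A y z := by
  obtain ⟨H, h1, h2, h3⟩ := recR_unf (sg_tot (E := E) (V1 := V1) (P := P) hOf) h
  refine ⟨H, h1, h2, fun A y z => ?_⟩
  rw [h3]
  constructor
  · rintro ⟨d', u', A', y', z', g1, g2, g3, g4, g5, e, g6⟩
    have := dom_uniq h1 g1; subst this
    have := U_uq hOf hu g2; subst this
    simp only [kp_inj] at e
    obtain ⟨rfl, rfl, rfl⟩ := e
    exact ⟨g3, g4, g5, g6⟩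
  · rintro ⟨g3, g4, g5, g6⟩; exact ⟨a, u, A, y, z, h1, hu, g3, g4, g5, rfl, g6⟩
variable (hPf : ∀ y a b a' b', P y a b → P y a' b' → a = a' ∧ b = b') (hPs : ∀ a b, E a V1 → E b V1 → ∃ y, E y V1 ∧ P y a b)
include hPf hPs
theorem S_main : ∀ a, IsOrd E a → ∀ s u, SR E V1 P OP a s → UR E V1 OP a u →
    (∀ A y z z', E (kp E A (kp E y z)) s → E (kp E A (kp E y z')) s → z = z') ∧
    ∀ A, SubsetE E A u → (∃ x, E x A) → ∃ y z, E (kp E A (kp E y z)) s := by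
  refine ord_ind (E := E) (fun a => ∀ s u, SR E V1 P OP a s → UR E V1 OP a u →
    (∀ A y z z', E (kp E A (kp E y z)) s → E (kp E A (kp E y z')) s → z = z') ∧
    ∀ A, SubsetE E A u → (∃ x, E x A) → ∃ y z, E (kp E A (kp E y z)) s) ?_
  intro a ha ih s u hs hu
  obtain ⟨H, h1, h2, h3⟩ := S_mem hOf hs hu
  constructor
  · intro A y z z' hzs hzs'
    obtain ⟨_, _, _, hb⟩ := (h3 A y z).1 hzs
    obtain ⟨_, _, _, hb'⟩ := (h3 A y z').1 hzs'
    rcases hb with ⟨c1, c2, rfl⟩ | ⟨c, β, σ, k, g1, g2, g3, g4, i, y', y0, y1, g5, g6, g7, x, w, A1, A2, g8, g9, g10, g11, g12⟩ <;>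
    rcases hb' with ⟨c1', c2', rfl⟩ | ⟨c', β', σ', k', g1', g2', g3', g4', i', y'', y0', y1', g5', g6', g7', x', w', A1', A2', g8', g9', g10', g11', g12'⟩
    · rfl
    · exact (c' ⟨_, c1, c2⟩).elim
    · exact (c ⟨_, c1', c2'⟩).elim
    · have hβ : β = β' := by
        rcases ord_lin g2.1 g2'.1 with h | h | h
        · exact (g4' _ h _ g2 g3).elim
        · exact h
        · exact (g4 _ h _ g2' g3').elim
      subst hβ
      obtain ⟨hβ, hσ⟩ := (h2 _ _).1 g1
      have := fun_uniq h1 g1 g1'; subst this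
      have := U_uq hOf g2 g2'; subst this
      obtain ⟨rfl, rfl⟩ := hPf _ _ _ _ _ g5 g5'
      obtain ⟨rfl, rfl⟩ := hPf _ _ _ _ _ g6 g6'
      have : A1 = A1' := ext (E := E) fun p => by rw [g8, g8']
      subst this
      have := (ih β hβ σ k hσ g2).1 _ _ _ _ g10 g10'; subst this
      have : A2 = A2' := ext (E := E) fun p => by rw [g9, g9']
      subst this
      have := (ih β hβ σ k hσ g2).1 _ _ _ _ g11 g11'; subst this
      exact hOf _ _ _ _ g12 g12'
  · rintro A hA ⟨a0, ha0⟩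
    by_cases hc : ∃ a, E a A ∧ E a V1
    · obtain ⟨y, hy, hy'⟩ := hc
      exact ⟨y, y, (h3 _ _ _).2 ⟨hA, hy', hy, Or.inl ⟨hy, hy', rfl⟩⟩⟩
    · rcases (U_mem hOf hu a0).1 (hA _ ha0) with h | ⟨β0, k0, e1, e2, i0, x0, w0, e3, e4, e5, e6⟩
      · exact (hc ⟨_, ha0, h⟩).elim
      · obtain ⟨β, hβ, ⟨k, hk, hit⟩, hmin⟩ := ord_least (E := E) (fun β => ∃ k, UR E V1 OP β k ∧ Hit E V1 OP β k A)
          ⟨β0, e2.1, k0, e2, i0, x0, w0, a0, e3, e4, e5, ha0, e6⟩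
        have hβa : E β a := by
          rcases ord_lin hβ e2.1 with h | rfl | h
          · exact ha.1 _ e1 _ h
          · exact e1
          · exact (hmin _ h ⟨k0, e2, i0, x0, w0, a0, e3, e4, e5, ha0, e6⟩).elim
        obtain ⟨σ, hσ⟩ := fun_val h1 hβa
        have hS := ((h2 _ _).1 hσ).2
        obtain ⟨H', _, _, h3'⟩ := S_mem hOf hS hk
        have ih := (ih β hβa σ k hS hk).2
        obtain ⟨i, x, w, z, f1, f2, f3, f4, f5⟩ := hit
        have m1 : ∀ p, E p (sepS E k (fun p => ∃ q z', E q k ∧ E z' A ∧ OP β (kp E i (kp E p q)) z')) ↔ _ := fun p => mem_sepS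
        obtain ⟨y0, x', hx'⟩ := ih _ (fun p h => ((m1 p).1 h).1) ⟨x, (m1 x).2 ⟨f2, w, z, f3, f4, f5⟩⟩
        have hx1 := (h3' _ _ _).1 hx'
        obtain ⟨_, q, z', q1, q2, q3⟩ := (m1 x').1 hx1.2.2.1
        have m2 : ∀ p, E p (sepS E k (fun p => ∃ z', E z' A ∧ OP β (kp E i (kp E x' p)) z')) ↔ _ := fun p => mem_sepS
        obtain ⟨y1, w', hw'⟩ := ih _ (fun p h => ((m2 p).1 h).1) ⟨q, (m2 q).2 ⟨q1, z', q2, q3⟩⟩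
        have hw1 := (h3' _ _ _).1 hw'
        obtain ⟨_, z2, r1, r2⟩ := (m2 w').1 hw1.2.2.1
        obtain ⟨y', hy', t1⟩ := hPs y0 y1 hx1.2.1 hw1.2.1
        obtain ⟨y, hy, t2⟩ := hPs i y' f1 hy'
        exact ⟨y, z2, (h3 _ _ _).2 ⟨hA, hy, r1, Or.inr ⟨hc, β, σ, k, hσ, hk, ⟨i, x, w, z, f1, f2, f3, f4, f5⟩,
          fun β' hb k' hk' hh => hmin β' hb ⟨k', hk', hh⟩, i, y', y0, y1, t2, t1, f1, x', w', _, _, m1, m2, hx', hw', r2⟩⟩⟩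
theorem sel (hgen : ∀ z, ∃ a u, UR E V1 OP a u ∧ E z u) (X : M) : ∃ S,
    (∀ A y z, E (kp E A (kp E y z)) S → E y V1 ∧ E z A) ∧
    (∀ A y z z', E (kp E A (kp E y z)) S → E (kp E A (kp E y z')) S → z = z') ∧
    ∀ A, SubsetE E A X → (∃ x, E x A) → ∃ y z, E (kp E A (kp E y z)) S := by
  obtain ⟨B, hB, h⟩ := coll (E := E) X (fun z β => ∃ u, UR E V1 OP β u ∧ E z u) (fun x _ => by
    obtain ⟨a, u, h1, h2⟩ := hgen x; exact ⟨a, h1.1, u, h1, h2⟩)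
  obtain ⟨u, hu⟩ := U_ex (E := E) (V1 := V1) hOf hB
  obtain ⟨s, hs⟩ := recR_total (sg_tot (E := E) (V1 := V1) (P := P) hOf) hB
  obtain ⟨H, _, _, h3⟩ := S_mem hOf hs hu
  have hm := S_main hOf hPf hPs B hB s u hs hu
  refine ⟨s, fun A y z h => ?_, hm.1, fun A hA hn => hm.2 A (fun z hz => ?_) hn⟩
  · have := (h3 A y z).1 h; exact ⟨this.2.1, this.2.2.1⟩
  · obtain ⟨β, h1, v, h2, h3⟩ := h z (hA z hz)
    exact U_mono hOf (Or.inl h1) h2 hu _ h3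
end
end

set_option autoImplicit false
set_option maxHeartbeats 1000000
set_option linter.unusedSectionVars false
set_option synthInstance.maxSize 2000
set_option synthInstance.maxHeartbeats 400000
section
variable {M : Type} {E : M → M → Prop} [Z : ZFM E]
noncomputable def num (E : M → M → Prop) [Z : ZFM E] : ℕ → M
  | 0 => emp E
  | n+1 => sc E (num E n)
theorem num_mem {m n : ℕ} (h : m < n) : E (num E m) (num E n) := by
  induction n with
  | zero => omega
  | succ n ih =>
    rcases Nat.lt_succ_iff_lt_or_eq.1 h with h | rfl
    · exact mem_sc.2 (Or.inl (ih h))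
    · exact mem_sc.2 (Or.inr rfl)
theorem num_inj {m n : ℕ} (h : num E m = num E n) : m = n := by
  rcases Nat.lt_trichotomy m n with h' | h' | h'
  · have := num_mem (E := E) h'; rw [h] at this; exact (irr this).elim
  · exact h'
  · have := num_mem (E := E) h'; rw [h] at this; exact (irr this).elim
def OPj (E : M → M → Prop) (V1 z1 z0 jm : M) : ℕ → M → M → M → Prop
  | 0, β, _, z => LR E z1 β z
  | 1, β, _, z => LR E z0 β z
  | 2, _, _, z => z = V1
  | 3, _, _, z => z = jm
  | n+4, _, p, z => ∃ x w, IsKPair E p x w ∧ GOp E n z x w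
def OP (E : M → M → Prop) [Z : ZFM E] (V1 z1 z0 jm : M) (β p z : M) : Prop :=
  ∃ j : Fin 14, ∃ q, p = kp E (num E j) q ∧ OPj E V1 z1 z0 jm j β q z
section
variable {n : ℕ} {t s r : (Fin n → M) → M} [DFn E t] [DFn E s] [DFn E r] {V1 z1 z0 jm : M}
instance OPj.dfn (j : ℕ) : Dfn E (fun v => OPj E V1 z1 z0 jm j (t v) (s v) (r v)) := by
  refine Dfn.sub3 (R := OPj E V1 z1 z0 jm j) ?_ t s r
  match j with
  | 0 | 1 | 2 | 3 | n+4 => unfold OPj; infer_instance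
instance OP.dfn : Dfn E (fun v => OP E V1 z1 z0 jm (t v) (s v) (r v)) := by
  refine Dfn.sub3 (R := OP E V1 z1 z0 jm) ?_ t s r
  exact Dfn.fin (R := fun (j : Fin 14) v => ∃ q, v 1 = kp E (num E j) q ∧ OPj E V1 z1 z0 jm j (v 0) q (v 2)) (fun i => inferInstance)
end
theorem lgen (R : M → Prop) [hR : Df1 E R] (z : M) (hb : ∀ t, E t z → R t) (hc : ∀ i x y z, R x → R y → GOp E i z x y → R z)
    (hL : ∀ γ l, LR E z γ l → R l) : ∀ x, WL E z x → R x := by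
  have key : ∀ γ, IsOrd E γ → ∀ l, LR E z γ l → ∀ x, E x l → R x := by
    refine ord_ind (E := E) (fun γ => ∀ l, LR E z γ l → ∀ x, E x l → R x) ?_
    intro γ hγ ih l hl x hx
    rcases ord_tri hγ with rfl | ⟨b, hb', rfl⟩ | h
    · rw [tri_zero def_tot hl] at hx; exact hb x hx
    · obtain ⟨k, hk⟩ := LR_ex (z0 := z) hb'
      obtain ⟨c, h1, h2⟩ := defset_iff.1 (tri_sc def_tot hk hl)
      have hcs := h1.2.2 (sepS E c R) (fun t ht => mem_sepS.2 ⟨h1.1 _ ht, by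
        rcases mem_sc.1 ht with h | rfl
        · exact ih b (mem_sc.2 (Or.inr rfl)) k hk t h
        · exact hL _ _ hk⟩) (gclosed_iff.2 fun i p q r hp hq hr =>
          mem_sepS.2 ⟨gclosed_iff.1 h1.2.1 i p q r (mem_sepS.1 hp).1 (mem_sepS.1 hq).1 hr, hc i p q r (mem_sepS.1 hp).2 (mem_sepS.1 hq).2 hr⟩)
      exact (mem_sepS.1 (hcs x ((h2 x).1 hx).2)).2
    · obtain ⟨c, k, h1, h2, h3⟩ := (tri_lim def_tot h hl x).1 hx
      exact ih c h1 k h2 x h3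
  rintro x ⟨a, l, h1, h2⟩; exact key a h1.1 l h1 x h2
theorem OP_f {V1 z1 z0 jm : M} (β p z z' : M) (h : OP E V1 z1 z0 jm β p z) (h' : OP E V1 z1 z0 jm β p z') : z = z' := by
  obtain ⟨⟨j, _⟩, q, rfl, h⟩ := h
  obtain ⟨⟨j', _⟩, q', e, h'⟩ := h'
  obtain ⟨e2, rfl⟩ := kp_inj.1 e
  have := num_inj e2; dsimp at this; subst this
  match j with
  | 0 => exact LR_uq h h'
  | 1 => exact LR_uq h h'
  | 2 => exact h.trans h'.symm
  | 3 => exact h.trans h'.symm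
  | n+4 =>
    obtain ⟨x, w, e, h⟩ := h; obtain ⟨x', w', e', h'⟩ := h'
    rw [isKPair_iff] at e e'; subst e
    obtain ⟨rfl, rfl⟩ := kp_inj.1 e'
    exact gop_uniq h h'
theorem gen {V1 z1 z0 jm : M} (hn : ∀ j : Fin 14, E (num E j) V1) (hz1 : ∀ t, E t z1 → E t V1 ∨ t = V1)
    (hz0 : ∀ R : M → Prop, (∀ i x y z, R x → R y → GOp E i z x y → R z) → (∀ x, E x V1 → R x) → R V1 → R jm → (∀ x, WL E z1 x → R x) → ∀ x, E x z0 → R x)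
    (hall : ∀ z, WL E z0 z) (z : M) : ∃ a u, UR E V1 (OP E V1 z1 z0 jm) a u ∧ E z u := by
  have hf := OP_f (E := E) (V1 := V1) (z1 := z1) (z0 := z0) (jm := jm)
  have h0 : E (emp E) V1 := hn 0
  have base : ∀ x, E x V1 → ∃ a u, UR E V1 (OP E V1 z1 z0 jm) a u ∧ E x u := fun x hx => by
    obtain ⟨u, hu⟩ := U_ex (E := E) (V1 := V1) hf ord_emp
    exact ⟨_, u, hu, (U_mem hf hu x).2 (Or.inl hx)⟩
  have step : ∀ (j : Fin 14) β x w k z, UR E V1 (OP E V1 z1 z0 jm) β k → E x k → E w k → OPj E V1 z1 z0 jm j β (kp E x w) z →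
      ∃ a u, UR E V1 (OP E V1 z1 z0 jm) a u ∧ E z u := fun j β x w k z hk hx hw h => by
    obtain ⟨u, hu⟩ := U_ex (E := E) (V1 := V1) hf (ord_sc hk.1)
    exact ⟨_, u, hu, (U_mem hf hu z).2 (Or.inr ⟨β, k, mem_sc.2 (Or.inr rfl), hk, num E j, x, w, hn j, hx, hw, j, _, rfl, h⟩)⟩
  have step0 : ∀ (j : Fin 14) β z, IsOrd E β → OPj E V1 z1 z0 jm j β (kp E (emp E) (emp E)) z →
      ∃ a u, UR E V1 (OP E V1 z1 z0 jm) a u ∧ E z u := fun j β z hβ h => by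
    obtain ⟨k, hk⟩ := U_ex (E := E) (V1 := V1) hf hβ
    have := (U_mem hf hk _).2 (Or.inl h0)
    exact step j β _ _ k z hk this this h
  have hc : ∀ i x y z, (∃ a u, UR E V1 (OP E V1 z1 z0 jm) a u ∧ E x u) → (∃ a u, UR E V1 (OP E V1 z1 z0 jm) a u ∧ E y u) → GOp E i z x y →
      ∃ a u, UR E V1 (OP E V1 z1 z0 jm) a u ∧ E z u := by
    rintro i x y z ⟨a, u, hu, hx⟩ ⟨b, v, hv, hy⟩ h
    obtain ⟨j, hj, h⟩ := gop_fin h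
    have : ∃ c k, UR E V1 (OP E V1 z1 z0 jm) c k ∧ E x k ∧ E y k := by
      rcases ord_lin hu.1 hv.1 with h | rfl | h
      · exact ⟨b, v, hv, U_mono hf (Or.inl h) hu hv _ hx, hy⟩
      · exact ⟨a, v, hv, U_mono hf (Or.inr rfl) hu hv _ hx, hy⟩
      · exact ⟨a, u, hu, hx, U_mono hf (Or.inl h) hv hu _ hy⟩
    obtain ⟨c, k, hk, hx, hy⟩ := this
    exact step ⟨j+4, by omega⟩ c x y k z hk hx hy ⟨x, y, isKPair_iff.2 rfl, h⟩
  have hV : ∃ a u, UR E V1 (OP E V1 z1 z0 jm) a u ∧ E V1 u := step0 2 _ _ ord_emp rfl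
  refine lgen (E := E) (fun z => ∃ a u, UR E V1 (OP E V1 z1 z0 jm) a u ∧ E z u) z0 ?_ hc (fun γ l h => step0 1 γ l h.1 h) z (hall z)
  refine hz0 _ hc base hV (step0 3 _ _ ord_emp rfl) ?_
  refine lgen (E := E) (fun z => ∃ a u, UR E V1 (OP E V1 z1 z0 jm) a u ∧ E z u) z1 ?_ hc (fun γ l h => step0 0 γ l h.1 h)
  rintro t ht
  rcases hz1 t ht with h | rfl
  · exact base t h
  · exact hV
end

set_option autoImplicit false
set_option maxHeartbeats 1000000
set_option linter.unusedSectionVars false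
set_option synthInstance.maxSize 2000
set_option synthInstance.maxHeartbeats 400000
section
variable {M : Type} {E : M → M → Prop} [Z : ZFM E]
noncomputable def pwn (E : M → M → Prop) [Z : ZFM E] : ℕ → M → M
  | 0, V => V
  | n+1, V => pwn E n (pw E V)
theorem pw_tr {V : M} (h : TransSet E V) : TransSet E (pw E V) := fun _ hy _ hz => mem_pw.2 (h _ (mem_pw.1 hy _ hz))
theorem pw_sub {V : M} (h : TransSet E V) : SubsetE E V (pw E V) := fun y hy => mem_pw.2 (h y hy)
theorem pwn_tr (k : ℕ) : ∀ {V : M}, TransSet E V → TransSet E (pwn E k V) ∧ SubsetE E V (pwn E k V) := by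
  induction k with
  | zero => exact fun h => ⟨h, fun _ h => h⟩
  | succ k ih => exact fun h => ⟨(ih (pw_tr h)).1, fun y hy => (ih (pw_tr h)).2 y (pw_sub h y hy)⟩
theorem pwn_sc (k : ℕ) : ∀ {V : M}, pwn E (k+1) V = pw E (pwn E k V) := by
  induction k with
  | zero => intro V; rfl
  | succ k ih => intro V; exact ih
theorem oi_le (k : ℕ) : ∀ {x s : M}, IsOrd E s → OrdIter E k x s → E x s ∨ x = s := by
  induction k with
  | zero => exact fun _ h => Or.inr h
  | succ k ih =>
    rintro x s hs ⟨y, hy, h⟩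
    rw [isSuccOf_iff] at hy; subst hy
    refine Or.inl ?_
    rcases ih hs h with h | rfl
    · exact hs.1 _ h _ (mem_sc.2 (Or.inr rfl))
    · exact mem_sc.2 (Or.inr rfl)
theorem oi_sc (k : ℕ) : ∀ {x s t : M}, OrdIter E k x s → OrdIter E 1 s t → OrdIter E (k+1) x t := by
  induction k with
  | zero => rintro x s t rfl h; exact h
  | succ k ih => rintro x s t ⟨y, hy, h⟩ h'; exact ⟨y, hy, ih h h'⟩
theorem oi_lim (k : ℕ) {h : M} (hh : IsLimitOrd E h) : ∀ {x s : M}, OrdIter E k x s → (E h s ∨ h = s) → (E h x ∨ h = x) := by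
  induction k with
  | zero => rintro x s rfl h; exact h
  | succ k ih =>
    rintro x s ⟨y, hy, h1⟩ h2
    rw [isSuccOf_iff] at hy; subst hy
    rcases ih h1 h2 with h | h
    · exact mem_sc.1 h
    · exact (lim_ne_sc hh h).elim
section
variable {H a : M} (hH : IsVHier E H a)
include hH
theorem vh_mem {b w : M} (h : E (kp E b w) H) (x : M) : E x w ↔ ∃ c u, E c b ∧ E (kp E c u) H ∧ SubsetE E x u := by
  have := hH.2.2.2 b w (pairIn_iff.2 h) x
  simpa only [pairIn_iff] using this
theorem vh_dom {b w : M} (h : E (kp E b w) H) : IsOrd E b := by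
  rcases (hH.2.2.1 b).1 ⟨w, pairIn_iff.2 h⟩ with h | rfl
  · exact ord_mem hH.1 h
  · exact hH.1
theorem vh_dn {b c w : M} (h : E (kp E b w) H) (hc : E c b) : ∃ u, E (kp E c u) H := by
  have : E c a := by
    rcases (hH.2.2.1 b).1 ⟨w, pairIn_iff.2 h⟩ with h | rfl
    · exact hH.1.1 _ h _ hc
    · exact hc
  obtain ⟨u, hu⟩ := (hH.2.2.1 c).2 (Or.inl this); exact ⟨u, pairIn_iff.1 hu⟩
theorem vh_mono {b c w u : M} (h : E (kp E b w) H) (h' : E (kp E c u) H) (hc : E c b) : SubsetE E u w := fun x hx => by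
  obtain ⟨d, t, h1, h2, h3⟩ := (vh_mem hH h' x).1 hx
  exact (vh_mem hH h x).2 ⟨d, t, (vh_dom hH h).1 _ hc _ h1, h2, h3⟩
theorem vh_tr {b w : M} (h : E (kp E b w) H) : TransSet E w := fun x hx y hy => by
  obtain ⟨d, t, h1, h2, h3⟩ := (vh_mem hH h x).1 hx
  exact vh_mono hH h h2 h1 _ (h3 _ hy)
theorem vh_sc {b w u : M} (h : E (kp E b u) H) (h' : E (kp E (sc E b) w) H) : w = pw E u :=
  ext (E := E) fun x => by
    rw [vh_mem hH h', mem_pw (E := E)]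
    constructor
    · rintro ⟨c, t, h1, h2, h3⟩
      rcases mem_sc.1 h1 with h1 | rfl
      · exact fun y hy => vh_mono hH h h2 h1 _ (h3 y hy)
      · rw [hH.2.1.2 _ _ _ (pairIn_iff.2 h) (pairIn_iff.2 h2)]; exact h3
    · exact fun hx => ⟨b, u, mem_sc.2 (Or.inr rfl), h, hx⟩
theorem vh_ord {b w : M} (h : E (kp E b w) H) : SubsetE E b w := by
  have := ord_ind (E := E) (fun b => ∀ w, E (kp E b w) H → SubsetE E b w) (fun b _ ih w hw c hc => by
    obtain ⟨u, hu⟩ := vh_dn hH hw hc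
    exact (vh_mem hH hw c).2 ⟨c, u, hc, hu, ih c hc u hu⟩)
  exact this b (vh_dom hH h) w h
theorem vh_upr {b w : M} (hb : IsLimitOrd E b) (h : E (kp E b w) H) {x y : M} (hx : E x w) (hy : E y w) : E (upr E x y) w := by
  obtain ⟨c, u, h1, h2, h3⟩ := (vh_mem hH h x).1 hx
  obtain ⟨c', u', h1', h2', h3'⟩ := (vh_mem hH h y).1 hy
  have : ∃ e t, E e b ∧ E (kp E e t) H ∧ SubsetE E x t ∧ SubsetE E y t := by
    rcases ord_lin (vh_dom hH h2) (vh_dom hH h2') with g | rfl | g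
    · exact ⟨c', u', h1', h2', fun z hz => vh_mono hH h2' h2 g _ (h3 z hz), h3'⟩
    · rw [hH.2.1.2 _ _ _ (pairIn_iff.2 h2') (pairIn_iff.2 h2)] at h3'; exact ⟨c, u, h1, h2, h3, h3'⟩
    · exact ⟨c, u, h1, h2, h3, fun z hz => vh_mono hH h2 h2' g _ (h3' z hz)⟩
  obtain ⟨e, t, g1, g2, g3, g4⟩ := this
  have g5 := (isLimitOrd_iff.1 hb).2.2 _ g1
  obtain ⟨s, hs⟩ := vh_dn hH h g5
  refine (vh_mem hH h _).2 ⟨_, s, g5, hs, fun z hz => ?_⟩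
  rw [vh_sc hH g2 hs, mem_pw (E := E)]
  rcases mem_upr.1 hz with rfl | rfl <;> assumption
theorem vh_pwn (k : ℕ) : ∀ {b u w : M}, OrdIter E k b a → E (kp E b u) H → E (kp E a w) H → w = pwn E k u := by
  induction k with
  | zero => rintro b u w rfl h h'; exact hH.2.1.2 _ _ _ (pairIn_iff.2 h') (pairIn_iff.2 h)
  | succ k ih =>
    rintro b u w ⟨y, hy, h1⟩ h h'
    rw [isSuccOf_iff] at hy; subst hy
    obtain ⟨t, ht⟩ := (hH.2.2.1 _).2 (oi_le k hH.1 h1)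
    rw [pairIn_iff] at ht
    rw [ih h1 ht h', vh_sc hH h ht]; rfl
end
theorem vdata {l v1 h : M} (hev : IsEvenOrd E l) (hv1 : VAt E l 1 v1) (hh : IsLimitOrd E h) (hhle : E h l ∨ h = l) :
    ∃ η V0 n, IsLimitOrd E η ∧ (E h η ∨ h = η) ∧ TransSet E V0 ∧ (∀ x y, E x V0 → E y V0 → E (kp E x y) V0) ∧ SubsetE E η V0 ∧
      v1 = pwn E (n+1) V0 := by
  obtain ⟨η, n, h1, h2⟩ := hev
  obtain ⟨s, hs, H, hH, hp⟩ := hv1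
  rw [pairIn_iff] at hp
  have h3 := oi_lim _ hh h2 hhle
  have h4 : IsLimitOrd E η := h1.resolve_left fun h0 => by
    rw [isZero_iff] at h0; subst h0
    rcases h3 with h | h
    · exact mem_emp h
    · exact lim_ne_emp hh h
  have h5 := oi_sc _ h2 hs
  obtain ⟨V0, hV⟩ := (hH.2.2.1 η).2 (oi_le _ hH.1 h5)
  rw [pairIn_iff] at hV
  exact ⟨η, V0, 2*n, h4, h3, vh_tr hH hV, fun x y hx hy => vh_upr hH h4 hV (vh_upr hH h4 hV hx hx) (vh_upr hH h4 hV hx hy),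
    vh_ord hH hV, vh_pwn hH _ h5 hV hp⟩
def Cdg (E : M → M → Prop) [Z : ZFM E] (η V c : M) : Prop :=
  (∀ ξ z, E ξ η → E z V → ∃ w, E w V ∧ E (kp E (kp E ξ z) w) c) ∧
  ∀ ξ z ξ' z' w, E (kp E (kp E ξ z) w) c → E (kp E (kp E ξ' z') w) c → ξ = ξ' ∧ z = z'
theorem cod0 {η V : M} (hs : SubsetE E η V) (hp : ∀ x y, E x V → E y V → E (kp E x y) V) : ∃ c, Cdg E η V c := by
  refine ⟨sepS E (prd E V V) (fun t => ∃ p, t = kp E p p), fun ξ z h1 h2 => ⟨_, hp _ _ (hs _ h1) h2, mem_sepS.2 ⟨?_, _, rfl⟩⟩, ?_⟩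
  · exact kp_mem_prd.2 ⟨hp _ _ (hs _ h1) h2, hp _ _ (hs _ h1) h2⟩
  · intro ξ z ξ' z' w h1 h2
    obtain ⟨_, p, e⟩ := mem_sepS.1 h1
    obtain ⟨_, q, e'⟩ := mem_sepS.1 h2
    rw [kp_inj] at e e'
    exact kp_inj.1 (e.1.trans (e.2.symm.trans (e'.2.trans e'.1.symm)))
def CB (E : M → M → Prop) [Z : ZFM E] (c ξ A w : M) : Prop :=
  (∃ z u, E z A ∧ E (kp E (kp E ξ z) u) c ∧ E (kp E (kp E (num E 0) u) w) c) ∨ ∃ u, E (kp E (kp E ξ (emp E)) u) c ∧ E (kp E (kp E (num E 1) u) w) c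
instance CB.dfn {n : ℕ} {t s r q : (Fin n → M) → M} [DFn E t] [DFn E s] [DFn E r] [DFn E q] : Dfn E (fun v => CB E (t v) (s v) (r v) (q v)) :=
  Dfn.sub4 (by unfold CB; infer_instance) t s r q
theorem cod1 {η V c : M} (h0 : E (num E 0) η) (h1 : E (num E 1) η) (he : E (emp E) V) (h : Cdg E η V c) : ∃ c', Cdg E η (pw E V) c' := by
  have hm : ∀ ξ A B, E (kp E (kp E ξ A) B) (sepS E (prd E (prd E η (pw E V)) (pw E V)) (fun t => ∃ ξ A B, t = kp E (kp E ξ A) B ∧ ∀ w, E w B ↔ E w V ∧ CB E c ξ A w))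
      ↔ (E ξ η ∧ SubsetE E A V) ∧ ∀ w, E w B ↔ E w V ∧ CB E c ξ A w := by
    intro ξ A B
    rw [mem_sepS (E := E), kp_mem_prd (E := E), kp_mem_prd (E := E), mem_pw (E := E), mem_pw (E := E)]
    constructor
    · rintro ⟨g, ξ', A', B', e, h⟩
      simp only [kp_inj] at e
      obtain ⟨⟨rfl, rfl⟩, rfl⟩ := e
      exact ⟨g.1, h⟩
    · rintro ⟨g, h⟩; exact ⟨⟨g, fun w hw => ((h w).1 hw).1⟩, ξ, A, B, rfl, h⟩
  refine ⟨_, fun ξ A h1 h2 => ⟨sepS E V (CB E c ξ A), mem_pw.2 fun w hw => (mem_sepS.1 hw).1, (hm _ _ _).2 ⟨⟨h1, mem_pw.1 h2⟩, fun w => mem_sepS⟩⟩, ?_⟩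
  intro ξ A ξ' A' B g g'
  obtain ⟨⟨a1, a2⟩, a3⟩ := (hm _ _ _).1 g
  obtain ⟨⟨b1, b2⟩, b3⟩ := (hm _ _ _).1 g'
  have ne : num E 0 ≠ num E 1 := fun h => by have := num_inj h; omega
  have eξ : ξ = ξ' := by
    obtain ⟨u, hu, hu'⟩ := h.1 ξ _ a1 he
    obtain ⟨w, hw, hw'⟩ := h.1 _ u h1 hu
    rcases ((b3 w).1 ((a3 w).2 ⟨hw, Or.inr ⟨u, hu', hw'⟩⟩)).2 with ⟨z, u2, _, _, k⟩ | ⟨u2, k1, k2⟩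
    · exact (ne (h.2 _ _ _ _ _ k hw').1).elim
    · have := (h.2 _ _ _ _ _ k2 hw').2; subst this
      exact (h.2 _ _ _ _ _ hu' k1).1
  subst eξ
  have key : ∀ A A', SubsetE E A V → (∀ w, E w B ↔ E w V ∧ CB E c ξ A w) → (∀ w, E w B ↔ E w V ∧ CB E c ξ A' w) → ∀ z, E z A → E z A' := by
    intro A A' a2 a3 b3 z hz
    obtain ⟨u, hu, hu'⟩ := h.1 ξ _ a1 (a2 _ hz)
    obtain ⟨w, hw, hw'⟩ := h.1 _ u h0 hu
    rcases ((b3 w).1 ((a3 w).2 ⟨hw, Or.inl ⟨z, u, hz, hu', hw'⟩⟩)).2 with ⟨z', u2, k0, k1, k2⟩ | ⟨u2, _, k⟩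
    · have := (h.2 _ _ _ _ _ k2 hw').2; subst this
      rw [(h.2 _ _ _ _ _ hu' k1).2]; exact k0
    · exact (ne (h.2 _ _ _ _ _ hw' k).1).elim
  exact ⟨rfl, ext (E := E) fun z => ⟨key A A' a2 a3 b3 z, key A' A b2 b3 a3 z⟩⟩
theorem codn {η : M} (h0 : E (num E 0) η) (h1 : E (num E 1) η) (k : ℕ) : ∀ {V : M}, E (emp E) V → (∃ c, Cdg E η V c) → ∃ c, Cdg E η (pwn E k V) c := by
  induction k with
  | zero => exact fun _ h => h
  | succ k ih => rintro V he ⟨c, h⟩; exact ih (mem_pw.2 fun z hz => (mem_emp hz).elim) (cod1 h0 h1 he h)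
/-- pairing on the power set -/
def PP (E : M → M → Prop) [Z : ZFM E] (V c y a b : M) : Prop := (∀ z, E z a ↔ E z V ∧ ∃ w, E w y ∧ E (kp E (kp E (num E 0) z) w) c) ∧
  ∀ z, E z b ↔ E z V ∧ ∃ w, E w y ∧ E (kp E (kp E (num E 1) z) w) c
instance PP.dfn {n : ℕ} {t s r : (Fin n → M) → M} [DFn E t] [DFn E s] [DFn E r] {V c : M} : Dfn E (fun v => PP E V c (t v) (s v) (r v)) :=
  Dfn.sub3 (by unfold PP; infer_instance) t s r
theorem PP_f {V c : M} (y a b a' b' : M) (h : PP E V c y a b) (h' : PP E V c y a' b') : a = a' ∧ b = b' :=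
  ⟨ext (E := E) fun z => by rw [h.1, h'.1], ext (E := E) fun z => by rw [h.2, h'.2]⟩
theorem PP_s {η V c : M} (h0 : E (num E 0) η) (h1 : E (num E 1) η) (h : Cdg E η V c) (a b : M) (ha : E a (pw E V)) (hb : E b (pw E V)) :
    ∃ y, E y (pw E V) ∧ PP E V c y a b := by
  rw [mem_pw (E := E)] at ha hb
  have ne : num E 0 ≠ num E 1 := fun h => by have := num_inj h; omega
  refine ⟨sepS E V (fun w => (∃ z, E z a ∧ E (kp E (kp E (num E 0) z) w) c) ∨ ∃ z, E z b ∧ E (kp E (kp E (num E 1) z) w) c),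
    mem_pw.2 fun w hw => (mem_sepS.1 hw).1, fun z => ⟨fun hz => ⟨ha _ hz, ?_⟩, ?_⟩, fun z => ⟨fun hz => ⟨hb _ hz, ?_⟩, ?_⟩⟩
  · obtain ⟨w, hw, hw'⟩ := h.1 _ z h0 (ha _ hz)
    exact ⟨w, mem_sepS.2 ⟨hw, Or.inl ⟨z, hz, hw'⟩⟩, hw'⟩
  · rintro ⟨_, w, hw, g⟩
    rcases (mem_sepS.1 hw).2 with ⟨z', k, k'⟩ | ⟨z', k, k'⟩
    · rw [(h.2 _ _ _ _ _ g k').2]; exact k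
    · exact (ne (h.2 _ _ _ _ _ g k').1).elim
  · obtain ⟨w, hw, hw'⟩ := h.1 _ z h1 (hb _ hz)
    exact ⟨w, mem_sepS.2 ⟨hw, Or.inr ⟨z, hz, hw'⟩⟩, hw'⟩
  · rintro ⟨_, w, hw, g⟩
    rcases (mem_sepS.1 hw).2 with ⟨z', k, k'⟩ | ⟨z', k, k'⟩
    · exact (ne (h.2 _ _ _ _ _ k' g).1).elim
    · rw [(h.2 _ _ _ _ _ g k').2]; exact k
end

set_option autoImplicit false
set_option maxHeartbeats 1000000
set_option linter.unusedSectionVars false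
set_option synthInstance.maxSize 2000
set_option synthInstance.maxHeartbeats 400000
section
variable {M : Type} {E : M → M → Prop} [Z : ZFM E]
def Ext1 (E : M → M → Prop) (s g : M) : Prop := ∃ d e, IsSuccOf E d e ∧ IsFuncOn E g e ∧ IsRestrOfFn E g d s
instance Ext1.dfn {n : ℕ} {t s : (Fin n → M) → M} [DFn E t] [DFn E s] : Dfn E (fun v => Ext1 E (t v) (s v)) :=
  Dfn.sub2 (by unfold Ext1; infer_instance) t s
def KP (E : M → M → Prop) [Z : ZFM E] (K T V1 : M) : Prop :=
  (∀ s y g, E (kp E s (kp E y g)) K → E s T ∧ E y V1 ∧ E g T ∧ Ext1 E s g) ∧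
  (∀ s y g g', E (kp E s (kp E y g)) K → E (kp E s (kp E y g')) K → g = g') ∧
  ∀ s g, E s T → E g T → Ext1 E s g → ∃ y g', E (kp E s (kp E y g')) K
theorem kEx {T V1 S : M} (h1 : ∀ A y z, E (kp E A (kp E y z)) S → E y V1 ∧ E z A)
    (h2 : ∀ A y z z', E (kp E A (kp E y z)) S → E (kp E A (kp E y z')) S → z = z')
    (h3 : ∀ A, SubsetE E A T → (∃ x, E x A) → ∃ y z, E (kp E A (kp E y z)) S) : ∃ K, KP E K T V1 := by
  have hm : ∀ s y g, E (kp E s (kp E y g)) (sepS E (prd E T (prd E V1 T)) (fun p => ∃ s y g A, p = kp E s (kp E y g) ∧ (∀ g', E g' A ↔ E g' T ∧ Ext1 E s g') ∧ E (kp E A (kp E y g)) S))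
      ↔ (E s T ∧ E y V1 ∧ E g T) ∧ ∃ A, (∀ g', E g' A ↔ E g' T ∧ Ext1 E s g') ∧ E (kp E A (kp E y g)) S := by
    intro s y g
    rw [mem_sepS (E := E), kp_mem_prd (E := E), kp_mem_prd (E := E)]
    refine and_congr_right fun _ => ⟨?_, ?_⟩
    · rintro ⟨s', y', g', A, e, h⟩
      simp only [kp_inj] at e
      obtain ⟨rfl, rfl, rfl⟩ := e; exact ⟨A, h⟩
    · rintro ⟨A, h⟩; exact ⟨s, y, g, A, rfl, h⟩
  generalize sepS E (prd E T (prd E V1 T)) (fun p => ∃ s y g A, p = kp E s (kp E y g) ∧ (∀ g', E g' A ↔ E g' T ∧ Ext1 E s g') ∧ E (kp E A (kp E y g)) S) = K at hm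
  refine ⟨K, fun s y g h => ?_, fun s y g g' h h' => ?_, fun s g hs hg he => ?_⟩
  · obtain ⟨⟨g1, g2, g3⟩, A, g4, g5⟩ := (hm _ _ _).1 h
    exact ⟨g1, g2, g3, ((g4 _).1 (h1 _ _ _ g5).2).2⟩
  · obtain ⟨_, A, g4, g5⟩ := (hm _ _ _).1 h
    obtain ⟨_, A', g4', g5'⟩ := (hm _ _ _).1 h'
    have : A = A' := ext (E := E) fun z => by rw [g4, g4']
    subst this; exact h2 _ _ _ _ g5 g5'
  · have m : ∀ g', E g' (sepS E T (Ext1 E s)) ↔ E g' T ∧ Ext1 E s g' := fun g' => mem_sepS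
    obtain ⟨y, z, hk⟩ := h3 (sepS E T (Ext1 E s)) (fun z hz => ((m z).1 hz).1) ⟨g, (m g).2 ⟨hg, he⟩⟩
    have := h1 _ _ _ hk
    exact ⟨y, z, (hm _ _ _).2 ⟨⟨hs, this.1, ((m z).1 this.2).1⟩, _, m, hk⟩⟩
def Mt (E : M → M → Prop) [Z : ZFM E] (K β t b : M) : Prop := ∀ ζ, E ζ β → ∃ r g y, IsRestrOfFn E t ζ r ∧ IsRestrOfFn E t (sc E ζ) g ∧ E (kp E ζ y) b ∧ E (kp E r (kp E y g)) K
instance Mt.dfn {n : ℕ} {t s r q : (Fin n → M) → M} [DFn E t] [DFn E s] [DFn E r] [DFn E q] : Dfn E (fun v => Mt E (t v) (s v) (r v) (q v)) :=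
  Dfn.sub4 (by unfold Mt; infer_instance) t s r q
theorem restr_rr {t b s c r : M} (h : IsRestrOfFn E t b s) (hc : SubsetE E c b) : IsRestrOfFn E s c r ↔ IsRestrOfFn E t c r := by
  rw [restr_iff] at h; rw [restr_iff, restr_iff]
  simp only [h.2]
  exact and_congr_right fun _ => forall₂_congr fun x y => by
    constructor
    · intro k; rw [k]; exact ⟨fun g => ⟨g.1, g.2.2⟩, fun g => ⟨g.1, hc _ g.1, g.2⟩⟩
    · intro k; rw [k]; exact ⟨fun g => ⟨g.1, hc _ g.1, g.2⟩, fun g => ⟨g.1, g.2.2⟩⟩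
theorem restr_self {t b : M} (h : IsFuncOn E t b) : IsRestrOfFn E t b t :=
  restr_iff.2 ⟨h, fun _ _ => ⟨fun g => ⟨fun_dom h g, g⟩, fun g => g.2⟩⟩
theorem sc_sub {ζ b : M} (hb : IsOrd E b) (h : E ζ b) : SubsetE E ζ b ∧ SubsetE E (sc E ζ) b :=
  ⟨hb.1 _ h, fun x hx => by
    rcases mem_sc.1 hx with h' | rfl
    · exact hb.1 _ h _ h'
    · exact h⟩
theorem mt_restr {K β γ t s b b' : M} (h : Mt E K β t b) (hγ : IsOrd E γ) (hs : SubsetE E γ β) (ht : IsRestrOfFn E t γ s)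
    (hb : ∀ ζ y, E ζ γ → E (kp E ζ y) b → E (kp E ζ y) b') : Mt E K γ s b' := fun ζ hζ => by
  obtain ⟨r, g, y, h1, h2, h3, h4⟩ := h ζ (hs _ hζ)
  have := sc_sub hγ hζ
  exact ⟨r, g, y, (restr_rr ht this.1).2 h1, (restr_rr ht this.2).2 h2, hb _ _ hζ h3, h4⟩
section
variable {K T V1 : M} (hK : KP E K T V1)
include hK
theorem mt_uq {β a b t s : M} (hβ : IsOrd E β) (hb : IsFuncOn E b a) (ht : IsFuncOn E t β) (hs : IsFuncOn E s β)
    (h : Mt E K β t b) (h' : Mt E K β s b) : t = s := by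
  have key : ∀ ζ, IsOrd E ζ → E ζ β → ∀ y, E (kp E ζ y) t ↔ E (kp E ζ y) s := by
    refine ord_ind (E := E) (fun ζ => E ζ β → ∀ y, E (kp E ζ y) t ↔ E (kp E ζ y) s) ?_
    intro ζ hζ ih hζβ y
    obtain ⟨r, g, z, h1, h2, h3, h4⟩ := h ζ hζβ
    obtain ⟨r', g', z', h1', h2', h3', h4'⟩ := h' ζ hζβ
    rw [restr_iff] at h1 h2 h1' h2'
    have := fun_uniq hb h3 h3'; subst this
    have : r = r' := fun_ext h1.1 h1'.1 fun x y => by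
      rw [h1.2, h1'.2]
      exact and_congr_right fun hx => ih x hx (hβ.1 _ hζβ _ hx) y
    subst this
    have := hK.2.1 _ _ _ _ h4 h4'; subst this
    have e1 := h2.2 ζ y; have e2 := h2'.2 ζ y
    have m : E ζ (sc E ζ) := mem_sc.2 (Or.inr rfl)
    exact ⟨fun k => (e2.1 (e1.2 ⟨m, k⟩)).2, fun k => (e1.1 (e2.2 ⟨m, k⟩)).2⟩
  exact fun_ext ht hs fun x y => ⟨fun k => (key x (ord_mem hβ (fun_dom ht k)) (fun_dom ht k) y).1 k,
    fun k => (key x (ord_mem hβ (fun_dom hs k)) (fun_dom hs k) y).2 k⟩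
theorem limF {a b : M} (ha : IsOrd E a) (hb : IsFuncOn E b a)
    (h : ∀ ζ, E ζ a → ∃ t, E t T ∧ IsFuncOn E t (sc E ζ) ∧ Mt E K (sc E ζ) t b) :
    ∃ f, IsFuncOn E f a ∧ Mt E K a f b := by
  obtain ⟨f, hf, hf2⟩ := fn_mk (E := E) a (fun ζ x => ∃ t, E t T ∧ IsFuncOn E t (sc E ζ) ∧ Mt E K (sc E ζ) t b ∧ E (kp E ζ x) t) (fun ζ hζ => by
    obtain ⟨t, h1, h2, h3⟩ := h ζ hζ
    obtain ⟨x, hx⟩ := fun_val h2 (mem_sc.2 (Or.inr rfl))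
    refine ⟨x, ⟨t, h1, h2, h3, hx⟩, ?_⟩
    rintro x' ⟨t', _, h2', h3', hx'⟩
    have := mt_uq hK (ord_sc (ord_mem ha hζ)) hb h2 h2' h3 h3'; subst this
    exact fun_uniq h2 hx' hx)
  refine ⟨f, hf, fun ζ hζ => ?_⟩
  obtain ⟨t, h1, h2, h3⟩ := h ζ hζ
  have hoz := ord_sc (ord_mem ha hζ)
  have hft : IsRestrOfFn E f (sc E ζ) t := by
    refine restr_iff.2 ⟨h2, fun ξ x => ?_⟩
    have val : ∀ ξ, E ξ (sc E ζ) → ∀ x, E (kp E ξ x) f → E (kp E ξ x) t := by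
      intro ξ hξ x hx
      obtain ⟨_, t', k1, k2, k3, k4⟩ := (hf2 ξ x).1 hx
      have hsc := sc_sub hoz hξ
      obtain ⟨r, hr⟩ := restr_ex h2 hsc.2
      have := mt_uq hK (ord_sc (ord_mem hoz hξ)) hb k2 (restr_iff.1 hr).1 k3
        (mt_restr h3 (ord_sc (ord_mem hoz hξ)) hsc.2 hr (fun _ _ _ h => h))
      subst this
      exact ((restr_iff.1 hr).2 _ _ |>.1 k4).2
    constructor
    · intro k
      have hξ := fun_dom h2 k
      obtain ⟨x', hx'⟩ := fun_val hf ((sc_sub ha hζ).2 _ hξ)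
      rw [fun_uniq h2 k (val ξ hξ _ hx')]; exact ⟨hξ, hx'⟩
    · exact fun k => val ξ k.1 x k.2
  obtain ⟨r, g, y, g1, g2, g3, g4⟩ := h3 ζ (mem_sc.2 (Or.inr rfl))
  exact ⟨r, g, y, (restr_rr hft (fun _ h => mem_sc.2 (Or.inl h))).1 g1, (restr_rr hft (fun _ h => h)).1 g2, g3, g4⟩
theorem treeDC {h X : M} (hT : IsTreeOn E T h X) (hh : IsLimitOrd E h) (hDC : DCAt E h) : (∃ t, E t T ∧ IsMaxBranch E T h X t) ∨
    ∃ a b, IsOrd E a ∧ (E a h ∨ a = h) ∧ (IsZero E a ∨ IsLimitOrd E a) ∧ MapsTo E b a V1 ∧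
      (∀ ζ, E ζ a → ∃ t, E t T ∧ IsFuncOn E t (sc E ζ) ∧ Mt E K (sc E ζ) t b) ∧ ∀ f, E f T → IsFuncOn E f a → ¬ Mt E K a f b := by
  have hm : ∀ t', E t' (sepS E (pw E (prd E h V1)) (fun t' => ∃ β t, E β h ∧ MapsTo E t' β V1 ∧ E t T ∧ IsFuncOn E t β ∧ Mt E K β t t')) ↔
      ∃ β t, E β h ∧ MapsTo E t' β V1 ∧ E t T ∧ IsFuncOn E t β ∧ Mt E K β t t' := fun t' => by
    rw [mem_sepS (E := E), mem_pw (E := E)]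
    refine ⟨fun h => h.2, fun g => ⟨?_, g⟩⟩
    obtain ⟨β, t, h1, h2, _⟩ := g
    intro p hp
    obtain ⟨x, y, e⟩ := h2.1.1.1 p hp
    rw [isKPair_iff] at e; subst e
    exact kp_mem_prd.2 ⟨hh.1.1 _ h1 _ (fun_dom h2.1 hp), h2.2 x y (pairIn_iff.2 hp)⟩
  generalize sepS E (pw E (prd E h V1)) (fun t' => ∃ β t, E β h ∧ MapsTo E t' β V1 ∧ E t T ∧ IsFuncOn E t β ∧ Mt E K β t t') = T' at hm
  have hT' : IsTreeOn E T' h V1 := by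
    refine ⟨fun f hf => ?_, fun f d b r hf hd hb hr => ?_⟩
    · obtain ⟨β, t, h1, h2, _⟩ := (hm f).1 hf
      exact ⟨β, ord_mem hh.1 h1, h1, h2⟩
    · obtain ⟨β, t, h1, h2, h3, h4, h5⟩ := (hm f).1 hf
      have := dom_uniq hd h2.1; subst this
      have hd := ord_mem hh.1 h1
      obtain ⟨s, hs⟩ := restr_ex h4 (hd.1 _ hb)
      refine (hm r).2 ⟨b, s, hh.1.1 _ h1 _ hb, ⟨hr.1, fun x y hxy => h2.2 x y ((hr.2 x y).1 hxy).2⟩, hT.2 t d b s h3 h4 hb hs, hs.1, ?_⟩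
      exact mt_restr h5 (ord_mem hd hb) (hd.1 _ hb) hs fun ζ y hζ hy => ((restr_iff.1 hr).2 _ _).2 ⟨hζ, hy⟩
  obtain ⟨b, _, a, ha, hah, hba, hcase⟩ := hDC V1 T' trivial trivial hT'
  rcases hcase with ⟨hbT, hno⟩ | ⟨hlim, hbT, hres⟩
  · left
    obtain ⟨β, t, h1, h2, h3, h4, h5⟩ := (hm b).1 hbT
    have := dom_uniq hba.1 h2.1; subst this
    obtain ⟨β, _, _, ht⟩ := hT.1 t h3
    have := dom_uniq h4 ht.1; subst this
    refine ⟨t, h3, a, ha, hah, ht, Or.inl ⟨h3, ?_⟩⟩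
    rintro ⟨g, dg, hg, hgd, had, hgr⟩
    have hodg : IsOrd E dg := by
      obtain ⟨e, he, _, hm⟩ := hT.1 g hg
      rw [dom_uniq hgd hm.1]; exact he
    obtain ⟨g2, hg2⟩ := restr_ex hgd (sc_sub hodg had).2
    have hg2T : E g2 T := by
      rcases ord_lin (ord_sc ha) hodg with k | k | k
      · exact hT.2 g dg _ g2 hg hgd k hg2
      · rw [k] at hg2; rw [restr_uniq hg2 (restr_self hgd)]; exact hg
      · rcases mem_sc.1 k with k | rfl
        · exact (asym k had).elim
        · exact (irr had).elim
    obtain ⟨y, g3, hk⟩ := hK.2.2 t g2 h3 hg2T ⟨a, sc E a, isSuccOf_iff.2 rfl, hg2.1, (restr_rr hg2 fun _ h => mem_sc.2 (Or.inl h)).2 hgr⟩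
    obtain ⟨_, hy, hg3, d, e, hde, he, hd⟩ := hK.1 _ _ _ hk
    rw [isSuccOf_iff] at hde; subst hde
    have := dom_uniq h4 hd.1; subst this
    have has : E a (sc E a) := mem_sc.2 (Or.inr rfl)
    obtain ⟨b2, hb2, hb2'⟩ := fn_mk (E := E) (sc E a) (fun x z => E (kp E x z) b ∨ (x = a ∧ z = y)) (fun x hx => by
      rcases mem_sc.1 hx with k | rfl
      · obtain ⟨z, hz⟩ := fun_val hba.1 k
        refine ⟨z, Or.inl hz, ?_⟩
        rintro z' (hz' | ⟨rfl, _⟩)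
        · exact fun_uniq hba.1 hz' hz
        · exact (irr k).elim
      · refine ⟨y, Or.inr ⟨rfl, rfl⟩, ?_⟩
        rintro z' (hz' | ⟨_, h⟩)
        · exact (irr (fun_dom hba.1 hz')).elim
        · exact h)
    have hb2b : ∀ x z, E x a → (E (kp E x z) b2 ↔ E (kp E x z) b) := fun x z hx => by
      rw [hb2']
      refine ⟨?_, fun k => ⟨mem_sc.2 (Or.inl hx), Or.inl k⟩⟩
      rintro ⟨_, k | ⟨rfl, _⟩⟩
      · exact k
      · exact (irr hx).elim
    refine hno ⟨b2, sc E a, (hm b2).2 ⟨sc E a, g3, (isLimitOrd_iff.1 hh).2.2 a h1, ⟨hb2, fun x z k => ?_⟩, hg3, he, fun ζ hζ => ?_⟩, hb2, has,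
      restr_iff.2 ⟨hba.1, fun x z => ⟨fun k => ⟨fun_dom hba.1 k, (hb2b x z (fun_dom hba.1 k)).2 k⟩, fun k => (hb2b x z k.1).1 k.2⟩⟩⟩
    · rw [pairIn_iff, hb2'] at k
      rcases k.2 with k | ⟨_, rfl⟩
      · exact hba.2 x z (pairIn_iff.2 k)
      · exact hy
    · rcases mem_sc.1 hζ with hζ | rfl
      · obtain ⟨r, g, z, k1, k2, k3, k4⟩ := h5 ζ hζ
        have := sc_sub ha hζ
        exact ⟨r, g, z, (restr_rr hd this.1).1 k1, (restr_rr hd this.2).1 k2, (hb2b _ _ hζ).2 k3, k4⟩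
      · exact ⟨t, g3, y, hd, restr_self he, (hb2' _ _).2 ⟨has, Or.inr ⟨rfl, rfl⟩⟩, hk⟩
  · right
    refine ⟨a, b, ha, hah, hlim, hba, fun ζ hζ => ?_, fun f hf hfa hfm => hbT ?_⟩
    · have hl : IsLimitOrd E a := hlim.resolve_left fun h0 => by rw [isZero_iff] at h0; subst h0; exact mem_emp hζ
      obtain ⟨r, hr, hr2⟩ := hres _ ((isLimitOrd_iff.1 hl).2.2 ζ hζ)
      obtain ⟨β, t, h1, h2, h3, h4, h5⟩ := (hm r).1 hr
      have := dom_uniq hr2.1 h2.1; subst this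
      exact ⟨t, h3, h4, mt_restr h5 (ord_mem hh.1 h1) (fun _ h => h) (restr_self h4) fun ζ y _ k => (((restr_iff.1 hr2).2 _ _).1 k).2⟩
    · obtain ⟨e, _, he, hm2⟩ := hT.1 f hf
      have := dom_uniq hfa hm2.1; subst this
      exact (hm b).2 ⟨a, f, he, hba, hf, hfa, hfm⟩
end
end

set_option autoImplicit false
set_option maxHeartbeats 1000000
set_option linter.unusedSectionVars false
set_option synthInstance.maxSize 2000
set_option synthInstance.maxHeartbeats 400000
section
variable {M : Type} {E : M → M → Prop} [Z : ZFM E]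
theorem num_lim {η : M} (h : IsLimitOrd E η) : ∀ j, E (num E j) η
  | 0 => lim_emp_mem h
  | j + 1 => (isLimitOrd_iff.1 h).2.2 _ (num_lim h j)
section
variable {z0 : M} (hz : TransSet E z0) [ZN : ZFM (EN E z0)]
include hz
theorem restrN {f d r : Nn E z0} : IsRestrOfFn (EN E z0) f d r ↔ IsRestrOfFn E f.1 d.1 r.1 := by
  rw [restr_iff, restr_iff, funN hz]
  simp only [prN hz]
  refine and_congr_right fun _ => ⟨fun h x y => ?_, fun h x y => h x.1 y.1⟩
  constructor
  · intro k
    have a := WL_of_kp hz (WL_trans hz r.2 k)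
    exact (h ⟨x, a.1⟩ ⟨y, a.2⟩).1 k
  · intro k
    have a := WL_of_kp hz (WL_trans hz f.2 k.2)
    exact (h ⟨x, a.1⟩ ⟨y, a.2⟩).2 k
theorem pr3N {f x y w : Nn E z0} : EN E z0 (kp (EN E z0) x (kp (EN E z0) y w)) f ↔ E (kp E x.1 (kp E y.1 w.1)) f.1 := by
  rw [prN hz, kpN hz]
theorem pr3N' {f x y w : Nn E z0} : EN E z0 (kp (EN E z0) (kp (EN E z0) x y) w) f ↔ E (kp E (kp E x.1 y.1) w.1) f.1 := by
  rw [prN hz, kpN hz]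
theorem up3 {f : Nn E z0} {x y w : M} (h : E (kp E x (kp E y w)) f.1) : WL E z0 x ∧ WL E z0 y ∧ WL E z0 w :=
  have a := WL_of_kp hz (WL_trans hz f.2 h); ⟨a.1, WL_of_kp hz a.2⟩
theorem up3' {f : Nn E z0} {x y w : M} (h : E (kp E (kp E x y) w) f.1) : WL E z0 x ∧ WL E z0 y ∧ WL E z0 w :=
  have a := WL_of_kp hz (WL_trans hz f.2 h); have b := WL_of_kp hz a.1; ⟨b.1, b.2, a.2⟩
theorem MtN {K β t b : Nn E z0} : Mt (EN E z0) K β t b ↔ Mt E K.1 β.1 t.1 b.1 := by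
  unfold Mt
  simp only [restrN hz, pr3N hz, prN hz, scN hz]
  constructor
  · intro h ζ hζ
    obtain ⟨r, g, y, k⟩ := h ⟨ζ, WL_trans hz β.2 hζ⟩ hζ
    exact ⟨r.1, g.1, y.1, k⟩
  · intro h ζ hζ
    obtain ⟨r, g, y, k⟩ := h ζ.1 hζ
    have a := up3 hz k.2.2.2
    exact ⟨⟨r, a.1⟩, ⟨g, a.2.2⟩, ⟨y, a.2.1⟩, k⟩
theorem KPN {K T V1 : Nn E z0} {h X : M} (hT : IsTreeOn E T.1 h X) (hK : KP (EN E z0) K T V1) : KP E K.1 T.1 V1.1 := by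
  refine ⟨fun s y g k => ?_, fun s y g g' k k' => ?_, fun s g hs hg k => ?_⟩
  · have a := up3 hz k
    obtain ⟨h1, h2, h3, d, e, h4, h5, h6⟩ := hK.1 ⟨s, a.1⟩ ⟨y, a.2.1⟩ ⟨g, a.2.2⟩ ((pr3N hz).2 k)
    refine ⟨h1, h2, h3, d.1, e.1, ?_, (funN hz).1 h5, (restrN hz).1 h6⟩
    rw [isSuccOf_iff] at h4 ⊢; rw [h4, scN hz]
  · have a := up3 hz k
    have b := up3 hz k'
    exact congrArg Subtype.val (hK.2.1 ⟨s, a.1⟩ ⟨y, a.2.1⟩ ⟨g, a.2.2⟩ ⟨g', b.2.2⟩ ((pr3N hz).2 k) ((pr3N hz).2 k'))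
  · obtain ⟨d, e, h1, h2, h3⟩ := k
    rw [isSuccOf_iff] at h1
    have he : IsOrd E e := by
      obtain ⟨b, hb, _, hm⟩ := hT.1 g hg
      rw [dom_uniq h2 hm.1]; exact hb
    have hd : IsOrd E d := ord_mem he (by rw [h1]; exact mem_sc.2 (Or.inr rfl))
    obtain ⟨y, g', k⟩ := hK.2.2 ⟨s, WL_trans hz T.2 hs⟩ ⟨g, WL_trans hz T.2 hg⟩ hs hg ⟨⟨d, ord_WL hz d hd⟩, ⟨e, ord_WL hz e he⟩,
      isSuccOf_iff.2 (Subtype.ext (by rw [scN hz]; exact h1)), (funN hz).2 h2, (restrN hz).2 h3⟩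
    exact ⟨y.1, g'.1, (pr3N hz).1 k⟩
theorem pwnN (k : ℕ) : ∀ V : Nn E z0, TransSet E V.1 → (∀ x, E x (pwn E k V.1) → WL E z0 x) → (pwn (EN E z0) k V).1 = pwn E k V.1 := by
  induction k with
  | zero => exact fun _ _ _ => rfl
  | succ k ih =>
    intro V hV h
    have e : (pw (EN E z0) V).1 = pw E V.1 := eqN hz (fun z hz' => h z ((pwn_tr k (pw_tr hV)).2 z hz')) (fun z => by
      rw [mem_pw (E := EN E z0), mem_pw (E := E), subN hz])
    have := ih (pw (EN E z0) V) (by rw [e]; exact pw_tr hV) (by rw [e]; exact h)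
    rw [e] at this; exact this
theorem dec {V c η : Nn E z0} (hc : Cdg (EN E z0) η V c) (hv : ∀ y, SubsetE E y V.1 → WL E z0 y) {a b v1 : M} (hb : MapsTo E b a v1)
    (hv1 : ∀ A, E A v1 → SubsetE E A V.1) (ha : IsOrd E a) (hs : SubsetE E a η.1) : WL E z0 b := by
  have my : ∀ w, E w (sepS E V.1 (fun w => ∃ ξ A z, E (kp E ξ A) b ∧ E z A ∧ E (kp E (kp E ξ z) w) c.1)) ↔
    E w V.1 ∧ ∃ ξ A z, E (kp E ξ A) b ∧ E z A ∧ E (kp E (kp E ξ z) w) c.1 := fun w => mem_sepS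
  generalize sepS E V.1 (fun w => ∃ ξ A z, E (kp E ξ A) b ∧ E z A ∧ E (kp E (kp E ξ z) w) c.1) = y at my
  have wy : WL E z0 y := hv y fun w hw => ((my w).1 hw).1
  have sub : ∀ {ξ A}, E (kp E ξ A) b → SubsetE E A V.1 := fun h => hv1 _ (hb.2 _ _ (pairIn_iff.2 h))
  have D : ∀ (ξ A z : Nn E z0), E (kp E ξ.1 A.1) b → (E z.1 A.1 ↔ E z.1 V.1 ∧ ∃ w : Nn E z0, E w.1 y ∧ E (kp E (kp E ξ.1 z.1) w.1) c.1) := by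
    intro ξ A z h
    constructor
    · intro hzA
      obtain ⟨w, hw, k⟩ := hc.1 ξ z (hs _ (fun_dom hb.1 h)) (sub h _ hzA)
      rw [pr3N' hz] at k
      exact ⟨sub h _ hzA, w, (my _).2 ⟨hw, _, _, _, h, hzA, k⟩, k⟩
    · rintro ⟨_, w, hw, k⟩
      obtain ⟨_, ξ', A', z', h', hz', k'⟩ := (my _).1 hw
      have u := up3' hz k'
      have e := hc.2 ξ z ⟨ξ', u.1⟩ ⟨z', u.2.1⟩ w ((pr3N' hz).2 k) ((pr3N' hz).2 k')
      rw [e.1] at h; rw [e.2, fun_uniq hb.1 h h']; exact hz'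
  have val : ∀ x, E x a → ∃ A, ∃ (hx : WL E z0 x) (hA : WL E z0 A), E (kp E x A) b := fun x hx => by
    obtain ⟨A, hA⟩ := fun_val hb.1 hx
    exact ⟨A, ord_WL hz x (ord_mem ha hx), hv A (sub hA), hA⟩
  let yN : Nn E z0 := ⟨y, wy⟩
  have D' : ∀ (ξ A : Nn E z0), E (kp E ξ.1 A.1) b → ∀ z, EN E z0 z A ↔ EN E z0 z V ∧ ∃ w, EN E z0 w yN ∧ EN E z0 (kp (EN E z0) (kp (EN E z0) ξ z) w) c := by
    intro ξ A h z
    simp only [pr3N' hz]; exact D ξ A z h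
  obtain ⟨f, hf, hf2⟩ := fn_mk (E := EN E z0) ⟨a, ord_WL hz a ha⟩ (fun ξ A => ∀ z, EN E z0 z A ↔ EN E z0 z V ∧ ∃ w, EN E z0 w yN ∧ EN E z0 (kp (EN E z0) (kp (EN E z0) ξ z) w) c) (by
    intro x hx
    obtain ⟨A, hx', hA, h⟩ := val x.1 hx
    refine ⟨⟨A, hA⟩, D' x ⟨A, hA⟩ h, fun A' hA' => ext (E := EN E z0) fun z => ?_⟩
    rw [hA' z, D' x ⟨A, hA⟩ h z])
  have hf' := (funN hz).1 hf
  have bf : ∀ x A, E (kp E x A) b → E (kp E x A) f.1 := fun x A h => by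
    have hx := fun_dom hb.1 h
    exact (prN hz).1 ((hf2 ⟨x, ord_WL hz x (ord_mem ha hx)⟩ ⟨A, hv A (sub h)⟩).2 ⟨hx, D' ⟨x, ord_WL hz x (ord_mem ha hx)⟩ ⟨A, hv A (sub h)⟩ h⟩)
  have : b = f.1 := fun_ext hb.1 hf' fun x A => ⟨bf x A, fun h => by
    obtain ⟨A', _, _, h'⟩ := val x (fun_dom hf' h)
    rw [fun_uniq hf' h (bf _ _ h')]; exact h'⟩
  rw [this]; exact f.2
theorem core {h η V0 : M} {n : ℕ} (hη : IsLimitOrd E η) (hhη : E h η ∨ h = η) (hV0 : TransSet E V0) (hp : ∀ x y, E x V0 → E y V0 → E (kp E x y) V0)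
    (hs : SubsetE E η V0) (v1N z1N z0N jmN : Nn E z0) (e1 : v1N.1 = pwn E (n+1) V0) (hz1 : z1N.1 = sc E v1N.1) (hz00 : z0N.1 = z0)
    (hcond : ∀ R : Nn E z0 → Prop, (∀ i x y z, R x → R y → GOp (EN E z0) i z x y → R z) → (∀ x, EN E z0 x v1N → R x) → R v1N → R jmN →
      (∀ x, WL (EN E z0) z1N x → R x) → ∀ x, EN E z0 x z0N → R x)
    (hh : IsLimitOrd E h) (hDC : DCAt E h) : DCOn E h (WL E z0) := by
  intro X T hX hTW hT
  have hV0v : E V0 v1N.1 := by rw [e1]; exact (pwn_tr n (pw_tr hV0)).2 _ (mem_pw.2 fun _ h => h)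
  have hv1tr : TransSet E v1N.1 := by rw [e1]; exact (pwn_tr (n+1) hV0).1
  let V0N : Nn E z0 := ⟨V0, WL_trans hz v1N.2 hV0v⟩
  let ηN : Nn E z0 := ⟨η, ord_WL hz η hη.1⟩
  have hηN : IsLimitOrd (EN E z0) ηN := (limN hz).2 hη
  have ev : v1N = pw (EN E z0) (pwn (EN E z0) n V0N) := by
    rw [← pwn_sc]
    exact Subtype.ext (by rw [pwnN hz (n+1) V0N hV0 (fun x hx => WL_trans hz v1N.2 (by rw [e1]; exact hx)), e1])
  have hnum : ∀ j, EN E z0 (num (EN E z0) j) ηN := num_lim hηN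
  have hsN : SubsetE (EN E z0) ηN V0N := (subN hz).2 hs
  obtain ⟨c, hc⟩ := codn (E := EN E z0) (hnum 0) (hnum 1) n (hsN _ (lim_emp_mem hηN)) (cod0 hsN (fun x y hx hy => by
    rw [prN hz]; exact hp _ _ hx hy))
  generalize hVN : pwn (EN E z0) n V0N = VN at hc ev
  have hvv2 : ∀ y, E y v1N.1 ↔ SubsetE E y VN.1 := fun y => by
    have e2 : VN.1 = pwn E n V0 := by
      rw [← hVN]; refine pwnN hz n V0N hV0 fun x hx => WL_trans hz v1N.2 ?_
      rw [e1, pwn_sc]; exact pw_sub (pwn_tr n hV0).1 x hx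
    rw [e1, pwn_sc, ← e2]; exact mem_pw
  have hall : ∀ z, WL (EN E z0) z0N z := fun z => by
    have := WLN hz (z1 := z0N) (x := z.1) (by rw [hz00]; exact z.2)
    exact this.2
  have hgen := gen (E := EN E z0) (V1 := v1N) (z1 := z1N) (z0 := z0N) (jm := jmN) (fun j => hv1tr V0 hV0v _ (hs _ (hnum j)))
    (fun t ht => by
      have : E t.1 z1N.1 := ht
      rw [hz1] at this
      rcases mem_sc.1 this with h | h
      · exact Or.inl h
      · exact Or.inr (Subtype.ext h)) hcond hall
  obtain ⟨S, s1, s2, s3⟩ := sel (E := EN E z0) (V1 := v1N) (P := PP (EN E z0) VN c) (OP := OP (EN E z0) v1N z1N z0N jmN) OP_f PP_f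
    (fun a b ha hb => by rw [ev] at ha hb ⊢; exact PP_s (hnum 0) (hnum 1) hc a b ha hb) hgen ⟨T, hTW⟩
  obtain ⟨K, hK⟩ := kEx (E := EN E z0) s1 s2 s3
  have hKM := KPN hz hT hK
  rcases treeDC hKM hT hh hDC with ⟨t, ht, hb⟩ | ⟨a, b, ha, hah, hlim, hba, hmt, hno⟩
  · exact ⟨t, WL_trans hz hTW ht, hb⟩
  · have hsub : SubsetE E a η := by
      have : E a η ∨ a = η := by
        rcases hah with h1 | rfl
        · rcases hhη with h2 | rfl
          · exact Or.inl (hη.1.1 _ h2 _ h1)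
          · exact Or.inl h1
        · exact hhη
      rcases this with h1 | rfl
      · exact hη.1.1 _ h1
      · exact fun _ h => h
    have hbW : WL E z0 b := dec hz (η := ηN) hc (fun y hy => WL_trans hz v1N.2 ((hvv2 y).2 hy)) hba (fun A hA => (hvv2 A).1 hA) ha hsub
    obtain ⟨f, hf, hfm⟩ := limF (E := EN E z0) hK (a := ⟨a, ord_WL hz a ha⟩) (b := ⟨b, hbW⟩) ((ordN hz).2 ha) ((funN hz).2 hba.1) (fun ζ hζ => by
      obtain ⟨t, h1, h2, h3⟩ := hmt ζ.1 hζ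
      exact ⟨⟨t, WL_trans hz hTW h1⟩, h1, (funN hz).2 (by rw [scN hz]; exact h2), (MtN hz).2 (by rw [scN hz]; exact h3)⟩)
    have hf := (funN hz).1 hf
    have hfm := (MtN hz).1 hfm
    refine ⟨f.1, f.2, a, ha, hah, ⟨hf, fun x y hxy => ?_⟩, Or.inr ⟨hlim, fun h => hno _ h hf hfm, fun x hx => ?_⟩⟩
    · rw [pairIn_iff] at hxy
      obtain ⟨r, g, w, _, h2, _, h4⟩ := hfm x (fun_dom hf hxy)
      obtain ⟨_, _, _, hm⟩ := hT.1 g (hKM.1 _ _ _ h4).2.2.1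
      exact hm.2 x y (pairIn_iff.2 (((restr_iff.1 h2).2 x y).2 ⟨mem_sc.2 (Or.inr rfl), hxy⟩))
    · obtain ⟨r, g, w, h1, _, _, h4⟩ := hfm x hx
      exact ⟨r, (hKM.1 _ _ _ h4).1, h1⟩
end
theorem z0W {z0 : M} (hz : TransSet E z0) : WL E z0 z0 ∧ ∀ x, E x z0 → WL E z0 x := by
  have h0 : IsOrd E (emp E) := ord_emp
  obtain ⟨l0, hl0⟩ := LR_ex (z0 := z0) h0
  obtain ⟨l1, hl1⟩ := LR_ex (z0 := z0) (ord_sc h0)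
  refine ⟨⟨_, l1, hl1, ?_⟩, fun x hx => ⟨_, l0, hl0, (LR_main hz _ h0 l0 hl0).2.1 x hx⟩⟩
  have := ((LR_main hz _ (ord_sc h0) l1 hl1).2.2 _ _ (mem_sc.2 (Or.inr rfl)) hl0).2
  rwa [tri_zero def_tot hl0] at this
theorem lz_tr {v z : M} (hv : TransSet E v) (h : IsLZero E v z) : z = sc E v := by
  obtain ⟨t, ht, h⟩ := h
  refine ext (E := E) fun x => ?_
  rw [h, mem_sc (E := E)]
  exact or_congr ⟨fun k => ht.2.2 v (fun _ h => h) hv x k, fun k => ht.1 x k⟩ Iff.rfl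
theorem main {J : M → M → Prop} {l v1 v2L jm b h : M} (hev : IsEvenOrd E l) (hv1 : VAt E l 1 v1)
    (hJ : ∀ x y, J x y → InL E v1 x ∧ InL E v1 y) (hjm : CodesRestr E J v2L jm) (hb : IsUPair E b v1 jm)
    (hh : IsLimitOrd E h) (hhle : E h l ∨ h = l) (hDC : DCAt E h) : DCOn E h (InL E v1) ∧ DCOn E h (InL E b) := by
  obtain ⟨η, V0, n, h1, h2, h3, h4, h5, h6⟩ := vdata hev hv1 hh hhle
  have htr : TransSet E v1 := by rw [h6]; exact (pwn_tr (n+1) h3).1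
  obtain ⟨z1, hz1, _⟩ := lzero_ex (E := E) v1
  have ez1 := lz_tr htr hz1
  have i1 : ∀ x, InL E v1 x ↔ WL E z1 x := fun x => inL_iff hz1
  obtain ⟨t1, m1⟩ := lzero_trans hz1
  constructor
  · have := zfN t1
    have e : InL E v1 = WL E z1 := funext fun x => propext (i1 x)
    rw [e]
    have w := z0W t1
    refine core t1 h1 h2 h3 h4 h5 ⟨v1, w.2 _ m1⟩ ⟨z1, w.1⟩ ⟨z1, w.1⟩ ⟨v1, w.2 _ m1⟩ h6 ez1 rfl ?_ hh hDC
    intro R _ hR1 hR2 _ _ x hx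
    have mz : ∀ q, E q z1 → E q v1 ∨ q = v1 := fun q hq => by rw [ez1] at hq; exact mem_sc.1 hq
    rcases mz x.1 hx with k | k
    · exact hR1 x k
    · have : x = ⟨v1, w.2 _ m1⟩ := Subtype.ext k
      rw [this]; exact hR2
  · obtain ⟨z0, hz0, _⟩ := lzero_ex (E := E) b
    obtain ⟨t0, m0⟩ := lzero_trans hz0
    have := zfN t0
    have e : InL E b = WL E z0 := funext fun x => propext (inL_iff hz0)
    rw [e]
    have w := z0W t0
    rw [isUPair_iff] at hb
    have mv : E v1 z0 := t0 b m0 _ (by rw [hb]; exact mem_upr.2 (Or.inl rfl))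
    have mj : E jm z0 := t0 b m0 _ (by rw [hb]; exact mem_upr.2 (Or.inr rfl))
    have ws : (sc (EN E z0) ⟨v1, w.2 _ mv⟩ : Nn E z0).1 = z1 := by rw [scN t0, ez1]
    have wv : WL E z1 v1 := (z0W t1).2 _ m1
    have hJW : ∀ p, E p jm → ∃ x y, p = kp E x y ∧ WL E z1 x ∧ WL E z1 y := fun p hp => by
      obtain ⟨x, y, k⟩ := hjm.1.1.1 p hp
      rw [isKPair_iff] at k
      have := hJ x y (hjm.2 x y (pairIn_iff.2 (by rw [← k]; exact hp)))
      exact ⟨x, y, k, (i1 _).1 this.1, (i1 _).1 this.2⟩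
    obtain ⟨t, ht, hzt⟩ := hz0
    have cov : ∀ z, E z t → WL E z1 z ∨ z = jm ∨ E z jm ∨ ∃ p, E p jm ∧ E z p := by
      have mt : ∀ z, E z (sepS E t (fun z => WL E z1 z ∨ z = jm ∨ E z jm ∨ ∃ p, E p jm ∧ E z p)) ↔ E z t ∧ (WL E z1 z ∨ z = jm ∨ E z jm ∨ ∃ p, E p jm ∧ E z p) := fun z => mem_sepS
      intro z hz
      refine ((mt z).1 (ht.2.2 _ (fun x hx => (mt x).2 ⟨ht.1 x hx, ?_⟩) (fun y hy x hx => ?_) z hz)).2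
      · rw [hb] at hx
        rcases mem_upr.1 hx with rfl | rfl
        · exact Or.inl wv
        · exact Or.inr (Or.inl rfl)
      · obtain ⟨k1, k2⟩ := (mt y).1 hy
        refine (mt x).2 ⟨ht.2.1 y k1 x hx, ?_⟩
        rcases k2 with k | rfl | k | ⟨p, k, k'⟩
        · exact Or.inl (WL_trans t1 k hx)
        · exact Or.inr (Or.inr (Or.inl hx))
        · exact Or.inr (Or.inr (Or.inr ⟨y, k, hx⟩))
        · obtain ⟨u, v, rfl, hu, hv⟩ := hJW p k
          left
          rcases mem_upr.1 k' with rfl | rfl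
          · rw [mem_sing.1 hx]; exact hu
          · rcases mem_upr.1 hx with rfl | rfl
            exacts [hu, hv]
    refine core t0 h1 h2 h3 h4 h5 ⟨v1, w.2 _ mv⟩ (sc (EN E z0) ⟨v1, w.2 _ mv⟩) ⟨z0, w.1⟩ ⟨jm, w.2 _ mj⟩ h6 (scN t0 _) rfl ?_ hh hDC
    intro R hR0 hR1 hR2 hR3 hR4 x hx
    have rW : ∀ x : Nn E z0, WL E z1 x.1 → R x := fun x hx => hR4 x (WLN t0 (by rw [ws]; exact hx)).2
    have ru : ∀ x y, R x → R y → R (upr (EN E z0) x y) := fun x y hx hy => hR0 0 x y _ hx hy fun w => mem_upr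
    have wW : ∀ x, WL E z1 x → WL E z0 x := fun x hx => by
      rw [← ws] at hx; exact (WLN t0 hx).1
    have ru' : ∀ (z : Nn E z0) x y, z.1 = upr E x y → (∃ hx : WL E z0 x, R ⟨x, hx⟩) → (∃ hy : WL E z0 y, R ⟨y, hy⟩) → R z := by
      rintro z x y k ⟨hx, k1⟩ ⟨hy, k2⟩
      have : z = upr (EN E z0) ⟨x, hx⟩ ⟨y, hy⟩ := Subtype.ext (by rw [uprN t0, k])
      rw [this]; exact ru _ _ k1 k2
    rcases (hzt x.1).1 hx with k | k
    · rcases cov _ k with k | k | k | ⟨p, k, k'⟩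
      · exact rW x k
      · have : x = ⟨jm, w.2 _ mj⟩ := Subtype.ext k
        rw [this]; exact hR3
      · obtain ⟨u, v, hp, hu, hv⟩ := hJW _ k
        have ru : ∃ h : WL E z0 u, R ⟨u, h⟩ := ⟨wW u hu, rW ⟨u, wW u hu⟩ hu⟩
        have rv : ∃ h : WL E z0 v, R ⟨v, h⟩ := ⟨wW v hv, rW ⟨v, wW v hv⟩ hv⟩
        have wx : ∀ q, E q (kp E u v) → WL E z0 q := fun q hq => WL_trans t0 x.2 (by rw [hp]; exact hq)
        have q1 := wx (sing E u) (mem_upr.2 (Or.inl rfl))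
        have q2 := wx (upr E u v) (mem_upr.2 (Or.inr rfl))
        exact ru' x _ _ hp ⟨q1, ru' ⟨_, q1⟩ u u rfl ru ru⟩ ⟨q2, ru' ⟨_, q2⟩ u v rfl ru rv⟩
      · obtain ⟨u, v, rfl, hu, hv⟩ := hJW p k
        have ru : ∃ h : WL E z0 u, R ⟨u, h⟩ := ⟨wW u hu, rW ⟨u, wW u hu⟩ hu⟩
        have rv : ∃ h : WL E z0 v, R ⟨v, h⟩ := ⟨wW v hv, rW ⟨v, wW v hv⟩ hv⟩
        rcases mem_upr.1 k' with k' | k'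
        · exact ru' x u u k' ru ru
        · exact ru' x u v k' ru rv
    · exact ru' x _ _ (k.trans hb) ⟨_, hR2⟩ ⟨_, hR3⟩
end

/-!
STATEMENT 5.  Assume ZF + I_{0,λ} with λ even, `J : 𝓛 → 𝓛` elementary with
crit `< λ`, `jm = J↾V_{λ+2}^𝓛`, `𝓛[j⁻] = InL E b`, `b = {V_{λ+1}, jm}`.
If `h ≤ λ` is a limit ordinal and `h`-DC holds in `V`, then `h`-DC holds in
`𝓛 = L(V_{λ+1})` and in `𝓛[j⁻]`.
-/
theorem stmt_5 {M : Type} (E J : M → M → Prop) (l v1 v2L jm b h : M)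
    (hZF : SatZF E (JPred E J)) (hev : IsEvenOrd E l)
    (hv1 : VAt E l 1 v1) (hI0 : I0Emb E l v1 J)
    (hv2L : IsV2L E v1 v2L) (hjm : CodesRestr E J v2L jm) (hb : IsUPair E b v1 jm)
    (hh : IsLimitOrd E h) (hhle : E h l ∨ h = l) (hDC : DCAt E h) :
    DCOn E h (InL E v1) ∧ DCOn E h (InL E b) := by
  have := hZF.toZFM
  exact main hev hv1 hI0.1.1.2.1 hjm hb hh hhle hDC

end ZFI0
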